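/- Let k ≥ 5 be an integer. For every ε > 0 there exists a constant A > 0 such that for all real X ≥ 2, the series ∑_{n=1}^∞ P_k(n)² e^{−n/X} converges and |∑_{n=1}^∞ P_k(n)² e^{−n/X} − C_k Γ(k−1) X^{k−1}| ≤ A X^{k−2+ε}. -/

import Mathlib

open scoped Real

/-- `rk k m` = number of ways to write `m` as a sum of `k` integer squares. -/
noncomputable def rk (k m : ℕ) : ℕ :=
  Nat.card {v : Fin k → ℤ // (∑ i, (v i) ^ 2) = (m : ℤ)}

/-- `Sk k t` = number of lattice points of `ℤ^k` in the closed ball of radius `√t`. -/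
noncomputable def Sk (k : ℕ) (t : ℝ) : ℕ :=
  Nat.card {v : Fin k → ℤ // (∑ i, ((v i : ℝ)) ^ 2) ≤ t}

/-- `Vk k` = volume of the unit ball in `ℝ^k`. -/
noncomputable def Vk (k : ℕ) : ℝ :=
  Real.pi ^ ((k : ℝ) / 2) / Real.Gamma ((k : ℝ) / 2 + 1)

/-- `Pk k t` = lattice point discrepancy of the `k`-dimensional ball of radius `√t`. -/
noncomputable def Pk (k : ℕ) (t : ℝ) : ℝ :=
  (Sk k t : ℝ) - Vk k * t ^ ((k : ℝ) / 2)

/-- Value of the (analytically continued) Riemann zeta function at a real point. -/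
noncomputable def rzeta (x : ℝ) : ℝ := (riemannZeta (x : ℂ)).re

/-- The Riemann zeta function with its 2-factor removed. -/
noncomputable def rzeta2 (x : ℝ) : ℝ := (1 - (2 : ℝ) ^ (-x)) * rzeta x

/-- The constant `C_k` for `k ≥ 4`. -/
noncomputable def Ck (k : ℕ) : ℝ :=
  ((k : ℝ) ^ 2 / 24) * (Vk k) ^ 2 +
    Real.pi ^ (k : ℝ) * rzeta ((k : ℝ) - 2) * (1 + (2 : ℝ) ^ ((3 : ℝ) - (k : ℝ))) /
      (12 * (Real.Gamma ((k : ℝ) / 2)) ^ 2 * rzeta2 (k : ℝ))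

section
open MeasureTheory FourierTransform SchwartzMap
open scoped Real ENNReal ContDiff

theorem exists_Lp_norm_eq_of_fourier (F : Lp (α := ℝ) ℂ 2) :
    ∃ g : Lp (α := ℝ) ℂ 2, ‖g‖ = ‖F‖ ∧
      ∀ φ : 𝓢(ℝ, ℂ), ∫ x, φ x • g x = ∫ x, (𝓕 φ) x • F x := by
  refine ⟨𝓕 F, Lp.norm_fourier_eq F, fun φ => ?_⟩
  have key := congrArg (fun T => T φ) (Lp.fourier_toTemperedDistribution_eq F)
  simp only [TemperedDistribution.fourier_apply, Lp.toTemperedDistribution_apply] at key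
  exact key.symm

theorem integral_schwartz_smul_fourier (φ : 𝓢(ℝ, ℂ)) {f : ℝ → ℂ} (h1 : Integrable f) :
    ∫ x, φ x • (𝓕 f) x = ∫ x, (𝓕 φ) x • f x := by
  have := VectorFourier.integral_fourierIntegral_smul_eq_flip (L := innerₗ ℝ) (μ := volume)
    (ν := volume) (f := (φ : ℝ → ℂ)) (g := f) Real.continuous_fourierChar continuous_inner
    φ.integrable h1
  rw [flip_innerₗ] at this
  exact this.symm

theorem continuous_fourier_of_integrable {f : ℝ → ℂ} (h1 : Integrable f) : Continuous (𝓕 f) :=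
  VectorFourier.fourierIntegral_continuous Real.continuous_fourierChar
    (innerSL ℝ).continuous₂ h1

theorem exists_schwartzMap_eq {v : ℝ → ℂ} (hvc : HasCompactSupport v) (hv : ContDiff ℝ ∞ v) :
    ∃ φ : 𝓢(ℝ, ℂ), ∀ x, φ x = v x :=
  ⟨hvc.toSchwartzMap hv, fun _ => rfl⟩

theorem integral_testFunction_smul_eq {f : ℝ → ℂ} (h1 : Integrable f) {g : ℝ → ℂ}
    (h : ∀ φ : 𝓢(ℝ, ℂ), ∫ x, φ x • g x = ∫ x, (𝓕 φ) x • f x) {u : ℝ → ℝ} (hu : ContDiff ℝ ∞ u)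
    (huc : HasCompactSupport u) : ∫ x, u x • g x = ∫ x, u x • (𝓕 f) x := by
  have huc' : HasCompactSupport (fun x => (u x : ℂ)) :=
    HasCompactSupport.comp_left (g := Complex.ofReal) huc Complex.ofReal_zero
  have hu' : ContDiff ℝ ∞ (fun x => (u x : ℂ)) := Complex.ofRealCLM.contDiff.comp hu
  obtain ⟨φ, hφ⟩ : ∃ φ : 𝓢(ℝ, ℂ), ∀ x, φ x = (u x : ℂ) :=
    exists_schwartzMap_eq huc' hu'
  have := (h φ).trans (integral_schwartz_smul_fourier φ h1).symm
  simp only [hφ, smul_eq_mul] at this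
  simpa only [Complex.real_smul] using this

theorem ae_eq_of_forall_testFunction {g F : ℝ → ℂ} (hg : LocallyIntegrable g volume)
    (hL : LocallyIntegrable F volume)
    (H : ∀ u : ℝ → ℝ, ContDiff ℝ ∞ u → HasCompactSupport u →
      ∫ x, u x • g x = ∫ x, u x • F x) : ∀ᵐ x, g x = F x :=
  ae_eq_of_integral_contDiff_smul_eq hg hL H

theorem memLp_two_fourier_and_integral_norm_sq {f : ℝ → ℂ} (h1 : Integrable f)
    (h2 : MemLp f 2) : MemLp (𝓕 f) 2 ∧ ∫ x, ‖𝓕 f x‖ ^ 2 = ∫ x, ‖f x‖ ^ 2 := by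
  obtain ⟨g, hg, hφ⟩ := exists_Lp_norm_eq_of_fourier (h2.toLp f)
  have hae : ∀ᵐ x, g x = (𝓕 f) x := by
    refine ae_eq_of_forall_testFunction ((Lp.memLp g).locallyIntegrable (by norm_num))
      (continuous_fourier_of_integrable h1).locallyIntegrable fun u hu huc =>
      integral_testFunction_smul_eq h1 (fun φ => ?_) hu huc
    rw [hφ φ]
    refine integral_congr_ae ?_
    filter_upwards [h2.coeFn_toLp] with x hx
    rw [hx]
  refine ⟨(Lp.memLp g).ae_eq hae, ?_⟩
  have aux : ∀ g : Lp (α := ℝ) ℂ 2, ‖g‖ ^ 2 = ∫ x, ‖g x‖ ^ 2 := by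
    intro g
    have := L2.inner_def (𝕜 := ℂ) g g
    rw [inner_self_eq_norm_sq_to_K] at this
    simp only [inner_self_eq_norm_sq_to_K] at this
    have h3 : ((‖g‖ ^ 2 : ℝ) : ℂ) = ((∫ x, ‖g x‖ ^ 2 : ℝ) : ℂ) := by
      rw [← integral_complex_ofReal]
      push_cast
      exact this
    exact_mod_cast h3
  calc _ = ∫ x, ‖g x‖ ^ 2 := by
        refine integral_congr_ae ?_
        filter_upwards [hae] with x hx
        rw [hx]
    _ = ∫ x, ‖h2.toLp f x‖ ^ 2 := by rw [← aux, ← aux, hg]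
    _ = _ := by
        refine integral_congr_ae ?_
        filter_upwards [h2.coeFn_toLp] with x hx
        rw [hx]

/-- Plancherel's theorem on a vertical line for Laplace transforms. -/
theorem integral_norm_sq_laplace {R : ℝ → ℝ} {σ : ℝ}
    (h1 : IntegrableOn (fun t => R t * Real.exp (-σ * t)) (Set.Ioi 0))
    (h2 : IntegrableOn (fun t => R t ^ 2 * Real.exp (-(2 * σ) * t)) (Set.Ioi 0)) :
    Integrable (fun y : ℝ =>
      ‖∫ t in Set.Ioi (0 : ℝ), (R t : ℂ) * Complex.exp (-((σ : ℂ) + y * Complex.I) * t)‖ ^ 2) ∧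
    ∫ y : ℝ, ‖∫ t in Set.Ioi (0 : ℝ), (R t : ℂ) * Complex.exp (-((σ : ℂ) + y * Complex.I) * t)‖ ^ 2
      = 2 * π * ∫ t in Set.Ioi (0 : ℝ), R t ^ 2 * Real.exp (-(2 * σ) * t) := by
  set f : ℝ → ℂ := (Set.Ioi (0 : ℝ)).indicator (fun t => ((R t * Real.exp (-σ * t) : ℝ) : ℂ))
    with hf
  have hf1 : Integrable f := by
    rw [hf, integrable_indicator_iff measurableSet_Ioi]
    exact h1.ofReal
  have hsq : ∀ t, ‖f t‖ ^ 2 =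
      (Set.Ioi (0 : ℝ)).indicator (fun t => R t ^ 2 * Real.exp (-(2 * σ) * t)) t := by
    intro t
    by_cases ht : t ∈ Set.Ioi (0 : ℝ)
    · simp only [hf, Set.indicator_of_mem ht, Complex.norm_real, Real.norm_eq_abs, sq_abs, mul_pow]
      rw [← Real.exp_nat_mul]
      congr 2
      push_cast; ring
    · simp [hf, Set.indicator_of_notMem ht]
  have hf2 : MemLp f 2 := by
    rw [memLp_two_iff_integrable_sq_norm hf1.aestronglyMeasurable]
    simp_rw [hsq]
    rwa [integrable_indicator_iff measurableSet_Ioi]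
  have hF : ∀ ξ : ℝ, 𝓕 f ξ = ∫ t in Set.Ioi (0 : ℝ),
      (R t : ℂ) * Complex.exp (-((σ : ℂ) + ((2 * π * ξ : ℝ) : ℂ) * Complex.I) * t) := by
    intro ξ
    rw [Real.fourier_real_eq_integral_exp_smul, ← integral_indicator measurableSet_Ioi]
    refine integral_congr_ae (Filter.Eventually.of_forall fun t => ?_)
    by_cases ht : t ∈ Set.Ioi (0 : ℝ)
    · simp only [hf, Set.indicator_of_mem ht, smul_eq_mul]
      push_cast
      rw [mul_comm, mul_assoc, ← Complex.exp_add]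
      congr 2
      ring
    · simp [hf, Set.indicator_of_notMem ht]
  set G : ℝ → ℝ := fun y => ‖∫ t in Set.Ioi (0 : ℝ),
      (R t : ℂ) * Complex.exp (-((σ : ℂ) + y * Complex.I) * t)‖ ^ 2 with hG
  have hGF : ∀ ξ : ℝ, ‖𝓕 f ξ‖ ^ 2 = G (2 * π * ξ) := fun ξ => by rw [hF, hG]
  obtain ⟨hM, hP⟩ := memLp_two_fourier_and_integral_norm_sq hf1 hf2
  have hI : Integrable (fun ξ => ‖𝓕 f ξ‖ ^ 2) := (memLp_two_iff_integrable_sq_norm hM.1).1 hM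
  simp_rw [hGF] at hP hI
  constructor
  · exact (integrable_comp_mul_left_iff G (by positivity)).1 hI
  · rw [Measure.integral_comp_mul_left] at hP
    simp_rw [hsq] at hP
    rw [integral_indicator measurableSet_Ioi] at hP
    rw [← hP, abs_of_pos (by positivity), smul_eq_mul]
    field_simp

end

section
open Finset

/-- The quadratic Gauss sum `∑ e((c j² + l j)/q)` over residues modulo `q`. -/
noncomputable def quadGauss (q : ℕ) [NeZero q] (c l : ZMod q) : ℂ :=
  ∑ j : ZMod q, ZMod.stdAddChar (c * j ^ 2 + l * j)

theorem quadGauss_normSq (q : ℕ) [NeZero q] (c l : ZMod q) (hc : IsUnit c) :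
    ((‖quadGauss q c l‖ ^ 2 : ℝ) : ℂ) =
      q * ∑ h : ZMod q, if 2 * h = 0 then ZMod.stdAddChar (c * h ^ 2 + l * h) else 0 := by
  have h1 : ((‖quadGauss q c l‖ ^ 2 : ℝ) : ℂ) =
      ∑ h : ZMod q, ∑ y : ZMod q,
        ZMod.stdAddChar (c * h ^ 2 + l * h) * ZMod.stdAddChar (y * (2 * c * h)) := by
    push_cast
    rw [← Complex.mul_conj', quadGauss, map_sum, sum_mul_sum, sum_comm]
    conv_rhs => rw [sum_comm]
    refine sum_congr rfl fun y _ => ?_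
    rw [← Equiv.sum_comp (Equiv.addRight y)]
    refine sum_congr rfl fun h _ => ?_
    rw [← AddChar.map_neg_eq_conj, ← AddChar.map_add_eq_mul, ← AddChar.map_add_eq_mul]
    congr 1
    simp only [Equiv.coe_addRight]
    ring
  rw [h1, mul_sum]
  refine sum_congr rfl fun h _ => ?_
  rw [← mul_sum, AddChar.sum_mulShift _ (ZMod.isPrimitive_stdAddChar q), ZMod.card]
  have : 2 * c * h = 0 ↔ 2 * h = 0 := by
    rw [mul_comm 2 c, mul_assoc, hc.mul_right_eq_zero]
  simp only [this]
  split_ifs <;> simp [mul_comm]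

theorem zmod_two_mul_eq_zero {q : ℕ} [NeZero q] {h : ZMod q} (hh : 2 * h = 0) :
    h = 0 ∨ 2 * h.val = q := by
  have h1 : q ∣ 2 * h.val := by
    rw [← ZMod.natCast_eq_zero_iff]
    push_cast
    rwa [ZMod.natCast_zmod_val]
  have h2 := ZMod.val_lt h
  obtain ⟨m, hm⟩ := h1
  have : m < 2 := by
    by_contra hcon
    have : q * 2 ≤ q * m := Nat.mul_le_mul_left _ (by omega)
    omega
  interval_cases m
  · left
    rw [← ZMod.val_eq_zero]; omega
  · right; omega

theorem quadGauss_normSq_le (q : ℕ) [NeZero q] (c l : ZMod q) (hc : IsUnit c) :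
    ‖quadGauss q c l‖ ^ 2 ≤ 2 * q := by
  have h := congrArg norm (quadGauss_normSq q c l hc)
  rw [Complex.norm_real, Real.norm_of_nonneg (by positivity), norm_mul, Complex.norm_natCast] at h
  rw [h, mul_comm (2 : ℝ)]
  refine mul_le_mul_of_nonneg_left ?_ (by positivity)
  rw [← sum_filter]
  refine (norm_sum_le _ _).trans ?_
  simp only [AddChar.norm_apply, sum_const, nsmul_eq_mul, mul_one]
  have : (univ.filter fun h : ZMod q => 2 * h = 0) ⊆ {0, ((q / 2 : ℕ) : ZMod q)} := by
    intro h hh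
    simp only [mem_filter, mem_univ, true_and] at hh
    rcases zmod_two_mul_eq_zero hh with h0 | h0
    · simp [h0]
    · have : h.val = q / 2 := by omega
      simp [← this]
  exact_mod_cast (card_le_card this).trans card_le_two

theorem quadGauss_normSq_odd (q : ℕ) [NeZero q] (c : ZMod q) (hc : IsUnit c) (hq : Odd q) :
    ‖quadGauss q c 0‖ ^ 2 = q := by
  have h := quadGauss_normSq q c 0 hc
  rw [sum_eq_single 0] at h
  · simp only [mul_zero, if_true] at h
    simp only [ne_eq, OfNat.ofNat_ne_zero, not_false_eq_true, zero_pow, mul_zero, add_zero,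
      AddChar.map_zero_eq_one, mul_one] at h
    exact_mod_cast h
  · intro b _ hb
    rw [if_neg]
    intro hb'
    rcases zmod_two_mul_eq_zero hb' with h0 | h0
    · exact hb h0
    · obtain ⟨m, hm⟩ := hq
      omega
  · simp

theorem quadGauss_normSq_even (m : ℕ) [NeZero (2 * m)] (c : ℤ) (hc : IsUnit (c : ZMod (2 * m))) :
    ‖quadGauss (2 * m) c 0‖ ^ 2 = if Even m then 2 * ((2 * m : ℕ) : ℝ) else 0 := by
  have hm : 0 < m := by have := NeZero.ne (2 * m); omega
  have hcodd : Odd c := by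
    have := hc.map (ZMod.castHom (Dvd.intro _ rfl : 2 ∣ 2 * m) (ZMod 2))
    rw [map_intCast, isUnit_iff_ne_zero] at this
    rw [← Int.not_even_iff_odd]
    intro he
    exact this ((ZMod.intCast_zmod_eq_zero_iff_dvd c 2).2 he.two_dvd)
  have hne : (m : ZMod (2 * m)) ≠ 0 := by
    rw [Ne, ZMod.natCast_eq_zero_iff]
    intro hd
    have := Nat.le_of_dvd hm hd
    omega
  have h2m : (2 : ZMod (2 * m)) * (m : ZMod (2 * m)) = 0 := by
    have := ZMod.natCast_self (2 * m)
    push_cast at this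
    exact this
  have h := quadGauss_normSq (2 * m) (c : ZMod (2 * m)) 0 hc
  rw [← sum_subset (subset_univ {0, (m : ZMod (2 * m))}), sum_pair hne.symm] at h
  · simp only [mul_zero, if_true, h2m] at h
    simp only [ne_eq, OfNat.ofNat_ne_zero, not_false_eq_true, zero_pow, mul_zero, add_zero,
      AddChar.map_zero_eq_one, zero_mul] at h
    have hch : ZMod.stdAddChar ((c : ZMod (2 * m)) * (m : ZMod (2 * m)) ^ 2) =
        if Even m then (1 : ℂ) else -1 := by
      have e1 : ((c : ZMod (2 * m)) * (m : ZMod (2 * m)) ^ 2) =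
          ((c * (m : ℤ) ^ 2 : ℤ) : ZMod (2 * m)) := by push_cast; ring
      rw [e1, ZMod.stdAddChar_coe]
      have e2 : (2 * π * Complex.I * ((c * (m : ℤ) ^ 2 : ℤ) : ℂ) / ((2 * m : ℕ) : ℂ)) =
          ((c * m : ℤ) : ℂ) * (π * Complex.I) := by
        have : (m : ℂ) ≠ 0 := by exact_mod_cast hm.ne'
        push_cast
        field_simp
      rw [e2, Complex.exp_int_mul, Complex.exp_pi_mul_I]
      split_ifs with he
      · have : Even (c * (m : ℤ)) := by
          rw [Int.even_mul]; right; exact_mod_cast he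
        exact this.neg_one_zpow
      · have : Odd (c * (m : ℤ)) := by
          rw [Int.odd_mul]; exact ⟨hcodd, by rw [Int.odd_coe_nat]; exact Nat.not_even_iff_odd.1 he⟩
        exact this.neg_one_zpow
    rw [hch] at h
    split_ifs at h ⊢
    · have : (1 : ℂ) + 1 = 2 := by norm_num
      rw [this] at h
      refine (Eq.trans ?_ (mul_comm _ _))
      exact_mod_cast h
    · simp only [add_neg_cancel, mul_zero] at h
      exact_mod_cast h
  · intro x _ hx
    rw [if_neg]
    intro hx'
    rcases zmod_two_mul_eq_zero hx' with h0 | h0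
    · exact hx (by simp [h0])
    · have : x.val = m := by omega
      exact hx (by simp [← this])

/-- The theta series `∑ e^{-n² w}`. -/
noncomputable def thetaSum (w : ℂ) : ℂ := ∑' n : ℤ, Complex.exp (-((n : ℂ) ^ 2) * w)

theorem summable_exp_neg_quadratic {a : ℂ} (ha : 0 < a.re) (b : ℂ) :
    Summable fun n : ℤ => Complex.exp (-a * (n : ℂ) ^ 2 + b * n) := by
  have h := (summable_jacobiTheta₂_term_iff (b / (2 * π * Complex.I)) (a * Complex.I / π)).2 (by
    simp only [Complex.div_ofReal_im, Complex.mul_I_im]; positivity)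
  refine h.congr fun n => ?_
  rw [jacobiTheta₂_term]
  congr 1
  have : (π : ℂ) ≠ 0 := by exact_mod_cast Real.pi_ne_zero
  field_simp
  rw [Complex.I_sq]
  ring

theorem thetaSum_eq_sum {q : ℕ} [NeZero q] (a : ℤ) {v : ℂ} (hv : 0 < v.re) :
    thetaSum (v + 2 * π * Complex.I * a / q) =
      ∑ j : Fin q, ZMod.stdAddChar (((-a * (j : ℤ) ^ 2 : ℤ)) : ZMod q) *
        ∑' m : ℤ, Complex.exp (-((q : ℂ) ^ 2 * v) * (m + (j : ℂ) / q) ^ 2) := by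
  have hq : (q : ℂ) ≠ 0 := by exact_mod_cast NeZero.ne q
  have hs : Summable fun n : ℤ => Complex.exp (-((n : ℂ) ^ 2) * (v + 2 * π * Complex.I * a / q)) := by
    refine (summable_exp_neg_quadratic (a := v + 2 * π * Complex.I * a / q) ?_ 0).congr fun n => ?_
    · have : (2 * π * Complex.I * a / q : ℂ) = ((2 * π * a / q : ℝ) : ℂ) * Complex.I := by
        push_cast; ring
      rw [this]; simpa using hv
    · congr 1; ring
  rw [thetaSum, ← (Int.divModEquiv q).symm.tsum_eq]
  have hs' := ((Int.divModEquiv q).symm.summable_iff).2 hs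
  have hs'' := (Equiv.prodComm (Fin q) ℤ).summable_iff.2 hs'
  rw [← (Equiv.prodComm (Fin q) ℤ).tsum_eq]
  refine hs''.tsum_prod.trans ?_
  rw [tsum_fintype]
  refine sum_congr rfl fun j _ => ?_
  rw [← tsum_mul_left]
  refine tsum_congr fun m => ?_
  simp only [Function.comp_apply]
  rw [ZMod.stdAddChar_coe, ← Complex.exp_add]
  simp only [Equiv.prodComm_apply, Prod.swap_prod_mk, Int.divModEquiv_symm_apply]
  rw [Complex.exp_eq_exp_iff_exists_int]
  refine ⟨-(a * q * m ^ 2 + 2 * a * m * j), ?_⟩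
  push_cast
  field_simp
  ring

theorem thetaSum_eq_tsum_quadGauss {q : ℕ} [NeZero q] (a : ℤ) {v : ℂ} (hv : 0 < v.re) :
    thetaSum (v + 2 * π * Complex.I * a / q) = (π / ((q : ℂ) ^ 2 * v)) ^ (1 / 2 : ℂ) *
      ∑' l : ℤ, Complex.exp (-(π ^ 2 / ((q : ℂ) ^ 2 * v)) * (l : ℂ) ^ 2) *
        quadGauss q ((-a : ℤ) : ZMod q) ((-l : ℤ) : ZMod q) := by
  have hq : (q : ℂ) ≠ 0 := by exact_mod_cast NeZero.ne q
  have hv0 : v ≠ 0 := by rintro rfl; simp at hv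
  have hpi : (π : ℂ) ≠ 0 := by exact_mod_cast Real.pi_ne_zero
  set A : ℂ := π / ((q : ℂ) ^ 2 * v) with hA
  have hA0 : A ≠ 0 := by rw [hA]; exact div_ne_zero hpi (mul_ne_zero (pow_ne_zero _ hq) hv0)
  have hAre : 0 < A.re := by
    have : A = ((π / (q : ℝ) ^ 2 : ℝ) : ℂ) * v⁻¹ := by rw [hA]; push_cast; field_simp
    rw [this, Complex.re_ofReal_mul, Complex.inv_re]
    have hq' : (0 : ℝ) < q := by exact_mod_cast NeZero.pos q
    have := Complex.normSq_pos.2 hv0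
    positivity
  have hpA : 0 < (π * A).re := by rw [Complex.re_ofReal_mul]; positivity
  have hP : ∀ j : Fin q, ∑' m : ℤ, Complex.exp (-((q : ℂ) ^ 2 * v) * (m + (j : ℂ) / q) ^ 2) =
      A ^ (1 / 2 : ℂ) * ∑' l : ℤ, Complex.exp (-(π * A) * (l : ℂ) ^ 2 +
        (-(2 * π * Complex.I * j / q)) * l) := by
    intro j
    have h := Complex.tsum_exp_neg_quadratic hAre (-(Complex.I * j / q))
    have e1 : ∀ l : ℤ, Complex.exp (-π * A * (l : ℂ) ^ 2 + 2 * π * (-(Complex.I * j / q)) * l) =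
        Complex.exp (-(π * A) * (l : ℂ) ^ 2 + (-(2 * π * Complex.I * j / q)) * l) := by
      intro l; congr 1; ring
    have e2 : ∀ m : ℤ, Complex.exp (-π / A * ((m : ℂ) + Complex.I * (-(Complex.I * j / q))) ^ 2) =
        Complex.exp (-((q : ℂ) ^ 2 * v) * (m + (j : ℂ) / q) ^ 2) := by
      intro m
      have i1 : Complex.I * (-(Complex.I * j / q)) = (j : ℂ) / q := by
        have := Complex.I_mul_I
        linear_combination (-(j : ℂ) / q) * this
      have i2 : (-π / A : ℂ) = -((q : ℂ) ^ 2 * v) := by rw [hA]; field_simp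
      rw [i1, i2]
    simp_rw [e1, e2] at h
    rw [h, ← mul_assoc, mul_one_div_cancel, one_mul]
    rw [Complex.cpow_ne_zero_iff]; exact Or.inl hA0
  rw [thetaSum_eq_sum a hv]
  simp_rw [hP]
  have hsum : ∀ j : Fin q, ZMod.stdAddChar (((-a * (j : ℤ) ^ 2 : ℤ)) : ZMod q) *
      (A ^ (1 / 2 : ℂ) * ∑' l : ℤ, Complex.exp (-(π * A) * (l : ℂ) ^ 2 +
        (-(2 * π * Complex.I * j / q)) * l)) = A ^ (1 / 2 : ℂ) *
      ∑' l : ℤ, ZMod.stdAddChar (((-a * (j : ℤ) ^ 2 : ℤ)) : ZMod q) *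
        Complex.exp (-(π * A) * (l : ℂ) ^ 2 + (-(2 * π * Complex.I * j / q)) * l) := by
    intro j
    rw [tsum_mul_left]; ring
  simp_rw [hsum]
  rw [← mul_sum, ← Summable.tsum_finsetSum]
  swap
  · intro j _
    exact (summable_exp_neg_quadratic hpA _).mul_left _
  congr 1
  refine tsum_congr fun l => ?_
  have hG : quadGauss q ((-a : ℤ) : ZMod q) ((-l : ℤ) : ZMod q) =
      ∑ j : Fin q, ZMod.stdAddChar (((-a * (j : ℤ) ^ 2 + -l * j : ℤ)) : ZMod q) := by
    rw [quadGauss]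
    obtain ⟨p, rfl⟩ := Nat.exists_eq_succ_of_ne_zero (NeZero.ne q)
    refine sum_congr rfl fun j _ => ?_
    congr 1
    have hj : ((Fin.val (n := p + 1) j : ℕ) : ZMod (p + 1)) = j := ZMod.natCast_zmod_val (n := p + 1) j
    push_cast
    rw [hj]
  rw [hG, mul_sum]
  refine sum_congr rfl fun j _ => ?_
  rw [ZMod.stdAddChar_coe, ZMod.stdAddChar_coe, ← Complex.exp_add, ← Complex.exp_add]
  congr 1
  rw [hA]
  push_cast
  field_simp
  ring

theorem norm_pow_sub_pow_le_of_norm_le {x y : ℂ} {M : ℝ} (hx : ‖x‖ ≤ M) (hy : ‖y‖ ≤ M) (k : ℕ) :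
    ‖x ^ k - y ^ k‖ * M ≤ k * M ^ k * ‖x - y‖ := by
  have hM : 0 ≤ M := (norm_nonneg x).trans hx
  induction k with
  | zero => simp
  | succ k ih =>
    have e : x ^ (k + 1) - y ^ (k + 1) = x * (x ^ k - y ^ k) + (x - y) * y ^ k := by ring
    have h1 : ‖x ^ (k + 1) - y ^ (k + 1)‖ ≤ M * ‖x ^ k - y ^ k‖ + ‖x - y‖ * M ^ k := by
      rw [e]
      refine (norm_add_le _ _).trans ?_
      rw [norm_mul, norm_mul, norm_pow]
      gcongr
    calc _ ≤ (M * ‖x ^ k - y ^ k‖ + ‖x - y‖ * M ^ k) * M := by gcongr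
      _ = M * (‖x ^ k - y ^ k‖ * M) + ‖x - y‖ * M ^ (k + 1) := by ring
      _ ≤ M * (k * M ^ k * ‖x - y‖) + ‖x - y‖ * M ^ (k + 1) := by gcongr
      _ = _ := by push_cast; ring

theorem rpow_mul_exp_neg_le {B x : ℝ} (hB : 0 < B) (hx : 0 < x) :
    Real.exp (-x) ≤ B ^ B * x ^ (-B) := by
  have h1 : (x / B) ^ B ≤ Real.exp x := by
    calc (x / B) ^ B ≤ (Real.exp (x / B)) ^ B := by
          apply Real.rpow_le_rpow (by positivity) _ hB.le
          linarith [Real.add_one_le_exp (x / B)]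
      _ = Real.exp x := by rw [← Real.exp_mul]; congr 1; field_simp
  rw [Real.div_rpow hx.le hB.le, div_le_iff₀ (by positivity)] at h1
  rw [Real.exp_neg, Real.rpow_neg hx.le, inv_le_comm₀ (by positivity) (by positivity), mul_inv,
    inv_inv, inv_mul_le_iff₀ (by positivity)]
  linarith

/-- The leading term of the theta series near a rational point. -/
noncomputable def thetaMain (q : ℕ) [NeZero q] (a : ℤ) (v : ℂ) : ℂ :=
  (π / ((q : ℂ) ^ 2 * v)) ^ (1 / 2 : ℂ) * quadGauss q ((-a : ℤ) : ZMod q) 0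

theorem norm_cpow_half (z : ℂ) : ‖z ^ (1 / 2 : ℂ)‖ = √‖z‖ := by
  have := Complex.norm_cpow_real z (1 / 2)
  rw [Real.sqrt_eq_rpow, ← this]
  norm_num

theorem norm_quadGauss_le (q : ℕ) [NeZero q] (c l : ZMod q) (hc : IsUnit c) :
    ‖quadGauss q c l‖ ≤ √(2 * q) :=
  Real.le_sqrt_of_sq_le (quadGauss_normSq_le q c l hc)

theorem isUnit_neg_intCast {q : ℕ} {a : ℤ} (ha : IsCoprime a (q : ℤ)) :
    IsUnit ((-a : ℤ) : ZMod q) := by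
  rw [ZMod.coe_int_isUnit_iff_isCoprime, IsCoprime.neg_right_iff]
  exact ha.symm

theorem norm_cpow_half_mul_sqrt {q : ℕ} [NeZero q] {v : ℂ} (hv : 0 < v.re) :
    ‖(π / ((q : ℂ) ^ 2 * v)) ^ (1 / 2 : ℂ)‖ * √(2 * q) = √(2 * π / (q * ‖v‖)) := by
  have hq : (0 : ℝ) < q := by exact_mod_cast NeZero.pos q
  have hv0 : 0 < ‖v‖ := norm_pos_iff.2 (by rintro rfl; simp at hv)
  rw [norm_cpow_half, ← Real.sqrt_mul (by positivity)]
  congr 1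
  rw [norm_div, norm_mul, norm_pow, Complex.norm_real, Complex.norm_natCast,
    Real.norm_of_nonneg Real.pi_pos.le]
  field_simp

theorem norm_thetaMain_le {q : ℕ} [NeZero q] {a : ℤ} (ha : IsCoprime a (q : ℤ)) {v : ℂ}
    (hv : 0 < v.re) : ‖thetaMain q a v‖ ≤ √(2 * π / (q * ‖v‖)) := by
  rw [thetaMain, norm_mul, ← norm_cpow_half_mul_sqrt hv]
  gcongr
  exact norm_quadGauss_le _ _ _ (isUnit_neg_intCast ha)

theorem norm_thetaSum_sub_thetaMain_le {q : ℕ} [NeZero q] {a : ℤ} (ha : IsCoprime a (q : ℤ))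
    {v : ℂ} (hv : 0 < v.re) (hb : (q * ‖v‖) ^ 2 ≤ 41 * v.re) :
    ‖thetaSum (v + 2 * π * Complex.I * a / q) - thetaMain q a v‖ ≤
      √(2 * π / (q * ‖v‖)) * ((∑' l : ℤ, Real.exp (-(1 / 41) * (l : ℝ) ^ 2)) *
        Real.exp (-(v.re / (q * ‖v‖) ^ 2))) := by
  have hq : (0 : ℝ) < q := by exact_mod_cast NeZero.pos q
  have hv0 : 0 < ‖v‖ := norm_pos_iff.2 (by rintro rfl; simp at hv)
  have hu := isUnit_neg_intCast ha
  set ρ : ℝ := v.re / (q * ‖v‖) ^ 2 with hρ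
  have hρ0 : 1 / 41 ≤ ρ := by
    rw [hρ, le_div_iff₀ (by positivity)]; linarith
  have hre : (π ^ 2 / ((q : ℂ) ^ 2 * v) : ℂ).re = π ^ 2 * ρ := by
    have : (π ^ 2 / ((q : ℂ) ^ 2 * v) : ℂ) = ((π ^ 2 / (q : ℝ) ^ 2 : ℝ) : ℂ) * v⁻¹ := by
      push_cast; rw [div_mul_eq_div_div, div_eq_mul_inv _ v]
    rw [this, Complex.re_ofReal_mul, Complex.inv_re, Complex.normSq_eq_norm_sq, hρ]
    field_simp
  have hsR : Summable fun l : ℤ => Real.exp (-(1 / 41) * (l : ℝ) ^ 2) := by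
    have := (summable_exp_neg_quadratic (a := ((1 / 41 : ℝ) : ℂ))
      (by rw [Complex.ofReal_re]; norm_num) 0).norm
    refine this.congr fun l => ?_
    rw [Complex.norm_exp]
    congr 1
    have : (-((1 / 41 : ℝ) : ℂ) * (l : ℂ) ^ 2 + 0 * l) = ((-(1 / 41) * (l : ℝ) ^ 2 : ℝ) : ℂ) := by
      push_cast; ring
    rw [this, Complex.ofReal_re]
  set f : ℤ → ℂ := fun l => Complex.exp (-(π ^ 2 / ((q : ℂ) ^ 2 * v)) * (l : ℂ) ^ 2) *
        quadGauss q ((-a : ℤ) : ZMod q) ((-l : ℤ) : ZMod q) with hf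
  have hnorm : ∀ l : ℤ, ‖f l‖ ≤ Real.exp (-(π ^ 2 * ρ * (l : ℝ) ^ 2)) * √(2 * q) := by
    intro l
    rw [hf, norm_mul, Complex.norm_exp]
    have : (-(π ^ 2 / ((q : ℂ) ^ 2 * v)) * (l : ℂ) ^ 2).re = -(π ^ 2 * ρ * (l : ℝ) ^ 2) := by
      have e : (-(π ^ 2 / ((q : ℂ) ^ 2 * v)) * (l : ℂ) ^ 2) =
        ((-(l : ℝ) ^ 2 : ℝ) : ℂ) * (π ^ 2 / ((q : ℂ) ^ 2 * v)) := by push_cast; ring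
      rw [e, Complex.re_ofReal_mul, hre]; ring
    rw [this]
    gcongr
    exact norm_quadGauss_le _ _ _ hu
  have hpi : (2 : ℝ) ≤ π ^ 2 := by nlinarith [Real.pi_gt_three]
  have hnorm' : ∀ l : ℤ, ‖if l = 0 then 0 else f l‖ ≤
      (Real.exp (-ρ) * √(2 * q)) * Real.exp (-(1 / 41) * (l : ℝ) ^ 2) := by
    intro l
    split_ifs with hl
    · simp; positivity
    · refine (hnorm l).trans ?_
      have hl1 : (1 : ℝ) ≤ (l : ℝ) ^ 2 := by
        have : (1 : ℤ) ≤ l ^ 2 := by have := sq_pos_of_ne_zero hl; omega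
        exact_mod_cast this
      rw [mul_right_comm (Real.exp (-ρ)), ← Real.exp_add]
      gcongr
      nlinarith [mul_le_mul hpi (mul_le_mul hρ0 hl1 (by norm_num) (by linarith)) (by norm_num) (by positivity),
        mul_le_mul_of_nonneg_right hρ0 (by positivity : 0 ≤ (l : ℝ) ^ 2),
        mul_le_mul_of_nonneg_left hl1 (by linarith : 0 ≤ ρ),
        mul_le_mul_of_nonneg_right hpi (by positivity : 0 ≤ ρ * (l : ℝ) ^ 2)]
  have hs0 : Summable fun l : ℤ => if l = 0 then 0 else f l :=
    Summable.of_norm_bounded (hsR.mul_left _) hnorm'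
  have hsf : Summable f := by
    refine (summable_congr_cofinite ?_).2 hs0
    have : ({0} : Set ℤ)ᶜ ∈ Filter.cofinite := (Set.finite_singleton 0).compl_mem_cofinite
    filter_upwards [this] with l hl
    rw [if_neg (by simpa using hl)]
  have key : thetaSum (v + 2 * π * Complex.I * a / q) - thetaMain q a v =
      (π / ((q : ℂ) ^ 2 * v)) ^ (1 / 2 : ℂ) * ∑' l : ℤ, if l = 0 then 0 else f l := by
    rw [thetaSum_eq_tsum_quadGauss a hv, thetaMain, ← mul_sub]
    congr 1
    rw [hsf.tsum_eq_add_tsum_ite 0]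
    simp [hf]
  rw [key, norm_mul, ← norm_cpow_half_mul_sqrt hv]
  calc _ ≤ ‖(π / ((q : ℂ) ^ 2 * v)) ^ (1 / 2 : ℂ)‖ *
        ∑' l : ℤ, (Real.exp (-ρ) * √(2 * q)) * Real.exp (-(1 / 41) * (l : ℝ) ^ 2) := by
        gcongr
        exact tsum_of_norm_bounded (hsR.mul_left _).hasSum hnorm'
    _ = _ := by rw [tsum_mul_left]; ring

theorem sqrt_pow_eq {k : ℕ} {x : ℝ} (hx : 0 < x) :
    √(2 * π / x) ^ k = (2 * π) ^ ((k : ℝ) / 2) * x ^ (-((k : ℝ) / 2)) := by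
  rw [Real.sqrt_eq_rpow, ← Real.rpow_natCast, ← Real.rpow_mul (by positivity),
    Real.div_rpow (by positivity) hx.le, Real.rpow_neg hx.le, div_eq_mul_inv]
  congr 2 <;> ring_nf

theorem norm_thetaMain_pow_le (k : ℕ) {q : ℕ} [NeZero q] {a : ℤ} (ha : IsCoprime a (q : ℤ)) {v : ℂ}
    (hv : 0 < v.re) :
    ‖thetaMain q a v ^ k‖ ≤ (2 * π) ^ ((k : ℝ) / 2) * (q * ‖v‖) ^ (-((k : ℝ) / 2)) := by
  have hq : (0 : ℝ) < q := by exact_mod_cast NeZero.pos q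
  have hv0 : 0 < ‖v‖ := norm_pos_iff.2 (by rintro rfl; simp at hv)
  rw [norm_pow, ← sqrt_pow_eq (by positivity)]
  gcongr
  exact norm_thetaMain_le ha hv

theorem exists_norm_thetaSum_pow_sub_le (k : ℕ) {B : ℝ} (hB : 0 < B) :
    ∃ C : ℝ, 0 < C ∧ ∀ (q : ℕ) [NeZero q] (a : ℤ) (v : ℂ), IsCoprime a (q : ℤ) → 0 < v.re →
      (q * ‖v‖) ^ 2 ≤ 41 * v.re →
      ‖thetaSum (v + 2 * π * Complex.I * a / q) ^ k - thetaMain q a v ^ k‖ ≤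
        C * ((q * ‖v‖) ^ (-((k : ℝ) / 2)) * ((q * ‖v‖) ^ 2 / v.re) ^ B) := by
  set c : ℝ := ∑' l : ℤ, Real.exp (-(1 / 41) * (l : ℝ) ^ 2) with hc
  have hc0 : 0 ≤ c := tsum_nonneg fun _ => (Real.exp_pos _).le
  refine ⟨k * (1 + c) ^ k * (2 * π) ^ ((k : ℝ) / 2) * c * B ^ B + 1, by positivity, ?_⟩
  intro q _ a v ha hv hb
  have hq : (0 : ℝ) < q := by exact_mod_cast NeZero.pos q
  have hv0 : 0 < ‖v‖ := norm_pos_iff.2 (by rintro rfl; simp at hv)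
  have hx : 0 < q * ‖v‖ := by positivity
  set D : ℝ := √(2 * π / (q * ‖v‖)) with hD
  have hD0 : 0 < D := by positivity
  set ρ : ℝ := v.re / (q * ‖v‖) ^ 2 with hρ
  have hρ0 : 0 < ρ := by positivity
  have h1 := norm_thetaSum_sub_thetaMain_le ha hv hb
  rw [← hD, ← hc] at h1
  have h2 := norm_thetaMain_le ha hv
  rw [← hD] at h2
  set x := thetaSum (v + 2 * π * Complex.I * a / q)
  set y := thetaMain q a v
  have he1 : Real.exp (-ρ) ≤ 1 := by rw [Real.exp_le_one_iff]; linarith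
  have hy : ‖y‖ ≤ D * (1 + c) := h2.trans (by nlinarith)
  have hxn : ‖x‖ ≤ D * (1 + c) := by
    have : ‖x‖ ≤ ‖x - y‖ + ‖y‖ := by simpa using norm_add_le (x - y) y
    have h3 : D * (c * Real.exp (-ρ)) ≤ D * c := by
      have := mul_le_mul_of_nonneg_left he1 hc0
      rw [mul_one] at this
      gcongr
    linarith
  have h3 := norm_pow_sub_pow_le_of_norm_le hxn hy k
  have h4 : ‖x ^ k - y ^ k‖ * (D * (1 + c)) ≤
      (k * (D * (1 + c)) ^ k * (c * Real.exp (-ρ))) * (D * (1 + c)) := by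
    refine h3.trans ?_
    have : ‖x - y‖ ≤ (c * Real.exp (-ρ)) * (D * (1 + c)) := by
      refine h1.trans ?_
      have : 0 ≤ D * (c * Real.exp (-ρ)) * c := by positivity
      nlinarith
    calc _ ≤ k * (D * (1 + c)) ^ k * ((c * Real.exp (-ρ)) * (D * (1 + c))) := by gcongr
      _ = _ := by ring
  have h5 := le_of_mul_le_mul_right h4 (by positivity)
  have h6 := rpow_mul_exp_neg_le hB hρ0
  have h7 : ρ ^ (-B) = ((q * ‖v‖) ^ 2 / v.re) ^ B := by
    rw [hρ, Real.rpow_neg (by positivity), ← Real.inv_rpow (by positivity), inv_div]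
  rw [h7] at h6
  calc _ ≤ k * (D * (1 + c)) ^ k * (c * (B ^ B * ((q * ‖v‖) ^ 2 / v.re) ^ B)) := by
        refine h5.trans ?_
        gcongr
    _ = (k * (1 + c) ^ k * (2 * π) ^ ((k : ℝ) / 2) * c * B ^ B) *
      ((q * ‖v‖) ^ (-((k : ℝ) / 2)) * ((q * ‖v‖) ^ 2 / v.re) ^ B) := by
        rw [mul_pow, hD, sqrt_pow_eq hx]; ring
    _ ≤ _ := by
        gcongr
        linarith

end

section
open Finset MeasureTheory

theorem summable_exp_neg_sq_mul {w : ℂ} (hw : 0 < w.re) :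
    Summable fun n : ℤ => ‖Complex.exp (-((n : ℂ) ^ 2) * w)‖ := by
  refine ((summable_exp_neg_quadratic hw 0).norm).congr fun n => ?_
  congr 2; ring

theorem hasSum_exp_neg_normSq_mul (k : ℕ) {w : ℂ} (hw : 0 < w.re) :
    (Summable fun v : Fin k → ℤ => ‖Complex.exp (-((∑ i, (v i : ℝ) ^ 2 : ℝ) : ℂ) * w)‖) ∧
    ∑' v : Fin k → ℤ, Complex.exp (-((∑ i, (v i : ℝ) ^ 2 : ℝ) : ℂ) * w) = thetaSum w ^ k := by
  induction k with
  | zero =>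
    refine ⟨Summable.of_finite, ?_⟩
    simp
  | succ k ih =>
    have e : ∀ p : ℤ × (Fin k → ℤ),
        Complex.exp (-((∑ i, ((Fin.consEquiv (fun _ : Fin (k+1) => ℤ) p i : ℤ) : ℝ) ^ 2 : ℝ) : ℂ) * w)
        = Complex.exp (-((p.1 : ℂ) ^ 2) * w) *
          Complex.exp (-((∑ i, (p.2 i : ℝ) ^ 2 : ℝ) : ℂ) * w) := by
      intro p
      rw [← Complex.exp_add, Fin.sum_univ_succ]
      congr 1
      simp only [Fin.consEquiv_apply, Fin.cons_zero, Fin.cons_succ]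
      push_cast; ring
    constructor
    · rw [← (Fin.consEquiv (fun _ : Fin (k+1) => ℤ)).summable_iff]
      simp only [Function.comp_def, e]
      exact Summable.mul_norm (f := fun n : ℤ => Complex.exp (-((n : ℂ) ^ 2) * w))
        (g := fun v : Fin k → ℤ => Complex.exp (-((∑ i, (v i : ℝ) ^ 2 : ℝ) : ℂ) * w))
        (summable_exp_neg_sq_mul hw) ih.1
    · rw [← (Fin.consEquiv (fun _ : Fin (k+1) => ℤ)).tsum_eq]
      simp only [e]
      rw [← tsum_mul_tsum_of_summable_norm (summable_exp_neg_sq_mul hw) ih.1, ih.2, pow_succ',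
        thetaSum]

theorem abs_le_of_sum_sq_le {k : ℕ} {t : ℝ} {v : Fin k → ℤ} (hv : ∑ i, (v i : ℝ) ^ 2 ≤ t)
    (i : Fin k) : v i ∈ Finset.Icc (-⌊√t⌋) ⌊√t⌋ := by
  have h : (v i : ℝ) ^ 2 ≤ t :=
    (single_le_sum (f := fun i => (v i : ℝ) ^ 2) (fun j _ => sq_nonneg _) (mem_univ i)).trans hv
  have h2 := Real.abs_le_sqrt h
  rw [abs_le] at h2
  rw [Finset.mem_Icc]
  constructor
  · have : -(v i) ≤ ⌊√t⌋ := Int.le_floor.2 (by push_cast; linarith)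
    linarith
  · exact Int.le_floor.2 h2.2

theorem finite_sum_sq_le (k : ℕ) (t : ℝ) : {v : Fin k → ℤ | ∑ i, (v i : ℝ) ^ 2 ≤ t}.Finite := by
  refine (Fintype.piFinset fun _ : Fin k => Finset.Icc (-⌊√t⌋) ⌊√t⌋).finite_toSet.subset
    fun v hv => ?_
  exact Fintype.mem_piFinset.2 fun i => abs_le_of_sum_sq_le hv i

theorem Sk_le (k : ℕ) {t : ℝ} (ht : 0 ≤ t) : (Sk k t : ℝ) ≤ (3 * (1 + t)) ^ k := by
  have h : Sk k t ≤ (Fintype.piFinset fun _ : Fin k => Finset.Icc (-⌊√t⌋) ⌊√t⌋).card := by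
    rw [← Set.ncard_coe_finset]
    exact Set.ncard_le_ncard (fun v hv => Fintype.mem_piFinset.2 fun i => abs_le_of_sum_sq_le hv i)
      (Finset.finite_toSet _)
  have h1 : ((Finset.Icc (-⌊√t⌋) ⌊√t⌋).card : ℝ) ≤ 3 * (1 + t) := by
    have h0 : 0 ≤ ⌊√t⌋ := Int.floor_nonneg.2 (Real.sqrt_nonneg _)
    have hc : ((Finset.Icc (-⌊√t⌋) ⌊√t⌋).card : ℤ) = 2 * ⌊√t⌋ + 1 := by
      rw [Int.card_Icc_of_le] <;> linarith
    have hc' : ((Finset.Icc (-⌊√t⌋) ⌊√t⌋).card : ℝ) = 2 * ⌊√t⌋ + 1 := by exact_mod_cast hc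
    rw [hc']
    have := Int.floor_le (√t)
    nlinarith [Real.sq_sqrt ht, Real.sqrt_nonneg t, sq_nonneg (√t - 1)]
  calc (Sk k t : ℝ) ≤ ((Fintype.piFinset fun _ : Fin k => Finset.Icc (-⌊√t⌋) ⌊√t⌋).card : ℝ) := by
        exact_mod_cast h
    _ = ((Finset.Icc (-⌊√t⌋) ⌊√t⌋).card : ℝ) ^ k := by rw [Fintype.card_piFinset]; simp
    _ ≤ _ := by gcongr

theorem Sk_mono (k : ℕ) : Monotone (Sk k) := by
  intro s t h
  exact Nat.card_mono (finite_sum_sq_le k t) fun v hv => le_trans hv h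

theorem integrableOn_rpow_mul_exp_neg_mul {a σ : ℝ} (ha : -1 < a) (hσ : 0 < σ) :
    IntegrableOn (fun t : ℝ => t ^ a * Real.exp (-σ * t)) (Set.Ioi 0) := by
  simpa using integrableOn_rpow_mul_exp_neg_mul_rpow (p := 1) ha one_pos hσ

theorem integral_rpow_mul_cexp_neg_mul_Ioi {a : ℝ} (ha : 0 < a) {w : ℂ} (hw : 0 < w.re) :
    ∫ t in Set.Ioi (0 : ℝ), ((t ^ (a - 1) : ℝ) : ℂ) * Complex.exp (-w * t) =
      (1 / w) ^ (a : ℂ) * Real.Gamma a := by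
  set μ : Measure ℝ := (volume.restrict (Set.Ioi (0 : ℝ))).withDensity
    (fun t => ENNReal.ofReal (t ^ (a - 1))) with hμ
  have hm : Measurable fun t : ℝ => ENNReal.ofReal (t ^ (a - 1)) := by fun_prop
  have hto : ∀ t ∈ Set.Ioi (0 : ℝ), (ENNReal.ofReal (t ^ (a - 1))).toReal = t ^ (a - 1) :=
    fun t ht => ENNReal.toReal_ofReal (Real.rpow_nonneg (le_of_lt ht) _)
  have hset : Set.Iio (0 : ℝ) ⊆ interior (ProbabilityTheory.integrableExpSet id μ) := by
    refine interior_maximal (fun x hx => ?_) isOpen_Iio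
    change Integrable _ _
    rw [hμ, integrable_withDensity_iff_integrable_smul' hm (by simp)]
    have h := integrableOn_rpow_mul_exp_neg_mul (a := a - 1) (σ := -x) (by linarith)
      (by simpa using hx)
    refine IntegrableOn.congr_fun h (fun t ht => ?_) measurableSet_Ioi
    simp only [hto t ht, smul_eq_mul, id, neg_neg]
  set U : Set ℂ := {z : ℂ | 0 < z.re} with hU
  have hUo : IsOpen U := isOpen_lt continuous_const Complex.continuous_re
  have hf : AnalyticOnNhd ℂ (fun z => ProbabilityTheory.complexMGF id μ (-z)) U := by
    refine DifferentiableOn.analyticOnNhd (fun z hz => ?_) hUo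
    have h1 := (ProbabilityTheory.hasDerivAt_complexMGF (X := id) (μ := μ) (z := -z) (hset (by
      have hz' : 0 < z.re := hz
      simpa using hz'))).differentiableAt
    exact (h1.comp z differentiableAt_id.neg).differentiableWithinAt
  have hne : ∀ z ∈ U, (1 / z) ∈ Complex.slitPlane := by
    intro z hz
    have hz0 : z ≠ 0 := by rintro rfl; simp [hU] at hz
    left
    rw [one_div, Complex.inv_re]
    exact div_pos hz (Complex.normSq_pos.2 hz0)
  have hg : AnalyticOnNhd ℂ (fun z => (1 / z) ^ (a : ℂ) * (Real.Gamma a : ℂ)) U := by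
    refine DifferentiableOn.analyticOnNhd (fun z hz => ?_) hUo
    have hz0 : z ≠ 0 := by rintro rfl; simp [hU] at hz
    refine DifferentiableAt.differentiableWithinAt ?_
    refine DifferentiableAt.mul_const ?_ _
    refine DifferentiableAt.cpow_const ?_ (hne z hz)
    exact (differentiableAt_const _).div differentiableAt_id hz0
  have hint : ∀ z : ℂ, ProbabilityTheory.complexMGF id μ (-z) =
      ∫ t in Set.Ioi (0 : ℝ), ((t ^ (a - 1) : ℝ) : ℂ) * Complex.exp (-z * t) := by
    intro z
    rw [ProbabilityTheory.complexMGF, hμ, integral_withDensity_eq_integral_toReal_smul hm (by simp)]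
    refine setIntegral_congr_fun measurableSet_Ioi fun t ht => ?_
    simp only [hto t ht, id, Complex.real_smul]
  have hreal : ∀ x : ℝ, 0 < x → ProbabilityTheory.complexMGF id μ (-(x : ℂ)) =
      (1 / (x : ℂ)) ^ (a : ℂ) * (Real.Gamma a : ℂ) := by
    intro x hx
    rw [hint]
    have h := Real.integral_rpow_mul_exp_neg_mul_Ioi ha hx
    have h2 := congrArg (fun r : ℝ => (r : ℂ)) h
    rw [← integral_complex_ofReal] at h2
    push_cast at h2
    rw [Complex.ofReal_cpow (by positivity)] at h2
    push_cast at h2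
    rw [← h2]
    refine integral_congr_ae (Filter.Eventually.of_forall fun t => ?_)
    simp
  have hfreq : ∃ᶠ z in nhdsWithin (1 : ℂ) {1}ᶜ, ProbabilityTheory.complexMGF id μ (-z) =
      (1 / z) ^ (a : ℂ) * (Real.Gamma a : ℂ) := by
    have ht : Filter.Tendsto (fun n : ℕ => (((1 + 1 / ((n : ℝ) + 1) : ℝ)) : ℂ)) Filter.atTop
        (nhdsWithin (1 : ℂ) {1}ᶜ) := by
      rw [tendsto_nhdsWithin_iff]
      constructor
      · have : Filter.Tendsto (fun n : ℕ => 1 + 1 / ((n : ℝ) + 1)) Filter.atTop (nhds (1 + 0)) :=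
          tendsto_const_nhds.add tendsto_one_div_add_atTop_nhds_zero_nat
        rw [add_zero] at this
        exact_mod_cast (Complex.continuous_ofReal.tendsto 1).comp this
      · refine Filter.Eventually.of_forall fun n => ?_
        have : (0 : ℝ) < 1 / ((n : ℝ) + 1) := by positivity
        simp only [Set.mem_compl_iff, Set.mem_singleton_iff]
        intro h
        have h' : (1 + 1 / ((n : ℝ) + 1)) = 1 := by exact_mod_cast h
        linarith
    refine ht.frequently (Filter.Frequently.of_forall fun n => hreal _ (by positivity))
  have := AnalyticOnNhd.eqOn_of_preconnected_of_frequently_eq hf hg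
    (convex_halfSpace_re_gt 0).isPreconnected (z₀ := 1) (by simp [hU]) hfreq
  rw [← hint]
  exact this hw

/-- The centred discrepancy `P_k(t) + (k/4) V_k t^{k/2-1}`. -/
noncomputable def centredPk (k : ℕ) (t : ℝ) : ℝ :=
  Pk k t + (k : ℝ) / 4 * Vk k * t ^ ((k : ℝ) / 2 - 1)

theorem measurable_Sk (k : ℕ) : Measurable fun t : ℝ => (Sk k t : ℝ) :=
  (Nat.mono_cast.comp (Sk_mono k)).measurable

theorem measurable_centredPk (k : ℕ) : Measurable (centredPk k) := by
  unfold centredPk Pk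
  have := measurable_Sk k
  fun_prop

theorem Vk_nonneg (k : ℕ) : 0 ≤ Vk k := by
  unfold Vk
  have := Real.Gamma_pos_of_pos (s := (k : ℝ) / 2 + 1) (by positivity)
  positivity

theorem Sk_eq_tsum (k : ℕ) (t : ℝ) (c : ℂ) :
    (Sk k t : ℂ) * c = ∑' v : Fin k → ℤ, Set.indicator (Set.Ici (∑ i, (v i : ℝ) ^ 2)) (fun _ => c) t := by
  have hfin := finite_sum_sq_le k t
  rw [tsum_eq_sum (s := hfin.toFinset)]
  · rw [Finset.sum_congr rfl (g := fun _ => c)]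
    · rw [sum_const, nsmul_eq_mul, ← Set.ncard_eq_toFinset_card _ hfin]
      rfl
    · intro v hv
      have : ∑ i, (v i : ℝ) ^ 2 ≤ t := by simpa using hv
      exact Set.indicator_of_mem (s := Set.Ici _) this _
  · intro v hv
    have : ¬ ∑ i, (v i : ℝ) ^ 2 ≤ t := by simpa using hv
    exact Set.indicator_of_notMem (s := Set.Ici _) this _

theorem integral_Sk_mul_cexp (k : ℕ) {w : ℂ} (hw : 0 < w.re) :
    ∫ t in Set.Ioi (0 : ℝ), (Sk k t : ℂ) * Complex.exp (-w * t) = thetaSum w ^ k / w := by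
  have hw0 : w ≠ 0 := by rintro rfl; simp at hw
  have hre : (-w).re < 0 := by simpa using hw
  set N : (Fin k → ℤ) → ℝ := fun v => ∑ i, (v i : ℝ) ^ 2 with hN
  have hN0 : ∀ v, 0 ≤ N v := fun v => sum_nonneg fun i _ => sq_nonneg _
  set F : (Fin k → ℤ) → ℝ → ℂ := fun v t =>
    Set.indicator (Set.Ici (N v)) (fun t : ℝ => Complex.exp (-w * t)) t with hF
  have hint : ∀ v, Integrable (F v) (volume.restrict (Set.Ioi 0)) := by
    intro v
    have h1 : IntegrableOn (fun t : ℝ => Complex.exp (-w * t)) (Set.Ici (N v)) := by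
      rw [integrableOn_Ici_iff_integrableOn_Ioi]
      exact integrableOn_exp_mul_complex_Ioi hre _
    exact ((integrable_indicator_iff measurableSet_Ici).2 h1).integrableOn
  have key : ∀ (v : Fin k → ℤ) {E : Type} [NormedAddCommGroup E] [NormedSpace ℝ E] (f : ℝ → E),
      ∫ t in Set.Ioi (0 : ℝ), Set.indicator (Set.Ici (N v)) f t = ∫ t in Set.Ioi (N v), f t := by
    intro v E _ _ f
    rw [← integral_Ici_eq_integral_Ioi (x := (0 : ℝ)), setIntegral_indicator measurableSet_Ici,
      Set.inter_eq_self_of_subset_right (Set.Ici_subset_Ici.2 (hN0 v)), integral_Ici_eq_integral_Ioi]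
  have hval : ∀ v, ∫ t in Set.Ioi (0 : ℝ), F v t = Complex.exp (-(N v : ℂ) * w) / w := by
    intro v
    rw [hF]
    simp only
    rw [key v (fun t : ℝ => Complex.exp (-w * t)), integral_exp_mul_complex_Ioi hre, neg_div_neg_eq]
    congr 2; ring
  have hnorm : ∀ v, ∫ t in Set.Ioi (0 : ℝ), ‖F v t‖ = ‖Complex.exp (-(N v : ℂ) * w)‖ / w.re := by
    intro v
    have e : ∀ t, ‖F v t‖ = Set.indicator (Set.Ici (N v)) (fun t : ℝ => Real.exp (-w.re * t)) t := by
      intro t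
      rw [hF]
      simp only [norm_indicator_eq_indicator_norm, Complex.norm_exp]
      simp
    simp_rw [e]
    rw [key v (fun t : ℝ => Real.exp (-w.re * t)), integral_exp_mul_Ioi (by linarith),
      neg_div_neg_eq, Complex.norm_exp]
    congr 2
    simp; ring
  obtain ⟨hs, hts⟩ := hasSum_exp_neg_normSq_mul k hw
  have h := hasSum_integral_of_summable_integral_norm hint (by
    simp_rw [hnorm]
    exact hs.div_const _)
  have h2 := h.tsum_eq
  simp_rw [hval] at h2
  rw [tsum_div_const, hts] at h2
  rw [h2]
  refine setIntegral_congr_fun measurableSet_Ioi fun t _ => ?_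
  rw [Sk_eq_tsum]
  refine tsum_congr fun v => ?_
  rw [hF]
  simp only [Set.indicator]
  rfl

theorem thetaMain_one_pow (k : ℕ) {w : ℂ} (hw : 0 < w.re) :
    thetaMain 1 0 w ^ k = (π ^ ((k : ℝ) / 2) : ℝ) * (1 / w) ^ (((k : ℝ) / 2 : ℝ) : ℂ) := by
  have hw0 : w ≠ 0 := by rintro rfl; simp at hw
  have h1 : quadGauss 1 ((-0 : ℤ) : ZMod 1) 0 = 1 := by
    simp [quadGauss]
  rw [thetaMain, h1, mul_one, ← Complex.cpow_nat_mul]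
  have : (π / (((1 : ℕ) : ℂ) ^ 2 * w) : ℂ) = (π : ℝ) * (1 / w) := by push_cast; field_simp
  rw [this, Complex.cpow_def_of_ne_zero (by simp [hw0, Real.pi_ne_zero]),
    Complex.log_ofReal_mul Real.pi_pos (by simp [hw0]), Complex.cpow_def_of_ne_zero (by simp [hw0]),
    Real.rpow_def_of_pos Real.pi_pos]
  push_cast
  rw [← Complex.exp_add]
  congr 1; ring

theorem exists_abs_centredPk_le {k : ℕ} (hk : 2 ≤ k) :
    ∃ C, 0 < C ∧ ∀ t, 0 ≤ t → |centredPk k t| ≤ C * (1 + t) ^ k := by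
  have hk' : (2 : ℝ) ≤ k := by exact_mod_cast hk
  have hV := Vk_nonneg k
  refine ⟨3 ^ k + Vk k + k / 4 * Vk k, by positivity, fun t ht => ?_⟩
  have h1 := Sk_le k ht
  have h2 : t ^ ((k : ℝ) / 2) ≤ (1 + t) ^ k := by
    rw [← Real.rpow_natCast (1 + t) k]
    calc t ^ ((k : ℝ) / 2) ≤ (1 + t) ^ ((k : ℝ) / 2) := by gcongr; linarith
      _ ≤ _ := Real.rpow_le_rpow_of_exponent_le (by linarith) (by linarith)
  have h3 : t ^ ((k : ℝ) / 2 - 1) ≤ (1 + t) ^ k := by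
    rw [← Real.rpow_natCast (1 + t) k]
    calc t ^ ((k : ℝ) / 2 - 1) ≤ (1 + t) ^ ((k : ℝ) / 2 - 1) :=
          Real.rpow_le_rpow ht (by linarith) (by linarith)
      _ ≤ _ := Real.rpow_le_rpow_of_exponent_le (by linarith) (by linarith)
  have e2 : 0 ≤ t ^ ((k : ℝ) / 2) := by positivity
  have e3 : 0 ≤ t ^ ((k : ℝ) / 2 - 1) := by positivity
  rw [mul_pow] at h1
  have m2 := mul_le_mul_of_nonneg_left h2 hV
  have m3 := mul_le_mul_of_nonneg_left h3 (show 0 ≤ (k : ℝ) / 4 * Vk k by positivity)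
  have p2 : 0 ≤ Vk k * t ^ ((k : ℝ) / 2) := by positivity
  have p3 : 0 ≤ (k : ℝ) / 4 * Vk k * t ^ ((k : ℝ) / 2 - 1) := by positivity
  have p1 : (0 : ℝ) ≤ Sk k t := by positivity
  have q3 : 0 ≤ (k : ℝ) / 4 * Vk k * (1 + t) ^ k := by positivity
  have q2 : 0 ≤ Vk k * (1 + t) ^ k := by positivity
  have q1 : 0 ≤ (3 : ℝ) ^ k * (1 + t) ^ k := by positivity
  rw [centredPk, Pk, abs_le]
  constructor <;> linarith

theorem integrableOn_one_add_pow_mul_exp (m : ℕ) {σ : ℝ} (hσ : 0 < σ) :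
    IntegrableOn (fun t : ℝ => (1 + t) ^ m * Real.exp (-σ * t)) (Set.Ioi 0) := by
  simp_rw [add_pow, one_pow, one_mul, sum_mul]
  refine integrable_finsetSum _ fun i _ => ?_
  have h := (integrableOn_rpow_mul_exp_neg_mul (a := ((m - i : ℕ) : ℝ)) (σ := σ)
    (by have : (0 : ℝ) ≤ ((m - i : ℕ) : ℝ) := by positivity
        linarith) hσ).mul_const ((m.choose i : ℕ) : ℝ)
  refine h.congr (Filter.Eventually.of_forall fun t => ?_)
  simp only [Real.rpow_natCast]; ring

theorem integrableOn_centredPk {k : ℕ} (hk : 2 ≤ k) {σ : ℝ} (hσ : 0 < σ) :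
    IntegrableOn (fun t => centredPk k t * Real.exp (-σ * t)) (Set.Ioi 0) := by
  obtain ⟨C, hC, h⟩ := exists_abs_centredPk_le hk
  refine Integrable.mono' ((integrableOn_one_add_pow_mul_exp k hσ).const_mul C)
    ((measurable_centredPk k).mul (by fun_prop)).aestronglyMeasurable ?_
  refine (ae_restrict_iff' measurableSet_Ioi).2 (Filter.Eventually.of_forall fun t ht => ?_)
  rw [norm_mul, Real.norm_eq_abs, Real.norm_eq_abs, Real.abs_exp, ← mul_assoc]
  gcongr
  exact h t (le_of_lt ht)

theorem integrableOn_centredPk_sq {k : ℕ} (hk : 2 ≤ k) {σ : ℝ} (hσ : 0 < σ) :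
    IntegrableOn (fun t => centredPk k t ^ 2 * Real.exp (-σ * t)) (Set.Ioi 0) := by
  obtain ⟨C, hC, h⟩ := exists_abs_centredPk_le hk
  refine Integrable.mono' ((integrableOn_one_add_pow_mul_exp (k * 2) hσ).const_mul (C ^ 2))
    (((measurable_centredPk k).pow_const 2).mul (by fun_prop)).aestronglyMeasurable ?_
  refine (ae_restrict_iff' measurableSet_Ioi).2 (Filter.Eventually.of_forall fun t ht => ?_)
  rw [norm_mul, norm_pow, Real.norm_eq_abs, Real.norm_eq_abs, Real.abs_exp, ← mul_assoc, pow_mul,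
    ← mul_pow]
  gcongr
  exact h t (le_of_lt ht)

theorem Vk_mul_Gamma (k : ℕ) : Vk k * Real.Gamma ((k : ℝ) / 2 + 1) = π ^ ((k : ℝ) / 2) := by
  rw [Vk, div_mul_cancel₀]
  exact (Real.Gamma_pos_of_pos (by positivity)).ne'

theorem integral_centredPk_mul_cexp {k : ℕ} (hk : 2 ≤ k) {w : ℂ} (hw : 0 < w.re) :
    ∫ t in Set.Ioi (0 : ℝ), (centredPk k t : ℂ) * Complex.exp (-w * t) =
      (thetaSum w ^ k - thetaMain 1 0 w ^ k) / w + thetaMain 1 0 w ^ k / 2 := by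
  have hk' : (2 : ℝ) ≤ k := by exact_mod_cast hk
  have hw0 : w ≠ 0 := by rintro rfl; simp at hw
  have hcexp : ∀ (f : ℝ → ℝ), Measurable f → IntegrableOn (fun t => f t * Real.exp (-w.re * t)) (Set.Ioi 0) →
      IntegrableOn (fun t => (f t : ℂ) * Complex.exp (-w * t)) (Set.Ioi 0) := by
    intro f hfm hf
    refine Integrable.mono hf ((hfm.complex_ofReal).mul (by fun_prop)).aestronglyMeasurable ?_
    refine Filter.Eventually.of_forall fun t => ?_
    simp [Complex.norm_exp]
  have h1 := integrableOn_rpow_mul_exp_neg_mul (a := (k : ℝ) / 2) (by linarith) hw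
  have h2 := integrableOn_rpow_mul_exp_neg_mul (a := (k : ℝ) / 2 - 1) (by linarith) hw
  have h0 : IntegrableOn (fun t => (Sk k t : ℝ) * Real.exp (-w.re * t)) (Set.Ioi 0) := by
    have := ((integrableOn_centredPk hk hw).add (h1.const_mul (Vk k))).sub
      (h2.const_mul ((k : ℝ) / 4 * Vk k))
    refine this.congr (Filter.Eventually.of_forall fun t => ?_)
    simp only [Pi.add_apply, Pi.sub_apply, centredPk, Pk]
    ring
  have c0 := hcexp _ (measurable_Sk k) h0
  have c1 := (hcexp _ (by fun_prop) h1).const_mul (Vk k : ℂ)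
  have c2 := (hcexp _ (by fun_prop) h2).const_mul ((k : ℂ) / 4 * Vk k)
  have i1 := integral_rpow_mul_cexp_neg_mul_Ioi (a := (k : ℝ) / 2 + 1) (by linarith) hw
  have i2 := integral_rpow_mul_cexp_neg_mul_Ioi (a := (k : ℝ) / 2) (by linarith) hw
  rw [add_sub_cancel_right] at i1
  have e : ∀ t : ℝ, (centredPk k t : ℂ) * Complex.exp (-w * t) =
      (((Sk k t : ℝ) : ℂ) * Complex.exp (-w * t) - Vk k * (((t ^ ((k : ℝ) / 2) : ℝ) : ℂ) * Complex.exp (-w * t)))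
      + (k : ℂ) / 4 * Vk k * (((t ^ ((k : ℝ) / 2 - 1) : ℝ) : ℂ) * Complex.exp (-w * t)) := by
    intro t
    rw [centredPk, Pk]; push_cast; ring
  simp_rw [e]
  have hG := Vk_mul_Gamma k
  have hG2 : (k : ℝ) / 2 * Vk k * Real.Gamma ((k : ℝ) / 2) = π ^ ((k : ℝ) / 2) := by
    rw [← hG, Real.Gamma_add_one (by positivity)]; ring
  have c01 : Integrable (fun t : ℝ => ((Sk k t : ℝ) : ℂ) * Complex.exp (-w * t) -
      Vk k * (((t ^ ((k : ℝ) / 2) : ℝ) : ℂ) * Complex.exp (-w * t))) (volume.restrict (Set.Ioi 0)) := c0.sub c1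
  rw [integral_add c01 c2, integral_sub c0 c1, integral_const_mul, integral_const_mul, i1, i2]
  have hS : ∫ t in Set.Ioi (0 : ℝ), ((Sk k t : ℝ) : ℂ) * Complex.exp (-w * t) = thetaSum w ^ k / w := by
    rw [← integral_Sk_mul_cexp k hw]
    refine integral_congr_ae (Filter.Eventually.of_forall fun t => ?_)
    simp
  rw [hS, thetaMain_one_pow k hw]
  push_cast
  rw [Complex.cpow_add _ _ (by simp [hw0]), Complex.cpow_one]
  have hGc : (Vk k : ℂ) * Real.Gamma ((k : ℝ) / 2 + 1) = ((π ^ ((k : ℝ) / 2) : ℝ) : ℂ) := by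
    exact_mod_cast hG
  have hG2c : (k : ℂ) / 2 * Vk k * Real.Gamma ((k : ℝ) / 2) = ((π ^ ((k : ℝ) / 2) : ℝ) : ℂ) := by
    rw [← hG2]; push_cast; ring
  set z := (1 / w) ^ ((k : ℂ) / 2)
  linear_combination (-(z * (1 / w))) * hGc + z / 2 * hG2c

/-- The point `σ + i y` as seen from the singularity `2 π i r` of the theta series. -/
noncomputable def arcOffset (σ : ℝ) (r : ℚ) (y : ℝ) : ℂ := σ + ((y - 2 * π * r : ℝ) : ℂ) * Complex.I

/-- The major arc around `2 π r`. -/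
def majorArc (Q : ℕ) (r : ℚ) : Set ℝ := {y | r.den ≤ Q ∧ |y - 2 * π * r| < π / (r.den * Q)}

/-- The leading term of the theta series near `2 π i r`. -/
noncomputable def thetaRat (r : ℚ) (v : ℂ) : ℂ :=
  haveI : NeZero r.den := ⟨r.den_nz⟩
  thetaMain r.den r.num v

theorem arcOffset_re (σ : ℝ) (r : ℚ) (y : ℝ) : (arcOffset σ r y).re = σ := by
  simp [arcOffset]

theorem sq_norm_arcOffset (σ : ℝ) (r : ℚ) (y : ℝ) :
    ‖arcOffset σ r y‖ ^ 2 = σ ^ 2 + (y - 2 * π * r) ^ 2 := by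
  rw [Complex.sq_norm, arcOffset, Complex.normSq_add_mul_I]

theorem norm_arcOffset_pos {σ : ℝ} (hσ : 0 < σ) (r : ℚ) (y : ℝ) : 0 < ‖arcOffset σ r y‖ := by
  refine norm_pos_iff.2 fun h => ?_
  have := arcOffset_re σ r y
  rw [h] at this
  simp at this
  exact hσ.ne this

theorem abs_le_norm_arcOffset (σ : ℝ) (r : ℚ) (y : ℝ) : |y - 2 * π * r| ≤ ‖arcOffset σ r y‖ := by
  refine abs_le_of_sq_le_sq ?_ (norm_nonneg _)
  rw [sq_norm_arcOffset]; nlinarith [sq_nonneg σ]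

theorem le_norm_arcOffset (σ : ℝ) (r : ℚ) (y : ℝ) : σ ≤ ‖arcOffset σ r y‖ := by
  refine le_of_sq_le_sq ?_ (norm_nonneg _)
  rw [sq_norm_arcOffset]; nlinarith [sq_nonneg (y - 2 * π * r)]

theorem norm_thetaRat_pow_le (k : ℕ) (r : ℚ) {v : ℂ} (hv : 0 < v.re) :
    ‖thetaRat r v ^ k‖ ≤ (2 * π) ^ ((k : ℝ) / 2) * (r.den * ‖v‖) ^ (-((k : ℝ) / 2)) := by
  have : NeZero r.den := ⟨r.den_nz⟩
  exact norm_thetaMain_pow_le k (Rat.isCoprime_num_den r) hv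

theorem exists_norm_thetaSum_sub_thetaRat_le (k : ℕ) {B : ℝ} (hB : 0 < B) :
    ∃ C : ℝ, 0 < C ∧ ∀ (r : ℚ) (σ y : ℝ), 0 < σ → (r.den * ‖arcOffset σ r y‖) ^ 2 ≤ 41 * σ →
      ‖thetaSum (arcOffset σ 0 y) ^ k - thetaRat r (arcOffset σ r y) ^ k‖ ≤
        C * ((r.den * ‖arcOffset σ r y‖) ^ (-((k : ℝ) / 2)) *
          ((r.den * ‖arcOffset σ r y‖) ^ 2 / σ) ^ B) := by
  obtain ⟨C, hC, h⟩ := exists_norm_thetaSum_pow_sub_le k hB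
  refine ⟨C, hC, fun r σ y hσ hy => ?_⟩
  have : NeZero r.den := ⟨r.den_nz⟩
  have h1 := h r.den r.num (arcOffset σ r y) (Rat.isCoprime_num_den r)
    (by rwa [arcOffset_re]) (by rwa [arcOffset_re])
  rw [arcOffset_re] at h1
  have e : arcOffset σ r y + 2 * π * Complex.I * r.num / r.den = arcOffset σ 0 y := by
    have hr : ((r : ℝ) : ℂ) = r.num / r.den := by
      have := Rat.num_div_den r
      calc ((r : ℝ) : ℂ) = ((r : ℚ) : ℂ) := by norm_cast
        _ = _ := by exact_mod_cast (congrArg (fun x : ℚ => (x : ℂ)) this).symm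
    simp only [arcOffset]
    push_cast
    push_cast at hr
    rw [hr]
    ring
  rw [e] at h1
  exact h1

/-- Conditions saying that `Q` is the integer part of `σ^{-1/2}`. -/
structure IsArcOrder (σ : ℝ) (Q : ℕ) : Prop where
  pos : 0 < σ
  le_one : σ ≤ 1
  one_le : 1 ≤ Q
  sq_mul_le : (Q : ℝ) ^ 2 * σ ≤ 1
  le_sq_mul : 1 ≤ ((Q : ℝ) + 1) ^ 2 * σ

theorem exists_isArcOrder {σ : ℝ} (hσ : 0 < σ) (h1 : σ ≤ 1) : ∃ Q, IsArcOrder σ Q := by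
  have hx : 0 < √σ := Real.sqrt_pos.2 hσ
  have hx2 : √σ ^ 2 = σ := Real.sq_sqrt hσ.le
  have hx1 : √σ ≤ 1 := by simpa using Real.sqrt_le_sqrt h1
  have f1 := Nat.floor_le (a := 1 / √σ) (by positivity)
  have f2 := Nat.lt_floor_add_one (1 / √σ)
  rw [le_div_iff₀ hx] at f1
  rw [div_lt_iff₀ hx] at f2
  refine ⟨⌊1 / √σ⌋₊, hσ, h1, ?_, ?_, ?_⟩
  · rw [Nat.one_le_floor_iff, le_div_iff₀ hx]; linarith
  · have := pow_le_one₀ (n := 2) (by positivity) f1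
    rwa [mul_pow, hx2] at this
  · have := one_le_pow₀ (n := 2) f2.le
    rwa [mul_pow, hx2] at this

namespace IsArcOrder

variable {σ : ℝ} {Q : ℕ}

theorem cast_pos (h : IsArcOrder σ Q) : (1 : ℝ) ≤ Q := by exact_mod_cast h.one_le

theorem one_le_four_mul (h : IsArcOrder σ Q) : 1 ≤ 4 * ((Q : ℝ) ^ 2 * σ) := by
  have h1 := h.cast_pos
  have h2 := h.le_sq_mul
  have h3 := h.pos
  have : ((Q : ℝ) + 1) ^ 2 ≤ 4 * Q ^ 2 := by nlinarith
  nlinarith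

theorem cast_le (h : IsArcOrder σ Q) : (Q : ℝ) ≤ σ ^ (-(1 / 2) : ℝ) := by
  have h1 := h.sq_mul_le
  have h3 := h.pos
  rw [Real.rpow_neg h3.le, ← Real.sqrt_eq_rpow, ← one_div, le_div_iff₀ (Real.sqrt_pos.2 h3)]
  refine le_of_sq_le_sq ?_ zero_le_one
  rw [mul_pow, Real.sq_sqrt h3.le]; linarith

theorem inv_cast_le (h : IsArcOrder σ Q) : (Q : ℝ)⁻¹ ≤ 2 * σ ^ (1 / 2 : ℝ) := by
  have h1 := h.one_le_four_mul
  have h3 := h.pos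
  have h4 := h.cast_pos
  rw [← Real.sqrt_eq_rpow, inv_le_iff_one_le_mul₀ (by linarith)]
  refine le_of_sq_le_sq ?_ (by positivity)
  rw [mul_pow, mul_pow, Real.sq_sqrt h3.le]; linarith

theorem mul_norm_sq_le (h : IsArcOrder σ Q) {r : ℚ} {y : ℝ} (hr : r.den ≤ Q)
    (hy : (r.den * |y - 2 * π * r|) ^ 2 ≤ 4 * π ^ 2 * σ) :
    (r.den * ‖arcOffset σ r y‖) ^ 2 ≤ 41 * σ := by
  rw [mul_pow, sq_abs] at hy
  rw [mul_pow, sq_norm_arcOffset, mul_add]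
  have h3 := h.pos
  have hr' : (r.den : ℝ) ≤ Q := by exact_mod_cast hr
  have h5 : (r.den : ℝ) ^ 2 * σ ^ 2 ≤ σ := by
    calc (r.den : ℝ) ^ 2 * σ ^ 2 ≤ (Q : ℝ) ^ 2 * σ ^ 2 := by gcongr
      _ = ((Q : ℝ) ^ 2 * σ) * σ := by ring
      _ ≤ 1 * σ := by gcongr; exact h.sq_mul_le
      _ = σ := one_mul σ
  have h6 : 4 * π ^ 2 ≤ 40 := by nlinarith [Real.pi_lt_d4, Real.pi_pos]
  nlinarith

theorem norm_sq_le_of_mem (h : IsArcOrder σ Q) {r : ℚ} {y : ℝ} (hy : y ∈ majorArc Q r) :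
    (r.den * ‖arcOffset σ r y‖) ^ 2 ≤ 41 * σ := by
  refine h.mul_norm_sq_le hy.1 ?_
  have h4 := h.cast_pos
  have hq : (0 : ℝ) < r.den := by exact_mod_cast r.den_pos
  have h1 : r.den * |y - 2 * π * r| ≤ π / Q := by
    calc r.den * |y - 2 * π * r| ≤ r.den * (π / (r.den * Q)) := by gcongr; exact hy.2.le
      _ = π / Q := by field_simp
  calc (r.den * |y - 2 * π * r|) ^ 2 ≤ (π / Q) ^ 2 := by gcongr
    _ = π ^ 2 * 1 / Q ^ 2 := by rw [div_pow, mul_one]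
    _ ≤ π ^ 2 * (4 * ((Q : ℝ) ^ 2 * σ)) / Q ^ 2 := by gcongr; exact h.one_le_four_mul
    _ = _ := by field_simp

theorem exists_rat (h : IsArcOrder σ Q) (y : ℝ) : ∃ r : ℚ, r.den ≤ Q ∧
    (r.den * ‖arcOffset σ r y‖) ^ 2 ≤ 41 * σ := by
  obtain ⟨r, h1, h2⟩ := Real.exists_rat_abs_sub_le_and_den_le (y / (2 * π)) (n := Q) h.one_le
  refine ⟨r, h2, h.mul_norm_sq_le h2 ?_⟩
  have h4 := h.cast_pos
  have h3 := h.pos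
  have hq : (0 : ℝ) < r.den := by exact_mod_cast r.den_pos
  have e : |y - 2 * π * r| = 2 * π * |y / (2 * π) - r| := by
    rw [← abs_of_pos (show 0 < 2 * π by positivity), ← abs_mul, abs_of_pos (show 0 < 2 * π by positivity)]
    congr 1; field_simp
  have h5 : r.den * |y - 2 * π * r| ≤ 2 * π / (Q + 1) := by
    rw [e]
    calc r.den * (2 * π * |y / (2 * π) - r|) ≤ r.den * (2 * π * (1 / ((Q + 1) * r.den))) := by gcongr
      _ = _ := by field_simp
  calc (r.den * |y - 2 * π * r|) ^ 2 ≤ (2 * π / (Q + 1)) ^ 2 := by gcongr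
    _ = 4 * π ^ 2 * 1 / (Q + 1) ^ 2 := by rw [div_pow]; ring
    _ ≤ 4 * π ^ 2 * (((Q : ℝ) + 1) ^ 2 * σ) / (Q + 1) ^ 2 := by gcongr; exact h.le_sq_mul
    _ = _ := by field_simp

end IsArcOrder

theorem one_le_den_mul_den_mul_abs_sub {r s : ℚ} (h : r ≠ s) :
    (1 : ℝ) ≤ r.den * s.den * |(r : ℝ) - s| := by
  have h1 : (r : ℝ) - s = ((r - s : ℚ) : ℝ) := by push_cast; ring
  have hr : (0 : ℝ) < r.den := by exact_mod_cast r.den_pos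
  have hs : (0 : ℝ) < s.den := by exact_mod_cast s.den_pos
  have e : (r.den : ℝ) * s.den * ((r : ℝ) - s) = ((r.num * s.den - s.num * r.den : ℤ) : ℝ) := by
    have e1 : (r : ℝ) * r.den = r.num := by exact_mod_cast Rat.mul_den_eq_num r
    have e2 : (s : ℝ) * s.den = s.num := by exact_mod_cast Rat.mul_den_eq_num s
    push_cast
    rw [← e1, ← e2]; ring
  have e3 : (r.den : ℝ) * s.den * |(r : ℝ) - s| = |((r.num * s.den - s.num * r.den : ℤ) : ℝ)| := by
    rw [← e, abs_mul, abs_of_pos (by positivity : (0 : ℝ) < r.den * s.den)]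
  rw [e3]
  have hne : r.num * s.den - s.num * r.den ≠ 0 := by
    intro h0
    apply h
    rw [Rat.eq_iff_mul_eq_mul]
    linarith
  exact_mod_cast Int.one_le_abs hne

theorem majorArc_disjoint {Q : ℕ} {r s : ℚ} {y : ℝ} (hr : y ∈ majorArc Q r) (hs : y ∈ majorArc Q s) :
    r = s := by
  by_contra hne
  have h1 := one_le_den_mul_den_mul_abs_sub hne
  have hr0 : (0 : ℝ) < r.den := by exact_mod_cast r.den_pos
  have hs0 : (0 : ℝ) < s.den := by exact_mod_cast s.den_pos
  have hrQ : (r.den : ℝ) ≤ Q := by exact_mod_cast hr.1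
  have hsQ : (s.den : ℝ) ≤ Q := by exact_mod_cast hs.1
  have hQ : (0 : ℝ) < Q := by linarith
  have hpi := Real.pi_pos
  have h2 : 2 * π * |(r : ℝ) - s| < π / (r.den * Q) + π / (s.den * Q) := by
    have e : 2 * π * |(r : ℝ) - s| = |(y - 2 * π * s) - (y - 2 * π * r)| := by
      rw [← abs_of_pos (show 0 < 2 * π by positivity), ← abs_mul, abs_of_pos (show 0 < 2 * π by positivity)]
      congr 1; ring
    rw [e]
    refine (abs_sub _ _).trans_lt ?_
    linarith [hr.2, hs.2]
  have h3 : π / (r.den * Q) + π / (s.den * Q) ≤ 2 * π / (r.den * s.den) := by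
    have : π / (r.den * Q) + π / (s.den * Q) = π * (s.den + r.den) / Q / (r.den * s.den) := by
      field_simp
    rw [this]
    gcongr
    rw [div_le_iff₀ hQ]; nlinarith
  have h4 := h2.trans_le h3
  rw [lt_div_iff₀ (by positivity)] at h4
  nlinarith

/-- The Laplace transform of the centred discrepancy. -/
noncomputable def laplaceCentred (k : ℕ) (w : ℂ) : ℂ :=
  (thetaSum w ^ k - thetaRat 0 w ^ k) / w + thetaRat 0 w ^ k / 2

/-- The contribution of the singularity `2 π i r` to the squared Laplace transform. -/
noncomputable def mainDensity (k : ℕ) (σ : ℝ) (r : ℚ) (y : ℝ) : ℝ :=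
  ‖thetaRat r (arcOffset σ r y) ^ k‖ ^ 2 * (if r = 0 then 1 / 4 else 1 / (2 * π * r) ^ 2)

theorem IsArcOrder.rpow_cast_le {σ : ℝ} {Q : ℕ} (h : IsArcOrder σ Q) {p : ℝ} (hp : 0 ≤ p) :
    (Q : ℝ) ^ p ≤ σ ^ (-(p / 2)) := by
  have h3 := h.pos
  calc (Q : ℝ) ^ p ≤ (σ ^ (-(1 / 2) : ℝ)) ^ p := by gcongr; exact h.cast_le
    _ = _ := by rw [← Real.rpow_mul h3.le]; congr 1; ring

theorem IsArcOrder.rpow_neg_le {σ : ℝ} {Q : ℕ} (h : IsArcOrder σ Q) {p x : ℝ} (hp : 0 ≤ p)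
    (hx : (Q : ℝ)⁻¹ ≤ x) : x ^ (-p) ≤ σ ^ (-(p / 2)) := by
  have h4 := h.cast_pos
  have hQ : (0 : ℝ) < (Q : ℝ)⁻¹ := by positivity
  calc x ^ (-p) ≤ ((Q : ℝ)⁻¹) ^ (-p) := Real.rpow_le_rpow_of_nonpos hQ hx (by linarith)
    _ = (Q : ℝ) ^ p := by rw [Real.inv_rpow (by positivity), Real.rpow_neg (by positivity), inv_inv]
    _ ≤ _ := h.rpow_cast_le hp

theorem IsArcOrder.rpow_anti {σ : ℝ} {Q : ℕ} (h : IsArcOrder σ Q) {a b : ℝ} (hab : b ≤ a) :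
    σ ^ a ≤ σ ^ b := Real.rpow_le_rpow_of_exponent_ge h.pos h.le_one hab

theorem norm_thetaRat_zero_pow_le (k : ℕ) {σ : ℝ} (hσ : 0 < σ) (y : ℝ) :
    ‖thetaRat 0 (arcOffset σ 0 y) ^ k‖ ≤
      (2 * π) ^ ((k : ℝ) / 2) * ‖arcOffset σ 0 y‖ ^ (-((k : ℝ) / 2)) := by
  have := norm_thetaRat_pow_le k 0 (v := arcOffset σ 0 y) (by rwa [arcOffset_re])
  simpa using this

theorem abs_le_norm_arcOffset_zero (σ y : ℝ) : |y| ≤ ‖arcOffset σ 0 y‖ := by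
  simpa using abs_le_norm_arcOffset σ 0 y

/-- Away from the origin the main term of the theta series at `0` is small. -/
theorem norm_thetaRat_zero_far {k : ℕ} (hk : 2 ≤ k) {σ y : ℝ} {Q : ℕ} (h : IsArcOrder σ Q)
    (hy : π / Q ≤ |y|) :
    ‖thetaRat 0 (arcOffset σ 0 y) ^ k / arcOffset σ 0 y‖ ≤ (2 * π) ^ ((k : ℝ) / 2) * (σ ^ (-((k : ℝ) / 4)) / |y|) ∧
    ‖thetaRat 0 (arcOffset σ 0 y) ^ k / 2‖ ≤ (2 * π) ^ ((k : ℝ) / 2) * (σ ^ (-((k : ℝ) / 4)) / |y|) := by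
  have hk' : (2 : ℝ) ≤ k := by exact_mod_cast hk
  have h4 := h.cast_pos
  have h3 := h.pos
  have hw := norm_arcOffset_pos h.pos 0 y
  have hM := norm_thetaRat_zero_pow_le k h.pos y
  have hyw := abs_le_norm_arcOffset_zero σ y
  have hQy : (Q : ℝ)⁻¹ ≤ |y| := by
    refine le_trans ?_ hy
    rw [inv_eq_one_div]; gcongr; linarith [Real.pi_gt_three]
  have hy0 : 0 < |y| := lt_of_lt_of_le (by positivity) hQy
  set W := ‖arcOffset σ 0 y‖ with hW
  have hQW := hQy.trans hyw
  have a1 : W ^ (-((k : ℝ) / 2)) ≤ σ ^ (-((k : ℝ) / 4)) := by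
    refine (h.rpow_neg_le (by positivity) hQW).trans_eq ?_
    congr 1; ring
  have a2 : W ^ (-((k : ℝ) / 2)) ≤ σ ^ (-((k : ℝ) / 4)) / |y| := by
    have e : W ^ (-((k : ℝ) / 2)) = W ^ (-((k : ℝ) / 2 - 1)) / W := by
      rw [← Real.rpow_sub_one hw.ne']; congr 1; ring
    rw [e]
    have : W ^ (-((k : ℝ) / 2 - 1)) ≤ σ ^ (-((k : ℝ) / 4)) := by
      refine (h.rpow_neg_le (by linarith) hQW).trans (h.rpow_anti ?_)
      linarith
    gcongr
  constructor
  · rw [norm_div, ← hW]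
    calc _ ≤ (2 * π) ^ ((k : ℝ) / 2) * W ^ (-((k : ℝ) / 2)) / W := by gcongr
      _ = (2 * π) ^ ((k : ℝ) / 2) * (W ^ (-((k : ℝ) / 2)) / W) := by ring
      _ ≤ _ := by gcongr
  · rw [norm_div]
    calc _ ≤ ‖thetaRat 0 (arcOffset σ 0 y) ^ k‖ / 1 := by gcongr; simp
      _ ≤ (2 * π) ^ ((k : ℝ) / 2) * W ^ (-((k : ℝ) / 2)) := by rw [div_one]; exact hM
      _ ≤ _ := by gcongr

theorem sq_rpow_half_mul {x σ : ℝ} (hx : 0 < x) (hσ : 0 < σ) (p : ℝ) :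
    x ^ (-p) * (x ^ 2 / σ) ^ (p / 2) = σ ^ (-(p / 2)) := by
  rw [Real.div_rpow (by positivity) hσ.le, ← Real.rpow_natCast x 2, ← Real.rpow_mul hx.le,
    Real.rpow_neg hx.le, Real.rpow_neg hσ.le]
  have : ((2 : ℕ) : ℝ) * (p / 2) = p := by push_cast; ring
  rw [this]
  have := Real.rpow_pos_of_pos hx p
  field_simp

theorem exists_norm_theta_error_le {k : ℕ} (hk : 2 ≤ k) :
    ∃ C, 0 < C ∧ ∀ (r : ℚ) (σ y : ℝ), 0 < σ → (r.den * ‖arcOffset σ r y‖) ^ 2 ≤ 41 * σ →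
      ‖thetaSum (arcOffset σ 0 y) ^ k - thetaRat r (arcOffset σ r y) ^ k‖ ≤ C * σ ^ (-((k : ℝ) / 4)) := by
  have hk' : (2 : ℝ) ≤ k := by exact_mod_cast hk
  obtain ⟨C, hC, h⟩ := exists_norm_thetaSum_sub_thetaRat_le k (B := (k : ℝ) / 2 / 2) (by positivity)
  refine ⟨C, hC, fun r σ y hσ hy => (h r σ y hσ hy).trans_eq ?_⟩
  have hq : (0 : ℝ) < r.den := by exact_mod_cast r.den_pos
  have := norm_arcOffset_pos hσ r y
  rw [sq_rpow_half_mul (by positivity) hσ]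
  congr 2; ring

theorem exists_rat_off_arcs (k : ℕ) {σ y : ℝ} {Q : ℕ} (h : IsArcOrder σ Q)
    (hy : ∀ r, y ∉ majorArc Q r) :
    ∃ r : ℚ, (r.den * ‖arcOffset σ r y‖) ^ 2 ≤ 41 * σ ∧
      ‖thetaRat r (arcOffset σ r y) ^ k‖ ≤ (2 * π) ^ ((k : ℝ) / 2) * σ ^ (-((k : ℝ) / 4)) := by
  obtain ⟨r, h1, h2⟩ := h.exists_rat y
  refine ⟨r, h2, ?_⟩
  have h3 := h.pos
  have h4 := h.cast_pos
  have hq : (0 : ℝ) < r.den := by exact_mod_cast r.den_pos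
  have h5 : π / (r.den * Q) ≤ |y - 2 * π * r| := by
    by_contra hc
    exact hy r ⟨h1, not_le.1 hc⟩
  have h6 := h5.trans (abs_le_norm_arcOffset σ r y)
  have h7 : (Q : ℝ)⁻¹ ≤ r.den * ‖arcOffset σ r y‖ := by
    calc (Q : ℝ)⁻¹ = 1 / Q := by rw [one_div]
      _ ≤ π / Q := by gcongr; linarith [Real.pi_gt_three]
      _ = r.den * (π / (r.den * Q)) := by field_simp
      _ ≤ _ := by gcongr
  refine (norm_thetaRat_pow_le k r (by rwa [arcOffset_re])).trans ?_
  gcongr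
  refine (h.rpow_neg_le (by positivity) h7).trans_eq ?_
  congr 1; ring

theorem le_abs_of_notMem_majorArc_zero {σ y : ℝ} {Q : ℕ} (h : IsArcOrder σ Q)
    (hy : y ∉ majorArc Q 0) : π / Q ≤ |y| := by
  by_contra hc
  refine hy ⟨by simpa using h.one_le, ?_⟩
  simpa using hc

/-- Size of the Laplace transform off the major arcs. -/
theorem exists_norm_laplace_off_arcs_le {k : ℕ} (hk : 2 ≤ k) :
    ∃ C, 0 < C ∧ ∀ (σ y : ℝ) (Q : ℕ), IsArcOrder σ Q → (∀ r, y ∉ majorArc Q r) →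
      ‖laplaceCentred k (arcOffset σ 0 y)‖ ≤ C * (σ ^ (-((k : ℝ) / 4)) / |y|) := by
  obtain ⟨C, hC, hE⟩ := exists_norm_theta_error_le hk
  refine ⟨C + 3 * (2 * π) ^ ((k : ℝ) / 2), by positivity, fun σ y Q h hy => ?_⟩
  obtain ⟨r, h1, h2⟩ := exists_rat_off_arcs k h hy
  have h3 := h.pos
  have hyQ := le_abs_of_notMem_majorArc_zero h (hy 0)
  have hy0 : 0 < |y| := lt_of_lt_of_le (div_pos Real.pi_pos (by linarith [h.cast_pos])) hyQ
  obtain ⟨h5, h6⟩ := norm_thetaRat_zero_far hk h hyQ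
  have h7 := hE r σ y h.pos h1
  have hyw := abs_le_norm_arcOffset_zero σ y
  set w := arcOffset σ 0 y
  have h8 : ‖thetaSum w ^ k‖ ≤ (C + (2 * π) ^ ((k : ℝ) / 2)) * σ ^ (-((k : ℝ) / 4)) := by
    have := norm_le_norm_sub_add (thetaSum w ^ k) (thetaRat r (arcOffset σ r y) ^ k)
    linarith
  have h9 : ‖thetaSum w ^ k / w‖ ≤ (C + (2 * π) ^ ((k : ℝ) / 2)) * (σ ^ (-((k : ℝ) / 4)) / |y|) := by
    rw [norm_div, ← mul_div_assoc]; gcongr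
  have e : laplaceCentred k w = thetaSum w ^ k / w - thetaRat 0 w ^ k / w + thetaRat 0 w ^ k / 2 := by
    rw [laplaceCentred, sub_div]
  rw [e]
  have t1 := norm_add_le (thetaSum w ^ k / w - thetaRat 0 w ^ k / w) (thetaRat 0 w ^ k / 2)
  have t2 := norm_sub_le (thetaSum w ^ k / w) (thetaRat 0 w ^ k / w)
  linarith

/-- Approximation of the Laplace transform on a major arc away from the origin. -/
theorem exists_norm_laplace_sub_le {k : ℕ} (hk : 2 ≤ k) :
    ∃ C, 0 < C ∧ ∀ (σ y : ℝ) (Q : ℕ) (r : ℚ), IsArcOrder σ Q → r ≠ 0 → y ∈ majorArc Q r →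
      ‖laplaceCentred k (arcOffset σ 0 y) - thetaRat r (arcOffset σ r y) ^ k / arcOffset σ 0 y‖ ≤
        C * (σ ^ (-((k : ℝ) / 4)) / |y|) := by
  obtain ⟨C, hC, hE⟩ := exists_norm_theta_error_le hk
  refine ⟨C + 2 * (2 * π) ^ ((k : ℝ) / 2), by positivity, fun σ y Q r h hr hy => ?_⟩
  have h3 := h.pos
  have hyQ := le_abs_of_notMem_majorArc_zero h fun h0 => hr (majorArc_disjoint hy h0)
  have hy0 : 0 < |y| := lt_of_lt_of_le (div_pos Real.pi_pos (by linarith [h.cast_pos])) hyQ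
  obtain ⟨h5, h6⟩ := norm_thetaRat_zero_far hk h hyQ
  have h7 := hE r σ y h.pos (h.norm_sq_le_of_mem hy)
  have hyw := abs_le_norm_arcOffset_zero σ y
  set w := arcOffset σ 0 y
  set E := thetaSum w ^ k - thetaRat r (arcOffset σ r y) ^ k
  have h9 : ‖E / w‖ ≤ C * (σ ^ (-((k : ℝ) / 4)) / |y|) := by
    rw [norm_div, ← mul_div_assoc]; gcongr
  have e : laplaceCentred k w - thetaRat r (arcOffset σ r y) ^ k / w =
      E / w - thetaRat 0 w ^ k / w + thetaRat 0 w ^ k / 2 := by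
    simp only [laplaceCentred, E]; ring
  rw [e]
  have t1 := norm_add_le (E / w - thetaRat 0 w ^ k / w) (thetaRat 0 w ^ k / 2)
  have t2 := norm_sub_le (E / w) (thetaRat 0 w ^ k / w)
  linarith

theorem abs_norm_sq_sub_norm_sq_le (a b : ℂ) :
    |‖a‖ ^ 2 - ‖b‖ ^ 2| ≤ ‖a - b‖ ^ 2 + 2 * (‖b‖ * ‖a - b‖) := by
  have h1 := abs_norm_sub_norm_le a b
  have h2 : ‖a‖ ≤ ‖a - b‖ + ‖b‖ := norm_le_norm_sub_add a b
  have e : ‖a‖ ^ 2 - ‖b‖ ^ 2 = (‖a‖ - ‖b‖) * (‖a‖ + ‖b‖) := by ring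
  rw [e, abs_mul, abs_of_nonneg (by positivity : 0 ≤ ‖a‖ + ‖b‖)]
  calc |‖a‖ - ‖b‖| * (‖a‖ + ‖b‖) ≤ ‖a - b‖ * (‖a - b‖ + ‖b‖ + ‖b‖) := by gcongr
    _ = _ := by ring

theorem exists_norm_sq_laplace_off_arcs_le {k : ℕ} (hk : 2 ≤ k) :
    ∃ C, 0 < C ∧ ∀ (σ y : ℝ) (Q : ℕ), IsArcOrder σ Q → (∀ r, y ∉ majorArc Q r) →
      ‖laplaceCentred k (arcOffset σ 0 y)‖ ^ 2 ≤ C * (σ ^ (-((k : ℝ) / 2)) * |y| ^ (-2 : ℝ)) := by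
  obtain ⟨C, hC, hE⟩ := exists_norm_laplace_off_arcs_le hk
  refine ⟨C ^ 2, by positivity, fun σ y Q h hy => ?_⟩
  have h1 := hE σ y Q h hy
  calc _ ≤ (C * (σ ^ (-((k : ℝ) / 4)) / |y|)) ^ 2 := by gcongr
    _ = _ := by
      rw [mul_pow, div_pow, ← Real.rpow_mul_natCast h.pos.le, Real.rpow_neg (abs_nonneg y),
        show (2 : ℝ) = ((2 : ℕ) : ℝ) by norm_num, Real.rpow_natCast, div_eq_mul_inv]
      congr 3; push_cast; ring

theorem exists_laplace_near_zero {k : ℕ} :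
    ∃ C, 0 < C ∧ ∀ (σ y : ℝ) (Q : ℕ), IsArcOrder σ Q → y ∈ majorArc Q 0 →
      |‖laplaceCentred k (arcOffset σ 0 y)‖ ^ 2 - mainDensity k σ 0 y| ≤
        C * σ ^ (-((k : ℝ) / 2 + 1)) := by
  obtain ⟨C₁, hC₁, hE₁⟩ := exists_norm_thetaSum_sub_thetaRat_le k (B := ((k : ℝ) / 2 + 1) / 2) (by positivity)
  obtain ⟨C₂, hC₂, hE₂⟩ := exists_norm_thetaSum_sub_thetaRat_le k (B := ((k : ℝ) + 1) / 2) (by positivity)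
  refine ⟨C₁ ^ 2 + (2 * π) ^ ((k : ℝ) / 2) * C₂, by positivity, fun σ y Q h hy => ?_⟩
  have h3 := h.pos
  have hb := h.norm_sq_le_of_mem hy
  have h1 := hE₁ 0 σ y h3 hb
  have h2 := hE₂ 0 σ y h3 hb
  have hM := norm_thetaRat_zero_pow_le k h3 y
  have hw := norm_arcOffset_pos h3 0 y
  simp only [Rat.den_zero, Nat.cast_one, one_mul] at h1 h2
  set w := arcOffset σ 0 y
  set M := thetaRat 0 w ^ k
  set E := thetaSum w ^ k - M
  have e : laplaceCentred k w - M / 2 = E / w := by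
    simp only [laplaceCentred, E, M]; ring
  have hd : mainDensity k σ 0 y = ‖M / 2‖ ^ 2 := by
    rw [mainDensity, if_pos rfl, norm_div, Complex.norm_ofNat]
    simp only [M, w]; ring
  have f1 : ‖E / w‖ ≤ C₁ * σ ^ (-(((k : ℝ) / 2 + 1) / 2)) := by
    rw [norm_div, ← sq_rpow_half_mul hw h3, neg_add', Real.rpow_sub_one hw.ne']
    calc ‖E‖ / ‖w‖ ≤ C₁ * (‖w‖ ^ (-((k : ℝ) / 2)) * (‖w‖ ^ 2 / σ) ^ (((k : ℝ) / 2 + 1) / 2)) / ‖w‖ := by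
          gcongr
      _ = _ := by ring
  have f2 : ‖M‖ * ‖E / w‖ ≤ (2 * π) ^ ((k : ℝ) / 2) * C₂ * σ ^ (-(((k : ℝ) + 1) / 2)) := by
    rw [norm_div, ← sq_rpow_half_mul hw h3, neg_add', Real.rpow_sub_one hw.ne']
    have e3 : ‖w‖ ^ (-(k : ℝ)) = ‖w‖ ^ (-((k : ℝ) / 2)) * ‖w‖ ^ (-((k : ℝ) / 2)) := by
      rw [← Real.rpow_add hw]; congr 1; ring
    rw [e3]
    calc ‖M‖ * (‖E‖ / ‖w‖) ≤ ((2 * π) ^ ((k : ℝ) / 2) * ‖w‖ ^ (-((k : ℝ) / 2))) *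
          (C₂ * (‖w‖ ^ (-((k : ℝ) / 2)) * (‖w‖ ^ 2 / σ) ^ (((k : ℝ) + 1) / 2)) / ‖w‖) := by
          gcongr
      _ = _ := by ring
  have f3 : ‖E / w‖ ^ 2 ≤ C₁ ^ 2 * σ ^ (-((k : ℝ) / 2 + 1)) := by
    calc ‖E / w‖ ^ 2 ≤ (C₁ * σ ^ (-(((k : ℝ) / 2 + 1) / 2))) ^ 2 := by gcongr
      _ = _ := by
        rw [mul_pow, ← Real.rpow_mul_natCast h3.le]; congr 2; push_cast; ring
  have f4 : σ ^ (-(((k : ℝ) + 1) / 2)) ≤ σ ^ (-((k : ℝ) / 2 + 1)) := h.rpow_anti (by linarith)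
  have f5 := abs_norm_sq_sub_norm_sq_le (laplaceCentred k w) (M / 2)
  rw [e] at f5
  rw [hd]
  have f6 : 2 * (‖M / 2‖ * ‖E / w‖) = ‖M‖ * ‖E / w‖ := by
    rw [norm_div M, Complex.norm_ofNat]; ring
  rw [f6] at f5
  have f7 := mul_le_mul_of_nonneg_left f4 (by positivity : 0 ≤ (2 * π) ^ ((k : ℝ) / 2) * C₂)
  linarith

theorem abs_rat_le_abs_of_mem {Q : ℕ} {r : ℚ} {y : ℝ} (hQ : 1 ≤ Q) (hr : r ≠ 0) (hy : y ∈ majorArc Q r) :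
    π * |(r : ℝ)| ≤ |y| := by
  have hq : (0 : ℝ) < r.den := by exact_mod_cast r.den_pos
  have hQ' : (1 : ℝ) ≤ Q := by exact_mod_cast hQ
  have h1 : (1 : ℝ) / r.den ≤ |(r : ℝ)| := by
    have := one_le_den_mul_den_mul_abs_sub hr
    simp only [Rat.den_zero, Nat.cast_one, mul_one, Rat.cast_zero, sub_zero] at this
    rw [div_le_iff₀ hq]; linarith
  have h2 : π / (r.den * Q) ≤ π * |(r : ℝ)| := by
    calc π / (r.den * Q) ≤ π / (r.den * 1) := by gcongr
      _ = π * (1 / r.den) := by ring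
      _ ≤ _ := by gcongr
  have h3 := hy.2
  have h4 : |2 * π * r| ≤ |y - 2 * π * r| + |y| := by
    have := abs_sub_abs_le_abs_sub (2 * π * (r : ℝ)) y
    rw [abs_sub_comm] at this
    linarith
  rw [abs_mul, abs_of_pos (by positivity : 0 < 2 * π)] at h4
  linarith

theorem abs_inv_sq_sub_inv_sq_le {σ y : ℝ} {r : ℚ} (hσ : 0 < σ) (hr : r ≠ 0)
    (hy : π * |(r : ℝ)| ≤ |y|) :
    |1 / ‖arcOffset σ 0 y‖ ^ 2 - 1 / (2 * π * r) ^ 2| ≤ ‖arcOffset σ r y‖ * |(r : ℝ)| ^ (-3 : ℝ) := by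
  have hr0 : 0 < |(r : ℝ)| := by rw [abs_pos]; exact_mod_cast hr
  have hw := norm_arcOffset_pos hσ 0 y
  have hyw := abs_le_norm_arcOffset_zero σ y
  set w := arcOffset σ 0 y with hwdef
  set v := arcOffset σ r y with hv
  set R := |(r : ℝ)| with hR
  have hpi := Real.pi_gt_three
  have hwr : π * R ≤ ‖w‖ := hy.trans hyw
  have h0 : ‖(((2 * π * r : ℝ)) : ℂ) * Complex.I‖ = 2 * π * R := by
    rw [norm_mul, Complex.norm_I, mul_one, Complex.norm_real, Real.norm_eq_abs, abs_mul,
      abs_of_pos (by positivity : 0 < 2 * π)]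
  have hsub : w - (((2 * π * r : ℝ)) : ℂ) * Complex.I = v := by
    simp only [hwdef, hv, arcOffset]; push_cast; ring
  have h1 : |‖w‖ - 2 * π * R| ≤ ‖v‖ := by
    rw [← hsub, ← h0]; exact abs_norm_sub_norm_le _ _
  have e0 : (2 * π * (r : ℝ)) ^ 2 = (2 * π * R) ^ 2 := by
    rw [mul_pow (2 * π), mul_pow (2 * π), sq_abs]
  rw [e0]
  have e1 : 1 / ‖w‖ ^ 2 - 1 / (2 * π * R) ^ 2 =
      (2 * π * R - ‖w‖) * ((2 * π * R + ‖w‖) / (‖w‖ ^ 2 * (2 * π * R) ^ 2)) := by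
    field_simp; ring
  rw [e1, abs_mul, abs_sub_comm, abs_of_nonneg (by positivity : 0 ≤ (2 * π * R + ‖w‖) / (‖w‖ ^ 2 * (2 * π * R) ^ 2))]
  have h2 : (2 * π * R + ‖w‖) / (‖w‖ ^ 2 * (2 * π * R) ^ 2) ≤ R ^ (-3 : ℝ) := by
    rw [Real.rpow_neg hr0.le, show (3 : ℝ) = ((3 : ℕ) : ℝ) by norm_num, Real.rpow_natCast,
      ← one_div, div_le_div_iff₀ (by positivity) (by positivity)]
    have h3 : R ≤ ‖w‖ := by nlinarith
    have h4 : 2 * π * R + ‖w‖ ≤ 3 * ‖w‖ := by linarith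
    have h5 : (6 * R) ^ 2 ≤ (2 * π * R) ^ 2 := by gcongr; linarith
    calc (2 * π * R + ‖w‖) * R ^ 3 ≤ 3 * ‖w‖ * (R * R ^ 2) := by
          rw [show R ^ 3 = R * R ^ 2 by ring]; gcongr
      _ ≤ 3 * ‖w‖ * (‖w‖ * R ^ 2) := by gcongr
      _ ≤ ‖w‖ ^ 2 * (6 * R) ^ 2 := by nlinarith [sq_nonneg (‖w‖ * R)]
      _ ≤ ‖w‖ ^ 2 * (2 * π * R) ^ 2 := by gcongr
      _ = _ := by ring
  gcongr

theorem exists_laplace_near_rat {k : ℕ} (hk : 2 ≤ k) :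
    ∃ C, 0 < C ∧ ∀ (σ y : ℝ) (Q : ℕ) (r : ℚ), IsArcOrder σ Q → r ≠ 0 → y ∈ majorArc Q r →
      |‖laplaceCentred k (arcOffset σ 0 y)‖ ^ 2 - mainDensity k σ r y| ≤
        C * (σ ^ (-((k : ℝ) / 2)) * |y| ^ (-2 : ℝ) +
          ((r.den : ℝ) ^ (-((k : ℝ) / 2)) * |(r : ℝ)| ^ (-2 : ℝ) * σ ^ (-((k : ℝ) / 4)) * ‖arcOffset σ r y‖ ^ (-((k : ℝ) / 2)) +
          (r.den : ℝ) ^ (-(k : ℝ)) * |(r : ℝ)| ^ (-3 : ℝ) * ‖arcOffset σ r y‖ ^ (-((k : ℝ) - 1)))) := by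
  obtain ⟨C, hC, hE⟩ := exists_norm_laplace_sub_le hk
  set D : ℝ := (2 * π) ^ ((k : ℝ) / 2) with hD
  have hD0 : 0 < D := by positivity
  refine ⟨C ^ 2 + 2 * D * C + D ^ 2, by positivity, fun σ y Q r h hr hy => ?_⟩
  have h3 := h.pos
  have hq : (0 : ℝ) < r.den := by exact_mod_cast r.den_pos
  have hr0 : 0 < |(r : ℝ)| := by rw [abs_pos]; exact_mod_cast hr
  have hry := abs_rat_le_abs_of_mem h.one_le hr hy
  have hpi := Real.pi_gt_three
  have hry' : |(r : ℝ)| ≤ |y| := by nlinarith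
  have hy0 : 0 < |y| := by linarith
  have h1 := hE σ y Q r h hr hy
  have hM := norm_thetaRat_pow_le k r (v := arcOffset σ r y) (by rwa [arcOffset_re])
  have hinv := abs_inv_sq_sub_inv_sq_le h3 hr hry
  have hyw := abs_le_norm_arcOffset_zero σ y
  have hv := norm_arcOffset_pos h3 r y
  rw [Real.mul_rpow hq.le hv.le, ← hD] at hM
  have hK : mainDensity k σ r y = ‖thetaRat r (arcOffset σ r y) ^ k‖ ^ 2 * (1 / (2 * π * r) ^ 2) := by
    rw [mainDensity, if_neg hr]
  rw [hK]
  set w := arcOffset σ 0 y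
  set v := arcOffset σ r y
  set M := thetaRat r v ^ k
  set U := laplaceCentred k w
  set S4 := σ ^ (-((k : ℝ) / 4)) with hS4
  set q2 := (r.den : ℝ) ^ (-((k : ℝ) / 2)) with hq2
  set v2 := ‖v‖ ^ (-((k : ℝ) / 2)) with hv2
  have hS40 : 0 < S4 := by positivity
  have hq20 : 0 < q2 := by positivity
  have hv20 : 0 < v2 := by positivity
  have p2 : ∀ x : ℝ, 0 ≤ x → x ^ (-2 : ℝ) = 1 / x ^ 2 := fun x hx => by
    rw [Real.rpow_neg hx, one_div, show (2 : ℝ) = ((2 : ℕ) : ℝ) by norm_num, Real.rpow_natCast]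
  have hS2 : σ ^ (-((k : ℝ) / 2)) = S4 ^ 2 := by
    rw [hS4, ← Real.rpow_mul_natCast h3.le]; congr 1; push_cast; ring
  have hqk : (r.den : ℝ) ^ (-(k : ℝ)) = q2 ^ 2 := by
    rw [hq2, ← Real.rpow_mul_natCast hq.le]; congr 1; push_cast; ring
  have hvk : ‖v‖ ^ (-((k : ℝ) - 1)) = v2 ^ 2 * ‖v‖ := by
    rw [hv2, ← Real.rpow_mul_natCast hv.le, ← Real.rpow_add_one hv.ne']; congr 1; push_cast; ring
  rw [hS2, hqk, hvk, p2 _ hy0.le, p2 _ hr0.le]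
  have g1 : ‖U - M / w‖ ^ 2 ≤ C ^ 2 * (S4 ^ 2 * (1 / |y| ^ 2)) := by
    calc ‖U - M / w‖ ^ 2 ≤ (C * (S4 / |y|)) ^ 2 := by gcongr
      _ = _ := by ring
  have g2 : 2 * (‖M / w‖ * ‖U - M / w‖) ≤ 2 * D * C * (q2 * (1 / |(r : ℝ)| ^ 2) * S4 * v2) := by
    have a1 : ‖M / w‖ ≤ D * (q2 * v2) / |(r : ℝ)| := by
      rw [norm_div]; gcongr; linarith
    have a2 : C * (S4 / |y|) ≤ C * (S4 / |(r : ℝ)|) := by gcongr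
    calc 2 * (‖M / w‖ * ‖U - M / w‖) ≤ 2 * ((D * (q2 * v2) / |(r : ℝ)|) * (C * (S4 / |(r : ℝ)|))) := by
          gcongr; exact h1.trans a2
      _ = _ := by field_simp
  have g3 : |‖M / w‖ ^ 2 - ‖M‖ ^ 2 * (1 / (2 * π * r) ^ 2)| ≤
      D ^ 2 * (q2 ^ 2 * |(r : ℝ)| ^ (-3 : ℝ) * (v2 ^ 2 * ‖v‖)) := by
    have : ‖M / w‖ ^ 2 - ‖M‖ ^ 2 * (1 / (2 * π * r) ^ 2) = ‖M‖ ^ 2 * (1 / ‖w‖ ^ 2 - 1 / (2 * π * r) ^ 2) := by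
      rw [norm_div]; ring
    rw [this, abs_mul, abs_of_nonneg (by positivity : 0 ≤ ‖M‖ ^ 2)]
    calc _ ≤ (D * (q2 * v2)) ^ 2 * (‖v‖ * |(r : ℝ)| ^ (-3 : ℝ)) := by gcongr
      _ = _ := by ring
  have g4 := abs_norm_sq_sub_norm_sq_le U (M / w)
  have g5 := abs_sub_le (‖U‖ ^ 2) (‖M / w‖ ^ 2) (‖M‖ ^ 2 * (1 / (2 * π * r) ^ 2))
  have x1 : 0 ≤ S4 ^ 2 * (1 / |y| ^ 2) := by positivity
  have x2 : 0 ≤ q2 * (1 / |(r : ℝ)| ^ 2) * S4 * v2 := by positivity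
  have x3 : 0 ≤ q2 ^ 2 * |(r : ℝ)| ^ (-3 : ℝ) * (v2 ^ 2 * ‖v‖) := by positivity
  set X1 := S4 ^ 2 * (1 / |y| ^ 2)
  set X2 := q2 * (1 / |(r : ℝ)| ^ 2) * S4 * v2
  set X3 := q2 ^ 2 * |(r : ℝ)| ^ (-3 : ℝ) * (v2 ^ 2 * ‖v‖)
  have c1 : 0 ≤ D * C := by positivity
  have c2 : 0 ≤ C ^ 2 := by positivity
  have c3 : 0 ≤ D ^ 2 := by positivity
  have m1 := mul_nonneg c1 x1
  have m2 := mul_nonneg c1 x3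
  have m3 := mul_nonneg c2 x2
  have m4 := mul_nonneg c2 x3
  have m5 := mul_nonneg c3 x1
  have m6 := mul_nonneg c3 x2
  have := g5.trans (add_le_add (g4.trans (add_le_add g1 g2)) g3)
  nlinarith

/-- The constant in front of `‖arcOffset σ r y‖ ^ (-k)` in `mainDensity`. -/
noncomputable def mainCoeff (k : ℕ) (r : ℚ) : ℝ :=
  haveI : NeZero r.den := ⟨r.den_nz⟩
  π ^ k * ((r.den : ℝ) ^ (2 * k))⁻¹ * (‖quadGauss r.den ((-r.num : ℤ) : ZMod r.den) 0‖ ^ 2) ^ k *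
    (if r = 0 then 1 / 4 else 1 / (2 * π * r) ^ 2)

theorem mainDensity_eq (k : ℕ) {σ : ℝ} (hσ : 0 < σ) (r : ℚ) (y : ℝ) :
    mainDensity k σ r y = mainCoeff k r * ‖arcOffset σ r y‖ ^ (-(k : ℝ)) := by
  have : NeZero r.den := ⟨r.den_nz⟩
  have hv := norm_arcOffset_pos hσ r y
  have hq : (0 : ℝ) < r.den := by exact_mod_cast r.den_pos
  have e : ‖thetaRat r (arcOffset σ r y) ^ k‖ ^ 2 = π ^ k * ((r.den : ℝ) ^ (2 * k))⁻¹ *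
      (‖quadGauss r.den ((-r.num : ℤ) : ZMod r.den) 0‖ ^ 2) ^ k * ‖arcOffset σ r y‖ ^ (-(k : ℝ)) := by
    rw [norm_pow, ← pow_mul, mul_comm k 2, pow_mul, thetaRat, thetaMain, norm_mul, mul_pow, norm_cpow_half,
      Real.sq_sqrt (norm_nonneg _), mul_pow, norm_div, norm_mul, norm_pow, Complex.norm_natCast,
      Complex.norm_real, Real.norm_of_nonneg Real.pi_pos.le, div_pow, mul_pow, ← pow_mul,
      Real.rpow_neg hv.le, Real.rpow_natCast]
    field_simp
  rw [mainDensity, mainCoeff, e]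
  ring

theorem mainCoeff_nonneg (k : ℕ) (r : ℚ) : 0 ≤ mainCoeff k r := by
  unfold mainCoeff
  split_ifs <;> positivity

theorem mainCoeff_le (k : ℕ) {r : ℚ} (hr : r ≠ 0) :
    mainCoeff k r ≤ (2 * π) ^ k * ((r.den : ℝ) ^ (2 - (k : ℝ)) * ((r.num : ℝ) ^ 2)⁻¹) := by
  have : NeZero r.den := ⟨r.den_nz⟩
  have hq : (0 : ℝ) < r.den := by exact_mod_cast r.den_pos
  have ha : (r.num : ℝ) ≠ 0 := by exact_mod_cast Rat.num_ne_zero.2 hr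
  have ha2 : 0 < (r.num : ℝ) ^ 2 := by positivity
  have hG := quadGauss_normSq_le r.den ((-r.num : ℤ) : ZMod r.den) 0
    (isUnit_neg_intCast (Rat.isCoprime_num_den r))
  have hr' : (r : ℝ) = r.num / r.den := by exact_mod_cast (Rat.num_div_den r).symm
  rw [mainCoeff, if_neg hr]
  have e : 1 / (2 * π * (r : ℝ)) ^ 2 ≤ (r.den : ℝ) ^ 2 * ((r.num : ℝ) ^ 2)⁻¹ := by
    rw [hr']
    have : 1 / (2 * π * ((r.num : ℝ) / r.den)) ^ 2 = (1 / (2 * π) ^ 2) * ((r.den : ℝ) ^ 2 * ((r.num : ℝ) ^ 2)⁻¹) := by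
      field_simp
    rw [this]
    refine mul_le_of_le_one_left (by positivity) ?_
    rw [div_le_one (by positivity)]
    nlinarith [Real.pi_gt_three]
  calc _ ≤ π ^ k * ((r.den : ℝ) ^ (2 * k))⁻¹ * (2 * r.den) ^ k *
        ((r.den : ℝ) ^ 2 * ((r.num : ℝ) ^ 2)⁻¹) := by gcongr
    _ = _ := by
      rw [Real.rpow_sub hq, Real.rpow_natCast, mul_pow, mul_pow, two_mul k, pow_add]
      rw [show ((r.den : ℝ) ^ (2 : ℝ)) = (r.den : ℝ) ^ 2 by norm_cast]
      field_simp

theorem lintegral_tail_rpow_le {p c : ℝ} (hp : 1 < p) (hc : 0 < c) :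
    ∫⁻ u in {u : ℝ | c ≤ |u|}, ENNReal.ofReal (|u| ^ (-p)) ≤
      ENNReal.ofReal (2 / (p - 1) * c ^ (1 - p)) := by
  have h1 : ∫⁻ u in Set.Ici c, ENNReal.ofReal (|u| ^ (-p)) = ENNReal.ofReal (1 / (p - 1) * c ^ (1 - p)) := by
    rw [setLIntegral_congr Ioi_ae_eq_Ici.symm]
    rw [setLIntegral_congr_fun (g := fun u => ENNReal.ofReal (u ^ (-p))) measurableSet_Ioi
      (fun u hu => by simp only; rw [abs_of_pos (hc.trans hu)])]
    rw [← ofReal_integral_eq_lintegral_ofReal (integrableOn_Ioi_rpow_of_lt (by linarith) hc)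
      (ae_restrict_of_forall_mem measurableSet_Ioi fun u hu => Real.rpow_nonneg (hc.trans hu).le _),
      integral_Ioi_rpow_of_lt (by linarith) hc]
    congr 1
    have : p - 1 ≠ 0 := by linarith
    rw [show -p + 1 = 1 - p by ring, show 1 - p = -(p - 1) by ring]
    field_simp
  have h2 : ∫⁻ u in Set.Iic (-c), ENNReal.ofReal (|u| ^ (-p)) = ∫⁻ u in Set.Ici c, ENNReal.ofReal (|u| ^ (-p)) := by
    rw [← lintegral_indicator measurableSet_Iic, ← lintegral_indicator measurableSet_Ici,
      ← lintegral_neg_eq_self]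
    refine lintegral_congr fun u => ?_
    by_cases h : c ≤ u
    · simp [h]
    · simp [h]
  have h3 : {u : ℝ | c ≤ |u|} = Set.Ici c ∪ Set.Iic (-c) := by
    ext u; simp [le_abs, le_neg]
  rw [h3]
  refine (lintegral_union_le _ _ _).trans ?_
  rw [h2, h1, ← ENNReal.ofReal_add (by have : 0 < p - 1 := by linarith
                                       positivity) (by have : 0 < p - 1 := by linarith
                                                       positivity)]
  refine ENNReal.ofReal_le_ofReal (le_of_eq ?_)
  ring

theorem lintegral_shift_far_le {p c : ℝ} (hp : 1 < p) (hc : 0 < c) (σ : ℝ) (r : ℚ) :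
    ∫⁻ y in {y : ℝ | c ≤ |y - 2 * π * r|}, ENNReal.ofReal (‖arcOffset σ r y‖ ^ (-p)) ≤
      ENNReal.ofReal (2 / (p - 1) * c ^ (1 - p)) := by
  refine le_trans ?_ (lintegral_tail_rpow_le hp hc)
  have m1 : MeasurableSet {y : ℝ | c ≤ |y - 2 * π * r|} := measurableSet_le measurable_const (by fun_prop)
  have m2 : MeasurableSet {y : ℝ | c ≤ |y|} := measurableSet_le measurable_const (by fun_prop)
  rw [← lintegral_indicator m1, ← lintegral_indicator m2,
    ← lintegral_sub_right_eq_self ({y : ℝ | c ≤ |y|}.indicator fun u => ENNReal.ofReal (|u| ^ (-p))) (2 * π * (r : ℝ))]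
  refine lintegral_mono fun y => ?_
  by_cases h : c ≤ |y - 2 * π * r|
  · simp only [Set.indicator, Set.mem_ofPred_eq, h, if_true]
    refine ENNReal.ofReal_le_ofReal ?_
    exact Real.rpow_le_rpow_of_nonpos (hc.trans_le h) (abs_le_norm_arcOffset σ r y) (by linarith)
  · simp [Set.indicator, h]

theorem lintegral_arcOffset_rpow_le {p σ : ℝ} (hp : 1 < p) (hσ : 0 < σ) (r : ℚ) :
    ∫⁻ y, ENNReal.ofReal (‖arcOffset σ r y‖ ^ (-p)) ≤
      ENNReal.ofReal ((2 + 2 / (p - 1)) * σ ^ (1 - p)) := by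
  have m1 : MeasurableSet {y : ℝ | σ ≤ |y - 2 * π * r|} := measurableSet_le measurable_const (by fun_prop)
  have hp1 : 0 < p - 1 := by linarith
  rw [← lintegral_add_compl _ m1, add_mul, ENNReal.ofReal_add (by positivity) (by positivity), add_comm]
  refine add_le_add ?_ (lintegral_shift_far_le hp hσ σ r)
  have hs : {y : ℝ | σ ≤ |y - 2 * π * r|}ᶜ = Metric.ball (2 * π * (r : ℝ)) σ := by
    ext y; simp [Real.dist_eq]
  rw [hs]
  calc _ ≤ ∫⁻ y in Metric.ball (2 * π * (r : ℝ)) σ, ENNReal.ofReal (σ ^ (-p)) := by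
        refine lintegral_mono fun y => ENNReal.ofReal_le_ofReal ?_
        exact Real.rpow_le_rpow_of_nonpos hσ (le_norm_arcOffset σ r y) (by linarith)
    _ = _ := by
        rw [setLIntegral_const, Real.volume_ball, ← ENNReal.ofReal_mul (by positivity)]
        congr 1
        rw [show 1 - p = -p + 1 by ring, Real.rpow_add_one hσ.ne']
        ring

theorem tsum_rat_le (f : ℕ → ENNReal) :
    ∑' r : ℚ, f r.den * ENNReal.ofReal (((r.num : ℝ) ^ 2)⁻¹) ≤
      (∑' q, f q) * ∑' a : ℤ, ENNReal.ofReal (((a : ℝ) ^ 2)⁻¹) := by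
  have inj : Function.Injective (fun r : ℚ => (r.den, r.num)) := fun r s h => by
    simp only [Prod.mk.injEq] at h
    exact Rat.ext h.2 h.1
  calc _ ≤ ∑' p : ℕ × ℤ, f p.1 * ENNReal.ofReal (((p.2 : ℝ) ^ 2)⁻¹) :=
        ENNReal.tsum_comp_le_tsum_of_injective inj
          (fun p : ℕ × ℤ => f p.1 * ENNReal.ofReal (((p.2 : ℝ) ^ 2)⁻¹))
    _ = _ := by
        rw [ENNReal.tsum_prod']
        simp_rw [ENNReal.tsum_mul_left]
        rw [ENNReal.tsum_mul_right]

/-- Summation over all rationals of a quantity decaying in denominator and numerator. -/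
theorem exists_tsum_rat_rpow_le {x : ℝ} (hx : 1 < x) : ∃ C : ℝ, 0 < C ∧
    ∑' r : ℚ, ENNReal.ofReal ((r.den : ℝ) ^ (-x) * ((r.num : ℝ) ^ 2)⁻¹) ≤ ENNReal.ofReal C := by
  have s1 : Summable (fun q : ℕ => (q : ℝ) ^ (-x)) := Real.summable_nat_rpow.2 (by linarith)
  have s2 : Summable (fun a : ℤ => ((a : ℝ) ^ 2)⁻¹) := by
    simpa using Real.summable_one_div_int_pow.2 (one_lt_two)
  refine ⟨(∑' q : ℕ, (q : ℝ) ^ (-x)) * (∑' a : ℤ, ((a : ℝ) ^ 2)⁻¹) + 1, ?_, ?_⟩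
  · have : 0 ≤ ∑' q : ℕ, (q : ℝ) ^ (-x) := tsum_nonneg fun q => by positivity
    have : 0 ≤ ∑' a : ℤ, ((a : ℝ) ^ 2)⁻¹ := tsum_nonneg fun q => by positivity
    positivity
  · simp_rw [ENNReal.ofReal_mul (Real.rpow_nonneg (Nat.cast_nonneg _) _)]
    refine (tsum_rat_le fun q => ENNReal.ofReal ((q : ℝ) ^ (-x))).trans ?_
    rw [← ENNReal.ofReal_tsum_of_nonneg (fun q => by positivity) s1,
      ← ENNReal.ofReal_tsum_of_nonneg (fun q => by positivity) s2, ← ENNReal.ofReal_mul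
        (tsum_nonneg fun q => by positivity)]
    exact ENNReal.ofReal_le_ofReal (by linarith)

theorem IsArcOrder.rpow_mul_far_le {σ : ℝ} {Q : ℕ} (h : IsArcOrder σ Q) {k ε q : ℝ} (hk : 5 ≤ k)
    (hε : 0 ≤ ε) (hq : 1 ≤ q) (hqQ : q ≤ Q) :
    q ^ (2 - k) * (π / (q * Q)) ^ (1 - k) ≤ σ ^ (2 - k - ε) * q ^ (-(1 + 2 * ε)) := by
  have hq0 : 0 < q := by linarith
  have hQ := h.cast_pos
  have hQ0 : (0 : ℝ) < Q := by linarith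
  calc q ^ (2 - k) * (π / (q * Q)) ^ (1 - k)
      ≤ q ^ (2 - k) * (1 / (q * Q)) ^ (1 - k) := by
        refine mul_le_mul_of_nonneg_left ?_ (by positivity)
        refine Real.rpow_le_rpow_of_nonpos (by positivity) ?_ (by linarith)
        gcongr; linarith [Real.pi_gt_three]
    _ = q ^ (2 - k) * (q ^ (k - 1) * Q ^ (k - 1)) := by
        rw [one_div, ← Real.rpow_neg_eq_inv_rpow, ← Real.mul_rpow hq0.le hQ0.le]; congr 2; ring
    _ = q ^ (-(1 + 2 * ε)) * (q ^ (2 + 2 * ε) * Q ^ (k - 1)) := by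
        rw [← mul_assoc, ← mul_assoc, ← Real.rpow_add hq0, ← Real.rpow_add hq0]; congr 2; ring
    _ ≤ q ^ (-(1 + 2 * ε)) * ((Q : ℝ) ^ (2 + 2 * ε) * Q ^ (k - 1)) := by gcongr
    _ = q ^ (-(1 + 2 * ε)) * (Q : ℝ) ^ (k + 1 + 2 * ε) := by
        rw [← Real.rpow_add hQ0]; congr 2; ring
    _ ≤ q ^ (-(1 + 2 * ε)) * σ ^ (2 - k - ε) := by
        gcongr
        refine (h.rpow_cast_le (by linarith)).trans (h.rpow_anti ?_)
        linarith
    _ = _ := mul_comm _ _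

theorem IsArcOrder.rpow_mul_large_le {σ : ℝ} {Q : ℕ} (h : IsArcOrder σ Q) {k ε q : ℝ} (hk : 5 ≤ k)
    (hε : ε ≤ 1) (hq : (Q : ℝ) + 1 ≤ q) :
    q ^ (2 - k) * σ ^ (1 - k) ≤ σ ^ (2 - k - ε) * q ^ (-(1 + 2 * ε)) := by
  have hQ := h.cast_pos
  have hq0 : 0 < q := by linarith
  have hσ := h.pos
  have h1 : 1 ≤ q ^ 2 * σ := by
    refine h.le_sq_mul.trans ?_
    gcongr
  have h2 : σ ^ (-(1 - ε)) ≤ q ^ (2 * (1 - ε)) := by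
    rw [Real.rpow_neg hσ.le, inv_le_iff_one_le_mul₀ (by positivity), Real.rpow_mul hq0.le, ← Real.mul_rpow (by positivity) hσ.le]
    refine Real.one_le_rpow ?_ (by linarith)
    exact_mod_cast h1
  calc q ^ (2 - k) * σ ^ (1 - k) = σ ^ (2 - k - ε) * (q ^ (2 - k) * σ ^ (-(1 - ε))) := by
        rw [mul_left_comm, ← Real.rpow_add hσ]; congr 2; ring
    _ ≤ σ ^ (2 - k - ε) * (q ^ (2 - k) * q ^ (2 * (1 - ε))) := by gcongr
    _ = σ ^ (2 - k - ε) * q ^ (4 - k - 2 * ε) := by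
        rw [← Real.rpow_add hq0]; congr 2; ring
    _ ≤ _ := by
        refine mul_le_mul_of_nonneg_left ?_ (by positivity)
        exact Real.rpow_le_rpow_of_exponent_le (by linarith) (by linarith)

theorem IsArcOrder.rpow_mul_cross_le {σ : ℝ} {Q : ℕ} (h : IsArcOrder σ Q) {k ε q : ℝ} (hk : 5 ≤ k)
    (hε : 0 ≤ ε) (hq : 1 ≤ q) (hqQ : q ≤ Q) :
    q ^ (2 - k / 2) * (σ ^ (-(k / 4)) * σ ^ (1 - k / 2)) ≤ σ ^ (2 - k - ε) * q ^ (-(1 + 2 * ε)) := by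
  have hq0 : 0 < q := by linarith
  have hσ := h.pos
  calc q ^ (2 - k / 2) * (σ ^ (-(k / 4)) * σ ^ (1 - k / 2))
      ≤ q ^ (-(1 / 2) : ℝ) * (σ ^ (-(k / 4)) * σ ^ (1 - k / 2)) := by
        gcongr
        linarith
    _ = q ^ (-(1 + 2 * ε)) * (q ^ (1 / 2 + 2 * ε) * (σ ^ (-(k / 4)) * σ ^ (1 - k / 2))) := by
        rw [← mul_assoc (q ^ _) (q ^ _), ← Real.rpow_add hq0]; congr 2; ring
    _ ≤ q ^ (-(1 + 2 * ε)) * ((Q : ℝ) ^ (1 / 2 + 2 * ε) * (σ ^ (-(k / 4)) * σ ^ (1 - k / 2))) := by gcongr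
    _ ≤ q ^ (-(1 + 2 * ε)) * (σ ^ (-((1 / 2 + 2 * ε) / 2)) * (σ ^ (-(k / 4)) * σ ^ (1 - k / 2))) := by
        gcongr
        exact h.rpow_cast_le (by linarith)
    _ ≤ q ^ (-(1 + 2 * ε)) * σ ^ (2 - k - ε) := by
        gcongr
        rw [← Real.rpow_add hσ, ← Real.rpow_add hσ]
        exact h.rpow_anti (by linarith)
    _ = _ := mul_comm _ _

theorem abs_rat_rpow_neg_le {r : ℚ} (hr : r ≠ 0) {p : ℝ} (hp : 2 ≤ p) :
    |(r : ℝ)| ^ (-p) ≤ (r.den : ℝ) ^ p * ((r.num : ℝ) ^ 2)⁻¹ := by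
  have hq : (0 : ℝ) < r.den := by exact_mod_cast r.den_pos
  have ha : 1 ≤ |(r.num : ℝ)| := by
    rw [← Int.cast_abs]; exact_mod_cast Int.one_le_abs (Rat.num_ne_zero.2 hr)
  have hr' : (r : ℝ) = r.num / r.den := by exact_mod_cast (Rat.num_div_den r).symm
  rw [hr', abs_div, abs_of_pos hq, Real.div_rpow (abs_nonneg _) hq.le, Real.rpow_neg hq.le, div_inv_eq_mul,
    mul_comm]
  gcongr
  calc |(r.num : ℝ)| ^ (-p) ≤ |(r.num : ℝ)| ^ (-2 : ℝ) := by gcongr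
    _ = _ := by
      rw [Real.rpow_neg (abs_nonneg _), ← sq_abs]; norm_cast

theorem lintegral_mainDensity_off_le {k : ℕ} (hk : 5 ≤ k) {ε : ℝ} (hε : 0 ≤ ε) (hε1 : ε ≤ 1) {σ : ℝ} {Q : ℕ}
    (h : IsArcOrder σ Q) {r : ℚ} (hr : r ≠ 0) :
    ∫⁻ y in (majorArc Q r)ᶜ, ENNReal.ofReal (mainDensity k σ r y) ≤
      ENNReal.ofReal (3 * (2 * π) ^ k * σ ^ (2 - (k : ℝ) - ε)) *
        ENNReal.ofReal ((r.den : ℝ) ^ (-(1 + 2 * ε)) * ((r.num : ℝ) ^ 2)⁻¹) := by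
  have hk' : (5 : ℝ) ≤ k := by exact_mod_cast hk
  have hq1 : (1 : ℝ) ≤ r.den := by exact_mod_cast r.den_pos
  have hσ := h.pos
  have hQ := h.cast_pos
  simp_rw [mainDensity_eq k hσ, ENNReal.ofReal_mul (mainCoeff_nonneg k r)]
  rw [lintegral_const_mul' _ _ ENNReal.ofReal_ne_top, ← ENNReal.ofReal_mul (by positivity)]
  have hfrac : 2 / ((k : ℝ) - 1) ≤ 1 := by rw [div_le_one (by linarith)]; linarith
  have hfrac0 : 0 < 2 / ((k : ℝ) - 1) := div_pos two_pos (by linarith)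
  have hA := mainCoeff_le k hr
  have ha : 0 ≤ ((r.num : ℝ) ^ 2)⁻¹ := by positivity
  by_cases hqQ : r.den ≤ Q
  · have hs : (majorArc Q r)ᶜ = {y : ℝ | π / (r.den * Q) ≤ |y - 2 * π * r|} := by
      ext y; simp [majorArc, hqQ]
    have hc : 0 < π / (r.den * Q) := by positivity
    rw [hs]
    refine (mul_le_mul_right (lintegral_shift_far_le (by linarith) hc σ r) _).trans ?_
    rw [← ENNReal.ofReal_mul (mainCoeff_nonneg k r)]
    refine ENNReal.ofReal_le_ofReal ?_
    have hB := h.rpow_mul_far_le hk' hε hq1 (by exact_mod_cast hqQ)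
    calc _ ≤ (2 * π) ^ k * ((r.den : ℝ) ^ (2 - (k : ℝ)) * ((r.num : ℝ) ^ 2)⁻¹) *
          (3 * (π / (r.den * Q)) ^ (1 - (k : ℝ))) := by gcongr; linarith
      _ = 3 * (2 * π) ^ k * ((r.den : ℝ) ^ (2 - (k : ℝ)) * (π / (r.den * Q)) ^ (1 - (k : ℝ))) *
          ((r.num : ℝ) ^ 2)⁻¹ := by ring
      _ ≤ 3 * (2 * π) ^ k * (σ ^ (2 - (k : ℝ) - ε) * (r.den : ℝ) ^ (-(1 + 2 * ε))) *
          ((r.num : ℝ) ^ 2)⁻¹ := by gcongr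
      _ = _ := by ring
  · have hq2 : (Q : ℝ) + 1 ≤ r.den := by exact_mod_cast not_le.1 hqQ
    refine (mul_le_mul_right ((setLIntegral_le_lintegral _ _).trans
      (lintegral_arcOffset_rpow_le (by linarith) hσ r)) _).trans ?_
    rw [← ENNReal.ofReal_mul (mainCoeff_nonneg k r)]
    refine ENNReal.ofReal_le_ofReal ?_
    have hB := h.rpow_mul_large_le hk' hε1 hq2
    calc _ ≤ (2 * π) ^ k * ((r.den : ℝ) ^ (2 - (k : ℝ)) * ((r.num : ℝ) ^ 2)⁻¹) *
          (3 * σ ^ (1 - (k : ℝ))) := by gcongr; linarith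
      _ = 3 * (2 * π) ^ k * ((r.den : ℝ) ^ (2 - (k : ℝ)) * σ ^ (1 - (k : ℝ))) *
          ((r.num : ℝ) ^ 2)⁻¹ := by ring
      _ ≤ 3 * (2 * π) ^ k * (σ ^ (2 - (k : ℝ) - ε) * (r.den : ℝ) ^ (-(1 + 2 * ε))) *
          ((r.num : ℝ) ^ 2)⁻¹ := by gcongr
      _ = _ := by ring

/-- The part of the approximation error on the major arc of `r` that depends on `r`. -/
noncomputable def arcError (k : ℕ) (σ : ℝ) (r : ℚ) (y : ℝ) : ℝ :=
  (r.den : ℝ) ^ (-((k : ℝ) / 2)) * |(r : ℝ)| ^ (-2 : ℝ) * σ ^ (-((k : ℝ) / 4)) *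
      ‖arcOffset σ r y‖ ^ (-((k : ℝ) / 2)) +
    (r.den : ℝ) ^ (-(k : ℝ)) * |(r : ℝ)| ^ (-3 : ℝ) * ‖arcOffset σ r y‖ ^ (-((k : ℝ) - 1))

theorem lintegral_arcError_le {k : ℕ} (hk : 5 ≤ k) {ε : ℝ} (hε : 0 ≤ ε) (hε1 : ε ≤ 1 / 2) {σ : ℝ} {Q : ℕ}
    (h : IsArcOrder σ Q) {r : ℚ} (hr : r ≠ 0) :
    ∫⁻ y in majorArc Q r, ENNReal.ofReal (arcError k σ r y) ≤
      ENNReal.ofReal (7 * σ ^ (2 - (k : ℝ) - ε)) *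
        ENNReal.ofReal ((r.den : ℝ) ^ (-(1 + 2 * ε)) * ((r.num : ℝ) ^ 2)⁻¹) := by
  have hk' : (5 : ℝ) ≤ k := by exact_mod_cast hk
  have hq1 : (1 : ℝ) ≤ r.den := by exact_mod_cast r.den_pos
  have hq0 : (0 : ℝ) < r.den := by linarith
  have hσ := h.pos
  by_cases hqQ : r.den ≤ Q
  swap
  · have : majorArc Q r = ∅ := by ext y; simp [majorArc, hqQ]
    rw [this]; simp
  refine (setLIntegral_le_lintegral _ _).trans ?_
  have hv := fun y => norm_arcOffset_pos hσ r y
  have hm : ∀ p : ℝ, Measurable fun y => ENNReal.ofReal (‖arcOffset σ r y‖ ^ p) := fun p => by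
    unfold arcOffset; fun_prop
  calc _ = ∫⁻ y, ENNReal.ofReal ((r.den : ℝ) ^ (-((k : ℝ) / 2)) * |(r : ℝ)| ^ (-2 : ℝ) * σ ^ (-((k : ℝ) / 4))) *
        ENNReal.ofReal (‖arcOffset σ r y‖ ^ (-((k : ℝ) / 2))) +
        ENNReal.ofReal ((r.den : ℝ) ^ (-(k : ℝ)) * |(r : ℝ)| ^ (-3 : ℝ)) *
          ENNReal.ofReal (‖arcOffset σ r y‖ ^ (-((k : ℝ) - 1))) := by
        refine lintegral_congr fun y => ?_
        have := hv y
        rw [arcError, ENNReal.ofReal_add (by positivity) (by positivity),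
          ← ENNReal.ofReal_mul (by positivity), ← ENNReal.ofReal_mul (by positivity)]
    _ ≤ ENNReal.ofReal ((r.den : ℝ) ^ (-((k : ℝ) / 2)) * |(r : ℝ)| ^ (-2 : ℝ) * σ ^ (-((k : ℝ) / 4))) *
        ENNReal.ofReal ((2 + 2 / ((k : ℝ) / 2 - 1)) * σ ^ (1 - (k : ℝ) / 2)) +
        ENNReal.ofReal ((r.den : ℝ) ^ (-(k : ℝ)) * |(r : ℝ)| ^ (-3 : ℝ)) *
          ENNReal.ofReal ((2 + 2 / ((k : ℝ) - 1 - 1)) * σ ^ (1 - ((k : ℝ) - 1))) := by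
        rw [lintegral_add_left ((hm _).const_mul _), lintegral_const_mul _ (hm _), lintegral_const_mul _ (hm _)]
        gcongr
        · exact lintegral_arcOffset_rpow_le (by linarith) hσ r
        · exact lintegral_arcOffset_rpow_le (by linarith) hσ r
    _ ≤ _ := by
      have f1 : 2 / ((k : ℝ) / 2 - 1) ≤ 2 := by rw [div_le_iff₀ (by linarith)]; linarith
      have f2 : 2 / ((k : ℝ) - 1 - 1) ≤ 1 := by rw [div_le_iff₀ (by linarith)]; linarith
      have g1 : 0 < 2 / ((k : ℝ) / 2 - 1) := div_pos two_pos (by linarith)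
      have g2 : 0 < 2 / ((k : ℝ) - 1 - 1) := div_pos two_pos (by linarith)
      rw [← ENNReal.ofReal_mul (by positivity), ← ENNReal.ofReal_mul (by positivity),
        ← ENNReal.ofReal_mul (by positivity), ← ENNReal.ofReal_add (by positivity) (by positivity)]
      refine ENNReal.ofReal_le_ofReal ?_
      have a1 := abs_rat_rpow_neg_le hr (p := 2) le_rfl
      have a2 := abs_rat_rpow_neg_le hr (p := 3) (by norm_num)
      have c1 := h.rpow_mul_cross_le hk' hε hq1 (by exact_mod_cast hqQ)
      set N := ((r.num : ℝ) ^ 2)⁻¹ with hN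
      have hN0 : 0 ≤ N := by positivity
      have b1 : (r.den : ℝ) ^ (-((k : ℝ) / 2)) * |(r : ℝ)| ^ (-2 : ℝ) ≤ (r.den : ℝ) ^ (2 - (k : ℝ) / 2) * N := by
        calc _ ≤ (r.den : ℝ) ^ (-((k : ℝ) / 2)) * ((r.den : ℝ) ^ (2 : ℝ) * N) := by gcongr
          _ = _ := by rw [← mul_assoc, ← Real.rpow_add hq0]; congr 2; ring
      have b2 : (r.den : ℝ) ^ (-(k : ℝ)) * |(r : ℝ)| ^ (-3 : ℝ) ≤ (r.den : ℝ) ^ (-(1 + 2 * ε)) * N := by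
        calc _ ≤ (r.den : ℝ) ^ (-(k : ℝ)) * ((r.den : ℝ) ^ (3 : ℝ) * N) := by gcongr
          _ = (r.den : ℝ) ^ (3 - (k : ℝ)) * N := by rw [← mul_assoc, ← Real.rpow_add hq0]; congr 2; ring
          _ ≤ _ := by gcongr; linarith
      have b3 : σ ^ (1 - ((k : ℝ) - 1)) ≤ σ ^ (2 - (k : ℝ) - ε) := h.rpow_anti (by linarith)
      calc _ ≤ (r.den : ℝ) ^ (2 - (k : ℝ) / 2) * N * σ ^ (-((k : ℝ) / 4)) * ((2 + 2) * σ ^ (1 - (k : ℝ) / 2)) +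
            (r.den : ℝ) ^ (-(1 + 2 * ε)) * N * ((2 + 1) * σ ^ (2 - (k : ℝ) - ε)) := by gcongr
        _ = 4 * ((r.den : ℝ) ^ (2 - (k : ℝ) / 2) * (σ ^ (-((k : ℝ) / 4)) * σ ^ (1 - (k : ℝ) / 2))) * N +
            3 * σ ^ (2 - (k : ℝ) - ε) * (r.den : ℝ) ^ (-(1 + 2 * ε)) * N := by ring
        _ ≤ 4 * (σ ^ (2 - (k : ℝ) - ε) * (r.den : ℝ) ^ (-(1 + 2 * ε))) * N +
            3 * σ ^ (2 - (k : ℝ) - ε) * (r.den : ℝ) ^ (-(1 + 2 * ε)) * N := by gcongr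
        _ = _ := by ring

theorem lintegral_arcOffset_eq (σ : ℝ) (r : ℚ) (p : ℝ) :
    ∫⁻ y, ENNReal.ofReal (‖arcOffset σ r y‖ ^ p) = ∫⁻ y, ENNReal.ofReal (‖arcOffset σ 0 y‖ ^ p) := by
  rw [← lintegral_sub_right_eq_self (fun y => ENNReal.ofReal (‖arcOffset σ 0 y‖ ^ p)) (2 * π * (r : ℝ))]
  simp [arcOffset]

theorem measurable_arcOffset_rpow (σ : ℝ) (r : ℚ) (p : ℝ) :
    Measurable fun y => ‖arcOffset σ r y‖ ^ p := by
  unfold arcOffset; fun_prop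

theorem measurable_mainDensity (k : ℕ) {σ : ℝ} (hσ : 0 < σ) (r : ℚ) :
    Measurable (mainDensity k σ r) := by
  have : mainDensity k σ r = fun y => mainCoeff k r * ‖arcOffset σ r y‖ ^ (-(k : ℝ)) :=
    funext fun y => mainDensity_eq k hσ r y
  rw [this]
  exact (measurable_arcOffset_rpow σ r _).const_mul _

theorem mainDensity_nonneg (k : ℕ) (σ : ℝ) (r : ℚ) (y : ℝ) : 0 ≤ mainDensity k σ r y := by
  unfold mainDensity
  split_ifs <;> positivity

theorem integrable_arcOffset_rpow {p σ : ℝ} (hp : 1 < p) (hσ : 0 < σ) (r : ℚ) :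
    Integrable fun y => ‖arcOffset σ r y‖ ^ (-p) := by
  refine ⟨(measurable_arcOffset_rpow σ r _).aestronglyMeasurable, ?_⟩
  rw [hasFiniteIntegral_iff_ofReal (ae_of_all _ fun y => Real.rpow_nonneg (norm_nonneg _) _)]
  exact (lintegral_arcOffset_rpow_le hp hσ r).trans_lt ENNReal.ofReal_lt_top

theorem lintegral_mainDensity (k : ℕ) (hk : 2 ≤ k) {σ : ℝ} (hσ : 0 < σ) (r : ℚ) :
    ∫⁻ y, ENNReal.ofReal (mainDensity k σ r y) =
      ENNReal.ofReal (mainCoeff k r) * ENNReal.ofReal (∫ y, ‖arcOffset σ 0 y‖ ^ (-(k : ℝ))) := by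
  have hk' : (2 : ℝ) ≤ k := by exact_mod_cast hk
  simp_rw [mainDensity_eq k hσ, ENNReal.ofReal_mul (mainCoeff_nonneg k r)]
  rw [lintegral_const_mul' _ _ ENNReal.ofReal_ne_top, lintegral_arcOffset_eq,
    ofReal_integral_eq_lintegral_ofReal (integrable_arcOffset_rpow (by linarith) hσ 0)
      (ae_of_all _ fun y => Real.rpow_nonneg (norm_nonneg _) _)]

theorem summable_mainCoeff {k : ℕ} (hk : 5 ≤ k) : Summable (mainCoeff k) := by
  have hk' : (5 : ℝ) ≤ k := by exact_mod_cast hk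
  obtain ⟨C, hC, h⟩ := exists_tsum_rat_rpow_le (x := (k : ℝ) - 2) (by linarith)
  have h1 : ∑' r : ℚ, ENNReal.ofReal (mainCoeff k r) ≠ ⊤ := by
    refine ne_top_of_le_ne_top (b := ENNReal.ofReal (mainCoeff k 0) + ENNReal.ofReal ((2 * π) ^ k) * ENNReal.ofReal C)
      (by finiteness) ?_
    calc _ ≤ ∑' r : ℚ, ((if r = 0 then ENNReal.ofReal (mainCoeff k 0) else 0) +
          ENNReal.ofReal ((2 * π) ^ k) *
          ENNReal.ofReal ((r.den : ℝ) ^ (-((k : ℝ) - 2)) * ((r.num : ℝ) ^ 2)⁻¹)) := by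
          refine ENNReal.tsum_le_tsum fun r => ?_
          by_cases hr : r = 0
          · subst hr; simp
          · rw [if_neg hr, zero_add, ← ENNReal.ofReal_mul (by positivity), neg_sub]
            exact ENNReal.ofReal_le_ofReal (mainCoeff_le k hr)
      _ ≤ _ := by
          rw [ENNReal.tsum_add, tsum_ite_eq, ENNReal.tsum_mul_left]
          gcongr
  have := ENNReal.summable_toReal h1
  simpa [ENNReal.toReal_ofReal (mainCoeff_nonneg k _)] using this

theorem ofReal_abs_sub_toReal_le {ι : Type*} [DecidableEq ι] (f : ι → ℝ) (hf : ∀ i, 0 ≤ f i) (u : ℝ) (j : ι)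
    (h : ∑' i, ENNReal.ofReal (f i) ≠ ⊤) :
    ENNReal.ofReal |u - (∑' i, ENNReal.ofReal (f i)).toReal| ≤
      ENNReal.ofReal |u - f j| + ∑' i, if i = j then 0 else ENNReal.ofReal (f i) := by
  set R := ∑' i, if i = j then 0 else ENNReal.ofReal (f i) with hR
  have e : ∑' i, ENNReal.ofReal (f i) = ENNReal.ofReal (f j) + R := by
    rw [ENNReal.tsum_eq_add_tsum_ite j, hR]
    congr!
  have hRt : R ≠ ⊤ := by
    rw [e] at h
    exact (ENNReal.add_ne_top.1 h).2
  rw [e, ENNReal.toReal_add ENNReal.ofReal_ne_top hRt, ENNReal.toReal_ofReal (hf j)]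
  calc ENNReal.ofReal |u - (f j + R.toReal)| ≤ ENNReal.ofReal (|u - f j| + R.toReal) := by
        refine ENNReal.ofReal_le_ofReal ?_
        have : u - (f j + R.toReal) = (u - f j) - R.toReal := by ring
        rw [this]
        refine (abs_sub _ _).trans ?_
        rw [abs_of_nonneg (ENNReal.toReal_nonneg : 0 ≤ R.toReal)]
    _ = _ := by
        rw [ENNReal.ofReal_add (abs_nonneg _) ENNReal.toReal_nonneg, ENNReal.ofReal_toReal hRt]

/-- The sum of all main densities. -/
noncomputable def totalDensity (k : ℕ) (σ y : ℝ) : ENNReal :=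
  ∑' r : ℚ, ENNReal.ofReal (mainDensity k σ r y)

theorem lintegral_totalDensity {k : ℕ} (hk : 5 ≤ k) {σ : ℝ} (hσ : 0 < σ) :
    ∫⁻ y, totalDensity k σ y =
      ENNReal.ofReal ((∑' r, mainCoeff k r) * ∫ y, ‖arcOffset σ 0 y‖ ^ (-(k : ℝ))) := by
  unfold totalDensity
  rw [lintegral_tsum fun r => ((measurable_mainDensity k hσ r).ennreal_ofReal).aemeasurable]
  simp_rw [lintegral_mainDensity k (by lia) hσ]
  rw [ENNReal.tsum_mul_right, ← ENNReal.ofReal_tsum_of_nonneg (mainCoeff_nonneg k) (summable_mainCoeff hk),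
    ENNReal.ofReal_mul (tsum_nonneg (mainCoeff_nonneg k))]

theorem measurable_totalDensity (k : ℕ) {σ : ℝ} (hσ : 0 < σ) : Measurable (totalDensity k σ) :=
  Measurable.tsum fun r => (measurable_mainDensity k hσ r).ennreal_ofReal

theorem measurableSet_majorArc (Q : ℕ) (r : ℚ) : MeasurableSet (majorArc Q r) := by
  have : majorArc Q r = {_y : ℝ | r.den ≤ Q} ∩ {y : ℝ | |y - 2 * π * r| < π / (r.den * Q)} := rfl
  rw [this]
  exact (MeasurableSet.const _).inter (measurableSet_lt (by fun_prop) measurable_const)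

/-- Pointwise comparison of the squared Laplace transform with the sum of its main densities. -/
theorem exists_laplace_sub_totalDensity_le {k : ℕ} (hk : 2 ≤ k) :
    ∃ C : ℝ, 0 < C ∧ ∀ (σ y : ℝ) (Q : ℕ), IsArcOrder σ Q → totalDensity k σ y ≠ ⊤ →
      ENNReal.ofReal |‖laplaceCentred k (arcOffset σ 0 y)‖ ^ 2 - (totalDensity k σ y).toReal| ≤
        ∑' r : ℚ, (majorArc Q r)ᶜ.indicator (fun y => ENNReal.ofReal (mainDensity k σ r y)) y +
        (ENNReal.ofReal C * ∑' r : ℚ, (if r = 0 then 0 else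
          (majorArc Q r).indicator (fun y => ENNReal.ofReal (arcError k σ r y)) y) +
        ({y : ℝ | π / Q ≤ |y|}.indicator
          (fun y => ENNReal.ofReal (C * σ ^ (-((k : ℝ) / 2))) * ENNReal.ofReal (|y| ^ (-2 : ℝ))) y +
        (majorArc Q 0).indicator (fun _ => ENNReal.ofReal (C * σ ^ (-((k : ℝ) / 2 + 1)))) y)) := by
  obtain ⟨C₁, hC₁, h₁⟩ := exists_norm_sq_laplace_off_arcs_le hk
  obtain ⟨C₂, hC₂, h₂⟩ := exists_laplace_near_zero (k := k)
  obtain ⟨C₃, hC₃, h₃⟩ := exists_laplace_near_rat hk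
  refine ⟨C₁ + C₂ + C₃, by positivity, fun σ y Q h ht => ?_⟩
  have hσ := h.pos
  set C := C₁ + C₂ + C₃ with hC
  have hrest : ∀ r₀, y ∈ majorArc Q r₀ →
      (∑' r : ℚ, if r = r₀ then 0 else ENNReal.ofReal (mainDensity k σ r y)) ≤
      ∑' r : ℚ, (majorArc Q r)ᶜ.indicator (fun y => ENNReal.ofReal (mainDensity k σ r y)) y := by
    intro r₀ h0
    refine ENNReal.tsum_le_tsum fun r => ?_
    split_ifs with hr
    · exact zero_le
    · rw [Set.indicator_of_mem (s := (majorArc Q r)ᶜ) fun hc => hr (majorArc_disjoint hc h0)]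
  by_cases hex : ∃ r, y ∈ majorArc Q r
  · obtain ⟨r₀, h0⟩ := hex
    have hmain := ofReal_abs_sub_toReal_le (fun r => mainDensity k σ r y) (fun r => mainDensity_nonneg k σ r y)
      (‖laplaceCentred k (arcOffset σ 0 y)‖ ^ 2) r₀ ht
    refine hmain.trans ?_
    rw [add_comm]
    refine add_le_add (hrest r₀ h0) ?_
    by_cases hr : r₀ = 0
    · subst hr
      refine le_trans ?_ (le_add_self.trans le_add_self)
      rw [Set.indicator_of_mem h0]
      refine ENNReal.ofReal_le_ofReal ((h₂ σ y Q h h0).trans ?_)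
      gcongr
      linarith
    · have hyQ := le_abs_of_notMem_majorArc_zero h fun hc => hr (majorArc_disjoint h0 hc)
      rw [← add_assoc]
      refine le_trans ?_ le_self_add
      rw [Set.indicator_of_mem (s := {y : ℝ | π / Q ≤ |y|}) hyQ, ← ENNReal.ofReal_mul (by positivity)]
      have hA : 0 ≤ arcError k σ r₀ y := by unfold arcError; positivity
      calc _ ≤ ENNReal.ofReal (C * arcError k σ r₀ y + C * σ ^ (-((k : ℝ) / 2)) * |y| ^ (-2 : ℝ)) := by
            refine ENNReal.ofReal_le_ofReal ((h₃ σ y Q r₀ h hr h0).trans ?_)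
            change C₃ * (_ + arcError k σ r₀ y) ≤ _
            rw [add_comm, mul_assoc C, ← mul_add]
            gcongr
            linarith
        _ = ENNReal.ofReal C * ENNReal.ofReal (arcError k σ r₀ y) + _ := by
            rw [ENNReal.ofReal_add (by positivity) (by positivity), ENNReal.ofReal_mul (by positivity)]
        _ ≤ _ := by
            gcongr
            refine le_trans ?_ (ENNReal.le_tsum r₀)
            rw [if_neg hr, Set.indicator_of_mem h0]
  · have hno : ∀ r, y ∉ majorArc Q r := fun r hr => hex ⟨r, hr⟩
    have hyQ := le_abs_of_notMem_majorArc_zero h (hno 0)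
    have e : ∑' r : ℚ, (majorArc Q r)ᶜ.indicator (fun y => ENNReal.ofReal (mainDensity k σ r y)) y =
        totalDensity k σ y := by
      refine tsum_congr fun r => ?_
      rw [Set.indicator_of_mem (s := (majorArc Q r)ᶜ) (hno r)]
    rw [e, Set.indicator_of_mem (s := {y : ℝ | π / Q ≤ |y|}) hyQ, ← ENNReal.ofReal_mul (by positivity)]
    calc _ ≤ ENNReal.ofReal ((totalDensity k σ y).toReal + ‖laplaceCentred k (arcOffset σ 0 y)‖ ^ 2) := by
          refine ENNReal.ofReal_le_ofReal ?_
          rw [abs_sub_comm]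
          refine (abs_sub _ _).trans ?_
          rw [abs_of_nonneg ENNReal.toReal_nonneg, abs_of_nonneg (by positivity)]
      _ = totalDensity k σ y + ENNReal.ofReal (‖laplaceCentred k (arcOffset σ 0 y)‖ ^ 2) := by
          rw [ENNReal.ofReal_add ENNReal.toReal_nonneg (by positivity), ENNReal.ofReal_toReal ht]
      _ ≤ _ := by
          gcongr
          refine le_trans ?_ (le_self_add.trans le_add_self)
          refine ENNReal.ofReal_le_ofReal ((h₁ σ y Q h hno).trans ?_)
          rw [← mul_assoc]
          gcongr
          linarith

theorem exists_lintegral_laplace_sub_totalDensity_le {k : ℕ} (hk : 5 ≤ k) {ε : ℝ} (hε : 0 < ε) (hε1 : ε ≤ 1 / 2) :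
    ∃ C : ℝ, 0 < C ∧ ∀ σ : ℝ, 0 < σ → σ ≤ 1 →
      ∫⁻ y, ENNReal.ofReal |‖laplaceCentred k (arcOffset σ 0 y)‖ ^ 2 - (totalDensity k σ y).toReal| ≤
        ENNReal.ofReal (C * σ ^ (2 - (k : ℝ) - ε)) := by
  have hk' : (5 : ℝ) ≤ k := by exact_mod_cast hk
  obtain ⟨C, hC, hpt⟩ := exists_laplace_sub_totalDensity_le (k := k) (by lia)
  obtain ⟨S, hS, hsum⟩ := exists_tsum_rat_rpow_le (x := 1 + 2 * ε) (by linarith)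
  set B : ℝ := 3 * (2 * π) ^ k with hB
  have hB0 : 0 < B := by positivity
  have hM := mainCoeff_nonneg k 0
  refine ⟨mainCoeff k 0 + B * S + (C * (7 * S) + (C * 2 + C * (4 * π))), by positivity, fun σ hσ hσ1 => ?_⟩
  obtain ⟨Q, h⟩ := exists_isArcOrder hσ hσ1
  have hQ := h.cast_pos
  have hQ0 : (0 : ℝ) < Q := by linarith
  set z := σ ^ (2 - (k : ℝ) - ε) with hz
  have hz0 : 0 < z := by positivity
  have hfin : ∀ᵐ y, totalDensity k σ y ≠ ⊤ := by
    have : ∫⁻ y, totalDensity k σ y ≠ ⊤ := by rw [lintegral_totalDensity hk hσ]; finiteness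
    filter_upwards [ae_lt_top (measurable_totalDensity k hσ) this] with y hy using hy.ne
  have mD := fun r => (measurable_mainDensity k hσ r).ennreal_ofReal
  have mA : ∀ r : ℚ, Measurable fun y => ENNReal.ofReal (arcError k σ r y) := fun r => by
    unfold arcError arcOffset; fun_prop
  have mU : MeasurableSet {y : ℝ | π / Q ≤ |y|} := measurableSet_le measurable_const (by fun_prop)
  refine (lintegral_mono_ae (hfin.mono fun y hy => hpt σ y Q h hy)).trans ?_
  have m1 : ∀ r : ℚ, Measurable ((majorArc Q r)ᶜ.indicator (fun y => ENNReal.ofReal (mainDensity k σ r y))) :=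
    fun r => (mD r).indicator (measurableSet_majorArc Q r).compl
  have m2 : ∀ r : ℚ, Measurable (fun y => if r = 0 then 0 else
      (majorArc Q r).indicator (fun y => ENNReal.ofReal (arcError k σ r y)) y) := fun r => by
    split_ifs
    · exact measurable_const
    · exact (mA r).indicator (measurableSet_majorArc Q r)
  rw [lintegral_add_left (Measurable.tsum m1),
    lintegral_add_left ((Measurable.tsum m2).const_mul _),
    lintegral_add_right _ (measurable_const.indicator (measurableSet_majorArc Q 0)),
    lintegral_const_mul _ (Measurable.tsum m2), lintegral_tsum fun r => (m1 r).aemeasurable,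
    lintegral_tsum fun r => (m2 r).aemeasurable, lintegral_indicator mU,
    lintegral_indicator (measurableSet_majorArc Q 0), lintegral_const_mul' _ _ ENNReal.ofReal_ne_top,
    setLIntegral_const]
  have hQc : (π / Q : ℝ) ^ (-1 : ℝ) ≤ Q := by
    rw [Real.rpow_neg_one, inv_div, div_le_iff₀ Real.pi_pos]
    nlinarith [Real.pi_gt_three]
  have hQk : σ ^ (-((k : ℝ) / 2)) * Q ≤ z := by
    have := h.rpow_cast_le (p := 1) (by norm_num)
    rw [Real.rpow_one] at this
    calc _ ≤ σ ^ (-((k : ℝ) / 2)) * σ ^ (-(1 / 2) : ℝ) := by gcongr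
      _ = σ ^ (-((k : ℝ) / 2) + -(1 / 2)) := by rw [Real.rpow_add hσ]
      _ ≤ _ := h.rpow_anti (by linarith)
  have b1 : ∑' r : ℚ, ∫⁻ y, (majorArc Q r)ᶜ.indicator (fun y => ENNReal.ofReal (mainDensity k σ r y)) y ≤
      ENNReal.ofReal ((mainCoeff k 0 + B * S) * z) := by
    calc _ ≤ ∑' r : ℚ, ((if r = 0 then ENNReal.ofReal (mainCoeff k 0 * z) else 0) + ENNReal.ofReal (B * z) *
          ENNReal.ofReal ((r.den : ℝ) ^ (-(1 + 2 * ε)) * ((r.num : ℝ) ^ 2)⁻¹)) := by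
          refine ENNReal.tsum_le_tsum fun r => ?_
          rw [lintegral_indicator (measurableSet_majorArc Q r).compl]
          by_cases hr : r = 0
          · subst hr
            rw [if_pos rfl]
            refine le_trans ?_ le_self_add
            have hs : (majorArc Q 0)ᶜ = {y : ℝ | π / Q ≤ |y - 2 * π * ((0 : ℚ) : ℝ)|} := by
              ext y; simp [majorArc, h.one_le]
            rw [hs]
            simp_rw [mainDensity_eq k hσ, ENNReal.ofReal_mul (mainCoeff_nonneg k 0)]
            rw [lintegral_const_mul' _ _ ENNReal.ofReal_ne_top]
            gcongr
            refine (lintegral_shift_far_le (by linarith) (by positivity) σ 0).trans ?_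
            refine ENNReal.ofReal_le_ofReal ?_
            have hfrac : 2 / ((k : ℝ) - 1) ≤ 1 := by rw [div_le_one (by linarith)]; linarith
            refine (mul_le_of_le_one_left (by positivity) hfrac).trans ?_
            have := h.rpow_neg_le (p := (k : ℝ) - 1) (x := π / Q) (by linarith) (by
              rw [inv_eq_one_div]; gcongr; linarith [Real.pi_gt_three])
            rw [neg_sub] at this
            exact this.trans (h.rpow_anti (by linarith))
          · rw [if_neg hr, zero_add]
            exact lintegral_mainDensity_off_le hk hε.le (by linarith) h hr
      _ ≤ ENNReal.ofReal (mainCoeff k 0 * z) + ENNReal.ofReal (B * z) * ENNReal.ofReal S := by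
          rw [ENNReal.tsum_add, tsum_ite_eq, ENNReal.tsum_mul_left]
          gcongr
      _ = _ := by
          rw [← ENNReal.ofReal_mul (by positivity), ← ENNReal.ofReal_add (by positivity) (by positivity)]
          congr 1; ring
  have b2 : ∑' r : ℚ, ∫⁻ y, (if r = 0 then 0 else
      (majorArc Q r).indicator (fun y => ENNReal.ofReal (arcError k σ r y)) y) ≤
      ENNReal.ofReal (7 * S * z) := by
    calc _ ≤ ∑' r : ℚ, ENNReal.ofReal (7 * z) *
          ENNReal.ofReal ((r.den : ℝ) ^ (-(1 + 2 * ε)) * ((r.num : ℝ) ^ 2)⁻¹) := by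
          refine ENNReal.tsum_le_tsum fun r => ?_
          by_cases hr : r = 0
          · simp [hr]
          · simp only [if_neg hr]
            rw [lintegral_indicator (measurableSet_majorArc Q r)]
            exact lintegral_arcError_le hk hε.le hε1 h hr
      _ ≤ ENNReal.ofReal (7 * z) * ENNReal.ofReal S := by
          rw [ENNReal.tsum_mul_left]
          gcongr
      _ = _ := by
          rw [← ENNReal.ofReal_mul (by positivity)]
          congr 1; ring
  have b3 : ∫⁻ y in {y : ℝ | π / Q ≤ |y|}, ENNReal.ofReal (|y| ^ (-2 : ℝ)) ≤ ENNReal.ofReal (2 * Q) := by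
    refine (lintegral_tail_rpow_le (p := 2) (by norm_num) (by positivity)).trans ?_
    refine ENNReal.ofReal_le_ofReal ?_
    norm_num at hQc ⊢
    linarith
  have b4 : volume (majorArc Q 0) ≤ ENNReal.ofReal (2 * π / Q) := by
    have hs : majorArc Q 0 = Metric.ball 0 (π / Q) := by
      ext y; simp [majorArc, h.one_le]
    rw [hs, Real.volume_ball, ← mul_div_assoc]
  have b5 : σ ^ (-((k : ℝ) / 2 + 1)) * (1 / Q) ≤ 2 * z := by
    have := h.inv_cast_le
    have : σ ^ (-((k : ℝ) / 2 + 1)) * (1 / Q) ≤ 2 * σ ^ (-((k : ℝ) / 2) + -(1 / 2)) := by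
      calc _ ≤ σ ^ (-((k : ℝ) / 2 + 1)) * (2 * σ ^ (1 / 2 : ℝ)) := by rw [one_div]; gcongr
        _ = 2 * (σ ^ (-((k : ℝ) / 2 + 1)) * σ ^ (1 / 2 : ℝ)) := by ring
        _ = _ := by rw [← Real.rpow_add hσ]; congr 2; ring
    exact this.trans (by gcongr; exact h.rpow_anti (by linarith))
  calc _ ≤ ENNReal.ofReal ((mainCoeff k 0 + B * S) * z) + (ENNReal.ofReal C * ENNReal.ofReal (7 * S * z) +
        (ENNReal.ofReal (C * σ ^ (-((k : ℝ) / 2))) * ENNReal.ofReal (2 * Q) +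
        ENNReal.ofReal (C * σ ^ (-((k : ℝ) / 2 + 1))) * ENNReal.ofReal (2 * π / Q))) := by
        gcongr
    _ = ENNReal.ofReal ((mainCoeff k 0 + B * S) * z + (C * (7 * S * z) +
        (C * σ ^ (-((k : ℝ) / 2)) * (2 * Q) + C * σ ^ (-((k : ℝ) / 2 + 1)) * (2 * π / Q)))) := by
        rw [← ENNReal.ofReal_mul (by positivity), ← ENNReal.ofReal_mul (by positivity),
          ← ENNReal.ofReal_mul (by positivity), ← ENNReal.ofReal_add (by positivity) (by positivity),
          ← ENNReal.ofReal_add (by positivity) (by positivity), ← ENNReal.ofReal_add (by positivity) (by positivity)]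
    _ ≤ _ := by
        refine ENNReal.ofReal_le_ofReal ?_
        calc _ = (mainCoeff k 0 + B * S) * z + (C * (7 * S) * z +
              (C * 2 * (σ ^ (-((k : ℝ) / 2)) * Q) + C * (2 * π) * (σ ^ (-((k : ℝ) / 2 + 1)) * (1 / Q)))) := by ring
          _ ≤ (mainCoeff k 0 + B * S) * z + (C * (7 * S) * z + (C * 2 * z + C * (2 * π) * (2 * z))) := by gcongr
          _ = _ := by ring

theorem integral_rpow_sub_two_mul_exp {k : ℕ} (hk : 2 ≤ k) {σ : ℝ} (hσ : 0 < σ) :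
    ∫ t in Set.Ioi (0 : ℝ), t ^ ((k : ℝ) - 2) * Real.exp (-(2 * σ) * t) =
      Real.Gamma ((k : ℝ) - 1) * (2 * σ) ^ (1 - (k : ℝ)) := by
  have hk' : (2 : ℝ) ≤ k := by exact_mod_cast hk
  have := Real.integral_rpow_mul_exp_neg_mul_Ioi (a := (k : ℝ) - 1) (r := 2 * σ) (by linarith) (by positivity)
  rw [one_div, ← Real.rpow_neg_eq_inv_rpow, neg_sub, mul_comm (_ ^ _)] at this
  rw [← this]
  congr 1; ext t
  congr 2
  · ring
  · ring

theorem integral_arcOffset_rpow {k : ℕ} (hk : 2 ≤ k) {σ : ℝ} (hσ : 0 < σ) :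
    ∫ y, ‖arcOffset σ 0 y‖ ^ (-(k : ℝ)) =
      2 * π * (Real.Gamma ((k : ℝ) - 1) * (2 * σ) ^ (1 - (k : ℝ))) / Real.Gamma ((k : ℝ) / 2) ^ 2 := by
  have hk' : (2 : ℝ) ≤ k := by exact_mod_cast hk
  have hG : 0 < Real.Gamma ((k : ℝ) / 2) := Real.Gamma_pos_of_pos (by linarith)
  have hsq : ∀ t ∈ Set.Ioi (0 : ℝ), (t ^ ((k : ℝ) / 2 - 1)) ^ 2 * Real.exp (-(2 * σ) * t) =
      t ^ ((k : ℝ) - 2) * Real.exp (-(2 * σ) * t) := fun t ht => by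
    have ht : (0 : ℝ) < t := ht
    rw [← Real.rpow_mul_natCast ht.le]; congr 2; push_cast; ring
  have h := (integral_norm_sq_laplace (R := fun t => t ^ ((k : ℝ) / 2 - 1)) (σ := σ)
    (integrableOn_rpow_mul_exp_neg_mul (by linarith) hσ)
    ((integrableOn_rpow_mul_exp_neg_mul (a := (k : ℝ) - 2) (σ := 2 * σ) (by linarith) (by linarith)).congr_fun
      (fun t ht => (hsq t ht).symm) measurableSet_Ioi)).2
  rw [setIntegral_congr_fun measurableSet_Ioi hsq, integral_rpow_sub_two_mul_exp hk hσ] at h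
  rw [eq_div_iff (by positivity), ← h, ← integral_mul_const]
  congr 1; ext y
  have e : (σ : ℂ) + y * Complex.I = arcOffset σ 0 y := by simp [arcOffset]
  have hw := norm_arcOffset_pos hσ 0 y
  simp only [e]
  rw [integral_rpow_mul_cexp_neg_mul_Ioi (by linarith) (by rwa [arcOffset_re]), norm_mul, mul_pow,
    Complex.norm_real, Real.norm_of_nonneg hG.le, Complex.norm_cpow_real, ← Real.rpow_mul_natCast (norm_nonneg _),
    norm_div, norm_one, one_div, ← Real.rpow_neg_eq_inv_rpow]
  congr 2; push_cast; ring

/-- Mean square of the centred discrepancy in terms of the singularities of the theta series. -/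
theorem exists_integral_centredPk_sq_sub_le {k : ℕ} (hk : 5 ≤ k) {ε : ℝ} (hε : 0 < ε) (hε1 : ε ≤ 1 / 2) :
    ∃ C : ℝ, 0 < C ∧ ∀ σ : ℝ, 0 < σ → σ ≤ 1 →
      |(∫ t in Set.Ioi (0 : ℝ), centredPk k t ^ 2 * Real.exp (-(2 * σ) * t)) -
        (∑' r, mainCoeff k r) / Real.Gamma ((k : ℝ) / 2) ^ 2 *
          (Real.Gamma ((k : ℝ) - 1) * (2 * σ) ^ (1 - (k : ℝ)))| ≤ C * σ ^ (2 - (k : ℝ) - ε) := by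
  obtain ⟨C, hC, h⟩ := exists_lintegral_laplace_sub_totalDensity_le hk hε hε1
  refine ⟨C, hC, fun σ hσ hσ1 => ?_⟩
  have hb := h σ hσ hσ1
  have hL := integral_norm_sq_laplace (R := centredPk k) (σ := σ) (integrableOn_centredPk (by lia) hσ)
    (integrableOn_centredPk_sq (by lia) (by linarith))
  have e : ∀ y : ℝ, ∫ t in Set.Ioi (0 : ℝ), (centredPk k t : ℂ) * Complex.exp (-((σ : ℂ) + y * Complex.I) * t) =
      laplaceCentred k (arcOffset σ 0 y) := fun y => by
    have e : (σ : ℂ) + y * Complex.I = arcOffset σ 0 y := by simp [arcOffset]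
    rw [e, integral_centredPk_mul_cexp (by lia) (by rwa [arcOffset_re])]
    rfl
  simp only [e] at hL
  have hTtop : ∫⁻ y, totalDensity k σ y ≠ ⊤ := by rw [lintegral_totalDensity hk hσ]; finiteness
  have hTm := measurable_totalDensity k hσ
  have hTi : Integrable fun y => (totalDensity k σ y).toReal :=
    integrable_toReal_of_lintegral_ne_top hTm.aemeasurable hTtop
  have hTv : ∫ y, (totalDensity k σ y).toReal = (∑' r, mainCoeff k r) *
      (2 * π * (Real.Gamma ((k : ℝ) - 1) * (2 * σ) ^ (1 - (k : ℝ))) / Real.Gamma ((k : ℝ) / 2) ^ 2) := by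
    rw [integral_toReal hTm.aemeasurable (ae_lt_top hTm hTtop), lintegral_totalDensity hk hσ,
      ENNReal.toReal_ofReal, integral_arcOffset_rpow (by lia) hσ]
    exact mul_nonneg (tsum_nonneg (mainCoeff_nonneg k)) (integral_nonneg fun y => by positivity)
  have hd : |∫ y, (‖laplaceCentred k (arcOffset σ 0 y)‖ ^ 2 - (totalDensity k σ y).toReal)| ≤
      C * σ ^ (2 - (k : ℝ) - ε) := by
    rw [← Real.norm_eq_abs]
    refine (norm_integral_le_lintegral_norm _).trans ?_
    simp only [Real.norm_eq_abs]
    exact ENNReal.toReal_le_of_le_ofReal (by positivity) hb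
  rw [integral_sub hL.1 hTi, hL.2, hTv] at hd
  set I := ∫ t in Set.Ioi (0 : ℝ), centredPk k t ^ 2 * Real.exp (-(2 * σ) * t)
  have e2 : 2 * π * I - (∑' r, mainCoeff k r) *
      (2 * π * (Real.Gamma ((k : ℝ) - 1) * (2 * σ) ^ (1 - (k : ℝ))) / Real.Gamma ((k : ℝ) / 2) ^ 2) =
      (2 * π) * (I - (∑' r, mainCoeff k r) / Real.Gamma ((k : ℝ) / 2) ^ 2 *
          (Real.Gamma ((k : ℝ) - 1) * (2 * σ) ^ (1 - (k : ℝ)))) := by ring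
  rw [e2, abs_mul, abs_of_pos (by positivity)] at hd
  refine le_trans ?_ hd
  refine le_mul_of_one_le_left (abs_nonneg _) ?_
  nlinarith [Real.pi_gt_three]

theorem quadGauss_normSq_eq (q : ℕ) [NeZero q] (c : ℤ) (hc : IsUnit (c : ZMod q)) :
    ‖quadGauss q c 0‖ ^ 2 = if Odd q then (q : ℝ) else if 4 ∣ q then 2 * q else 0 := by
  by_cases hq : Odd q
  · rw [if_pos hq, quadGauss_normSq_odd q _ hc hq]
  · rw [if_neg hq]
    obtain ⟨m, hm⟩ := Nat.not_odd_iff_even.1 hq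
    rw [← two_mul] at hm
    subst hm
    rw [quadGauss_normSq_even m c hc]
    have : 4 ∣ 2 * m ↔ Even m := by rw [even_iff_two_dvd]; lia
    simp only [this]

/-- The weight on pairs (numerator, denominator) that reproduces `mainCoeff` on coprime pairs. -/
noncomputable def pairWeight (k : ℕ) (p : ℕ × ℕ) : ℝ :=
  (if Odd p.2 then 1 else if 4 ∣ p.2 ∧ Odd p.1 then 2 ^ k else 0) *
    (((p.2 : ℝ) ^ (k - 2))⁻¹ * ((p.1 : ℝ) ^ 2)⁻¹)

theorem mainCoeff_zero (k : ℕ) : mainCoeff k 0 = π ^ k / 4 := by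
  have : NeZero (0 : ℚ).den := ⟨Rat.den_nz 0⟩
  have h := quadGauss_normSq_eq (0 : ℚ).den (-(0 : ℚ).num) (isUnit_neg_intCast (Rat.isCoprime_num_den 0))
  rw [mainCoeff, h]
  simp
  ring

theorem mainCoeff_eq {k : ℕ} (hk : 2 ≤ k) {r : ℚ} (hr : r ≠ 0) :
    mainCoeff k r = π ^ k / (4 * π ^ 2) * pairWeight k (r.num.natAbs, r.den) := by
  obtain ⟨m, rfl⟩ : ∃ m, k = m + 2 := ⟨k - 2, by lia⟩
  have : NeZero r.den := ⟨r.den_nz⟩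
  have hq : (0 : ℝ) < r.den := by exact_mod_cast r.den_pos
  have h := quadGauss_normSq_eq r.den (-r.num) (isUnit_neg_intCast (Rat.isCoprime_num_den r))
  have ha : (r.num : ℝ) ≠ 0 := by exact_mod_cast Rat.num_ne_zero.2 hr
  have hr' : (r : ℝ) = r.num / r.den := by exact_mod_cast (Rat.num_div_den r).symm
  have ha2 : ((r.num.natAbs : ℕ) : ℝ) ^ 2 = (r.num : ℝ) ^ 2 := by
    rw [Nat.cast_natAbs, Int.cast_abs, sq_abs]
  have hodd : ¬ Odd r.den → Odd r.num.natAbs := fun h => by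
    have hc := r.reduced
    by_contra hn
    have h2 := Nat.dvd_gcd (even_iff_two_dvd.1 (Nat.not_odd_iff_even.1 hn))
      (even_iff_two_dvd.1 (Nat.not_odd_iff_even.1 h))
    rw [hc.gcd_eq_one] at h2
    norm_num at h2
  rw [mainCoeff, h, if_neg hr, pairWeight, hr']
  simp only [ha2, Nat.add_sub_cancel]
  by_cases h1 : Odd r.den
  · simp only [h1, if_true]
    field_simp
    ring
  · simp only [h1, if_false, hodd h1, and_true]
    split_ifs
    · field_simp
      ring
    · simp

theorem pairWeight_mul {k : ℕ} (hk : 2 ≤ k) (d a q : ℕ) :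
    pairWeight k (d * a, d * q) = (if Odd d then ((d : ℝ) ^ k)⁻¹ else 0) * pairWeight k (a, q) := by
  obtain ⟨m, rfl⟩ : ∃ m, k = m + 2 := ⟨k - 2, by lia⟩
  by_cases h : Odd d
  · simp only [h, if_true, pairWeight, Nat.odd_mul, true_and, Nat.add_sub_cancel]
    have h4 : 4 ∣ d * q ↔ 4 ∣ q := by
      refine ⟨fun hh => ?_, fun hh => hh.mul_left d⟩
      refine Nat.Coprime.dvd_of_dvd_mul_left ?_ hh
      exact (Nat.coprime_two_left.2 h).pow_left 2
    simp only [h4]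
    push_cast
    rw [mul_pow, mul_pow, mul_inv, mul_inv, pow_add (d : ℝ), mul_inv]
    ring
  · simp [pairWeight, Nat.odd_mul, h]

theorem summable_inv_pow {s : ℕ} (hs : 1 < s) : Summable fun n : ℕ => ((n : ℝ) ^ s)⁻¹ :=
  Real.summable_nat_pow_inv.2 hs

theorem rzeta_natCast {s : ℕ} (hs : 1 < s) : rzeta s = ∑' n : ℕ, ((n : ℝ) ^ s)⁻¹ := by
  rw [rzeta, Complex.ofReal_natCast, zeta_nat_eq_tsum_of_gt_one hs]
  have : ∀ n : ℕ, 1 / (n : ℂ) ^ s = ((((n : ℝ) ^ s)⁻¹ : ℝ) : ℂ) := fun n => by push_cast; rw [one_div]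
  simp_rw [this]
  rw [← Complex.ofReal_tsum, Complex.ofReal_re]

theorem summable_ite_inv_pow {s : ℕ} (hs : 1 < s) (P : ℕ → Prop) [DecidablePred P] :
    Summable fun n : ℕ => if P n then ((n : ℝ) ^ s)⁻¹ else 0 := by
  refine (summable_inv_pow hs).of_nonneg_of_le (fun n => ?_) fun n => ?_
  · split_ifs <;> positivity
  · split_ifs
    · rfl
    · positivity

theorem tsum_ite_dvd_inv_pow {s m : ℕ} (hs : 1 < s) (hm : 0 < m) :
    (∑' n : ℕ, if m ∣ n then ((n : ℝ) ^ s)⁻¹ else 0) = ((m : ℝ) ^ s)⁻¹ * rzeta s := by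
  have inj : Function.Injective fun n : ℕ => m * n := fun a b h => Nat.eq_of_mul_eq_mul_left hm h
  rw [← inj.tsum_eq]
  · rw [rzeta_natCast hs, ← tsum_mul_left]
    refine tsum_congr fun n => ?_
    rw [if_pos (dvd_mul_right m n)]
    push_cast
    rw [mul_pow, mul_inv]
  · intro n hn
    by_contra h
    refine hn (if_neg fun ⟨c, hc⟩ => h ⟨c, hc.symm⟩)

theorem tsum_ite_odd_inv_pow {s : ℕ} (hs : 1 < s) :
    (∑' n : ℕ, if Odd n then ((n : ℝ) ^ s)⁻¹ else 0) = (1 - ((2 : ℝ) ^ s)⁻¹) * rzeta s := by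
  have h2 := tsum_ite_dvd_inv_pow hs two_pos
  rw [sub_mul, one_mul, ← Nat.cast_two (R := ℝ), ← h2, rzeta_natCast hs, ← (summable_inv_pow hs).tsum_sub
    (summable_ite_inv_pow hs _)]
  refine tsum_congr fun n => ?_
  by_cases h : Odd n
  · have : ¬ 2 ∣ n := by rwa [← even_iff_two_dvd, Nat.not_even_iff_odd]
    simp [h, this]
  · have : 2 ∣ n := by rwa [← even_iff_two_dvd, ← Nat.not_odd_iff_even]
    simp [h, this]

theorem rzeta_two : rzeta ((2 : ℕ) : ℝ) = π ^ 2 / 6 := by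
  rw [rzeta]
  have : (((2 : ℕ) : ℝ) : ℂ) = 2 := by norm_num
  rw [this, riemannZeta_two]
  have : (π : ℂ) ^ 2 / 6 = ((π ^ 2 / 6 : ℝ) : ℂ) := by push_cast; rfl
  rw [this, Complex.ofReal_re]

theorem rzeta_pos {s : ℕ} (hs : 1 < s) : 0 < rzeta s := by
  rw [rzeta_natCast hs]
  refine (summable_inv_pow hs).tsum_pos (fun n => by positivity) 1 (by simp)

theorem tsum_mul_snd_fst_add {u v w z : ℕ → ℝ} (hu : Summable u) (hv : Summable v) (hw : Summable w)
    (hz : Summable z) : ∑' p : ℕ × ℕ, (u p.2 * v p.1 + w p.2 * z p.1) =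
      (∑' n, u n) * (∑' n, v n) + (∑' n, w n) * ∑' n, z n := by
  have h1 : Summable fun p : ℕ × ℕ => v p.1 * u p.2 := summable_mul_of_summable_norm hv.norm hu.norm
  have h2 : Summable fun p : ℕ × ℕ => z p.1 * w p.2 := summable_mul_of_summable_norm hz.norm hw.norm
  simp_rw [mul_comm (u _), mul_comm (w _)]
  rw [h1.tsum_add h2, ← tsum_mul_tsum_of_summable_norm hv.norm hu.norm,
    ← tsum_mul_tsum_of_summable_norm hz.norm hw.norm, mul_comm (∑' n, v n), mul_comm (∑' n, z n)]

theorem tsum_pairWeight {m : ℕ} (hm : 1 < m) :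
    ∑' p, pairWeight (m + 2) p = π ^ 2 / 6 * rzeta m * (1 + 2 * ((2 : ℝ) ^ m)⁻¹) := by
  have e : ∀ p, pairWeight (m + 2) p =
      (if Odd p.2 then ((p.2 : ℝ) ^ m)⁻¹ else 0) * ((p.1 : ℝ) ^ 2)⁻¹ +
      (2 ^ (m + 2) * (if 4 ∣ p.2 then ((p.2 : ℝ) ^ m)⁻¹ else 0)) * (if Odd p.1 then ((p.1 : ℝ) ^ 2)⁻¹ else 0) := by
    intro p
    rw [pairWeight, Nat.add_sub_cancel]
    by_cases h : Odd p.2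
    · have : ¬ 4 ∣ p.2 := fun h4 => by
        have := even_iff_two_dvd.2 (dvd_trans (by norm_num) h4)
        exact Nat.not_even_iff_odd.2 h this
      simp [h, this]
    · simp only [h, if_false, zero_mul, zero_add]
      by_cases h4 : 4 ∣ p.2 <;> by_cases ho : Odd p.1 <;> simp [h4, ho]
      ring
  have s1 := summable_ite_inv_pow hm (fun n => Odd n)
  have s2 := summable_inv_pow one_lt_two
  have s3 := (summable_ite_inv_pow hm (fun n => 4 ∣ n)).mul_left (2 ^ (m + 2))
  have s4 := summable_ite_inv_pow one_lt_two (fun n => Odd n)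
  rw [tsum_congr e, tsum_mul_snd_fst_add s1 s2 s3 s4, tsum_mul_left, tsum_ite_odd_inv_pow hm,
    tsum_ite_odd_inv_pow one_lt_two, tsum_ite_dvd_inv_pow hm (by norm_num), ← rzeta_natCast one_lt_two, rzeta_two]
  have h4 : (((4 : ℕ) : ℝ) ^ m)⁻¹ = ((2 : ℝ) ^ m)⁻¹ * ((2 : ℝ) ^ m)⁻¹ := by
    rw [← mul_inv, ← mul_pow]; norm_num
  rw [h4, pow_add]
  field_simp
  ring

theorem tsum_pairWeight_eq_mul {k : ℕ} (hk : 5 ≤ k) :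
    ∑' p, pairWeight k p = (∑' n : ℕ, if Odd n then ((n : ℝ) ^ k)⁻¹ else 0) *
      ∑' r : {r : ℚ | 0 < r}, pairWeight k ((r : ℚ).num.natAbs, (r : ℚ).den) := by
  set g : ℕ+ × {r : ℚ | 0 < r} → ℕ × ℕ := fun x => (x.1 * (x.2 : ℚ).num.natAbs, x.1 * (x.2 : ℚ).den) with hg
  have inj : Function.Injective g := by
    rintro ⟨d, r, hr⟩ ⟨e, s, hs⟩ h
    have hr : 0 < r := hr
    have hs : 0 < s := hs
    simp only [hg, Prod.mk.injEq] at h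
    have hd : (0 : ℚ) < d := by exact_mod_cast d.pos
    have he : (0 : ℚ) < e := by exact_mod_cast e.pos
    have hrn : ((r.num.natAbs : ℕ) : ℚ) = r.num := by
      rw [Nat.cast_natAbs, abs_of_pos (Rat.num_pos.2 hr)]
    have hsn : ((s.num.natAbs : ℕ) : ℚ) = s.num := by
      rw [Nat.cast_natAbs, abs_of_pos (Rat.num_pos.2 hs)]
    have h1 : (d : ℚ) * r.num = e * s.num := by rw [← hrn, ← hsn]; exact_mod_cast h.1
    have h2 : (d : ℚ) * r.den = e * s.den := by exact_mod_cast h.2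
    have hrs : r = s := by
      rw [← Rat.num_div_den r, ← Rat.num_div_den s, ← mul_div_mul_left _ _ hd.ne', h1, h2,
        mul_div_mul_left _ _ he.ne']
    subst hrs
    have : (d : ℕ) = e := Nat.eq_of_mul_eq_mul_right r.den_pos h.2
    simp [PNat.coe_inj.1 this]
  have hsupp : Function.support (pairWeight k) ⊆ Set.range g := by
    rintro ⟨a, q⟩ h
    have ha : a ≠ 0 := by
      rintro rfl; exact h (by simp [pairWeight])
    have hq : q ≠ 0 := by
      rintro rfl; refine h ?_
      have : k - 2 ≠ 0 := by lia
      simp [pairWeight, this]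
    have hgcd : 0 < a.gcd q := Nat.gcd_pos_of_pos_left _ (Nat.pos_of_ne_zero ha)
    obtain ⟨a', b', hc, h1, h2⟩ := Nat.exists_coprime a q
    have ha' : a' ≠ 0 := by rintro rfl; simp at h1; exact ha h1
    have hb' : b' ≠ 0 := by rintro rfl; simp at h2; exact hq h2
    have hpos : (0 : ℚ) < (a' : ℚ) / b' := by
      have : 0 < a' := Nat.pos_of_ne_zero ha'
      have : 0 < b' := Nat.pos_of_ne_zero hb'
      positivity
    refine ⟨(⟨a.gcd q, hgcd⟩, ⟨(a' : ℚ) / b', hpos⟩), ?_⟩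
    have hnum : ((a' : ℚ) / b').num = a' := by
      have := Rat.num_div_eq_of_coprime (a := a') (b := b') (by exact_mod_cast Nat.pos_of_ne_zero hb') (by simpa using hc)
      simpa using this
    have hden : ((a' : ℚ) / b').den = b' := by
      have := Rat.den_div_eq_of_coprime (a := a') (b := b') (by exact_mod_cast Nat.pos_of_ne_zero hb') (by simpa using hc)
      simpa using this
    simp only [hg, hnum, hden, PNat.mk_coe, Int.natAbs_natCast]
    rw [mul_comm, ← h1, mul_comm, ← h2]
  have sodd := summable_ite_inv_pow (show 1 < k by lia) (fun n => Odd n)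
  have hPN : (∑' n : ℕ, if Odd n then ((n : ℝ) ^ k)⁻¹ else 0) =
      ∑' d : ℕ+, if Odd (d : ℕ) then (((d : ℕ) : ℝ) ^ k)⁻¹ else 0 := by
    rw [← PNat.coe_injective.tsum_eq]
    intro n hn
    refine ⟨⟨n, Nat.pos_of_ne_zero ?_⟩, rfl⟩
    rintro rfl
    exact hn (by simp)
  have sr : Summable fun r : {r : ℚ | 0 < r} => pairWeight k ((r : ℚ).num.natAbs, (r : ℚ).den) := by
    have := ((summable_mainCoeff hk).subtype {r : ℚ | 0 < r}).mul_left (π ^ k / (4 * π ^ 2))⁻¹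
    refine this.congr fun r => ?_
    have hr : r.1 ≠ 0 := ne_of_gt (show (0 : ℚ) < r.1 from r.2)
    rw [Function.comp_apply, mainCoeff_eq (by lia) hr, inv_mul_cancel_left₀ (by positivity)]
  have sP : Summable fun d : ℕ+ => if Odd (d : ℕ) then (((d : ℕ) : ℝ) ^ k)⁻¹ else 0 :=
    sodd.comp_injective PNat.coe_injective
  rw [← inj.tsum_eq hsupp, hPN, tsum_mul_tsum_of_summable_norm sP.norm sr.norm]
  exact tsum_congr fun x => pairWeight_mul (by lia) _ _ _

theorem tsum_mainCoeff {k : ℕ} (hk : 5 ≤ k) :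
    ∑' r, mainCoeff k r = π ^ k * (1 / 4 + rzeta ((k : ℝ) - 2) * (1 + (2 : ℝ) ^ ((3 : ℝ) - (k : ℝ))) /
      (12 * rzeta2 (k : ℝ))) := by
  set g : ℚ → ℝ := {r : ℚ | 0 < r}.indicator (mainCoeff k) with hg
  have sg : Summable g := (summable_mainCoeff hk).indicator _
  have e : ∀ r, mainCoeff k r = (if r = 0 then mainCoeff k 0 else 0) + (g r + g (-r)) := fun r => by
    rcases lt_trichotomy r 0 with h | h | h
    · have h1 : ¬ 0 < r := by linarith
      have h3 : mainCoeff k (-r) = mainCoeff k r := by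
        rw [mainCoeff_eq (by lia) h.ne, mainCoeff_eq (by lia) (neg_ne_zero.2 h.ne)]
        simp
      simp [hg, h, h1, h.ne, h3]
    · simp [hg, h]
    · have h1 : ¬ r < 0 := by linarith
      simp [hg, h, h1, h.ne']
  have sn : Summable fun r => g (-r) := (Equiv.neg ℚ).summable_iff.2 sg
  have hn : ∑' r, g (-r) = ∑' r, g r := (Equiv.neg ℚ).tsum_eq g
  have s0 : Summable fun r : ℚ => if r = 0 then mainCoeff k 0 else 0 :=
    summable_of_ne_finset_zero (s := {0}) fun r hr => by simpa using fun h => absurd h (by simpa using hr)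
  have hsum : ∑' r, mainCoeff k r = mainCoeff k 0 + 2 * ∑' r, g r := by
    rw [tsum_congr e, s0.tsum_add (sg.add sn), sg.tsum_add sn, hn, tsum_ite_eq]
    ring
  have hG : ∑' r, g r = π ^ k / (4 * π ^ 2) *
      ∑' r : {r : ℚ | 0 < r}, pairWeight k ((r : ℚ).num.natAbs, (r : ℚ).den) := by
    rw [hg, ← _root_.tsum_subtype, ← tsum_mul_left]
    exact tsum_congr fun r => mainCoeff_eq (by lia) (ne_of_gt r.2)
  have h1 := tsum_pairWeight_eq_mul hk
  obtain ⟨m, rfl⟩ : ∃ m, k = m + 2 := ⟨k - 2, by lia⟩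
  rw [tsum_pairWeight (by lia), tsum_ite_odd_inv_pow (by lia)] at h1
  rw [hsum, hG, mainCoeff_zero]
  set S := ∑' r : {r : ℚ | 0 < r}, pairWeight (m + 2) ((r : ℚ).num.natAbs, (r : ℚ).den)
  have e1 : (((m + 2 : ℕ) : ℝ)) - 2 = m := by push_cast; ring
  have e2 : (2 : ℝ) ^ ((3 : ℝ) - ((m + 2 : ℕ) : ℝ)) = 2 * ((2 : ℝ) ^ m)⁻¹ := by
    rw [show (3 : ℝ) - ((m + 2 : ℕ) : ℝ) = 1 - m by push_cast; ring, Real.rpow_sub two_pos, Real.rpow_natCast,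
      Real.rpow_one, div_eq_mul_inv]
  have e3 : rzeta2 ((m + 2 : ℕ) : ℝ) = (1 - ((2 : ℝ) ^ (m + 2))⁻¹) * rzeta ((m + 2 : ℕ) : ℝ) := by
    rw [rzeta2, Real.rpow_neg two_pos.le, Real.rpow_natCast]
  rw [e1, e2, e3]
  have hz : (1 - ((2 : ℝ) ^ (m + 2))⁻¹) * rzeta ((m + 2 : ℕ) : ℝ) ≠ 0 := by
    have h2 : ((2 : ℝ) ^ (m + 2))⁻¹ < 1 := inv_lt_one_of_one_lt₀ (one_lt_pow₀ one_lt_two (by lia))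
    exact (mul_pos (by linarith) (rzeta_pos (by lia))).ne'
  set Z := (1 - ((2 : ℝ) ^ (m + 2))⁻¹) * rzeta ((m + 2 : ℕ) : ℝ)
  have hS : S = π ^ 2 / 6 * rzeta m * (1 + 2 * ((2 : ℝ) ^ m)⁻¹) / Z := by
    rw [eq_div_iff hz, h1, mul_comm]
  rw [hS]
  field_simp
  ring

theorem tangent_le_rpow {p a b : ℝ} (hp : 1 ≤ p) (ha : 0 < a) (hb : 0 ≤ b) :
    a ^ p + p * a ^ (p - 1) * (b - a) ≤ b ^ p := by
  have h1 : -1 ≤ (b - a) / a := by rw [le_div_iff₀ ha]; linarith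
  have h := one_add_mul_self_le_rpow_one_add h1 hp
  have h2 : 1 + (b - a) / a = b / a := by field_simp; ring
  rw [h2, Real.div_rpow hb ha.le] at h
  have hpa : 0 < a ^ p := Real.rpow_pos_of_pos ha p
  rw [le_div_iff₀ hpa] at h
  refine le_trans (le_of_eq ?_) h
  rw [Real.rpow_sub_one ha.ne']
  field_simp

theorem rpow_sub_rpow_le {p N t : ℝ} (hp : 1 ≤ p) (hN : 1 ≤ N) (h1 : N ≤ t) (h2 : t ≤ N + 1) :
    t ^ p - N ^ p ≤ p * 2 ^ (p - 1) * N ^ (p - 1) := by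
  have h := tangent_le_rpow hp (by linarith : 0 < t) (by linarith : 0 ≤ N)
  have h3 : t ^ (p - 1) ≤ (2 * N) ^ (p - 1) :=
    Real.rpow_le_rpow (by linarith) (by linarith) (by linarith)
  rw [Real.mul_rpow (by norm_num) (by linarith)] at h3
  have h4 : 0 ≤ t ^ (p - 1) := Real.rpow_nonneg (by linarith) _
  have h5 : p * t ^ (p - 1) * (t - N) ≤ p * t ^ (p - 1) :=
    mul_le_of_le_one_right (by positivity) (by linarith)
  nlinarith

theorem rpow_taylor_le {s N t : ℝ} (hs : 2 ≤ s) (hN : 1 ≤ N) (h1 : N ≤ t) (h2 : t ≤ N + 1) :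
    t ^ s - N ^ s - s * N ^ (s - 1) * (t - N) ≤ s * ((s - 1) * 2 ^ (s - 2) * N ^ (s - 2)) := by
  have h := tangent_le_rpow (by linarith : 1 ≤ s) (by linarith : 0 < t) (by linarith : 0 ≤ N)
  have h3 := rpow_sub_rpow_le (by linarith : 1 ≤ s - 1) hN h1 h2
  rw [show s - 1 - 1 = s - 2 by ring] at h3
  have h4 : N ^ (s - 1) ≤ t ^ (s - 1) := Real.rpow_le_rpow (by linarith) h1 (by linarith)
  have h5 : s * (t ^ (s - 1) - N ^ (s - 1)) * (t - N) ≤ s * (t ^ (s - 1) - N ^ (s - 1)) :=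
    mul_le_of_le_one_right (mul_nonneg (by linarith) (by linarith)) (by linarith)
  have h6 := mul_le_mul_of_nonneg_left h3 (by linarith : 0 ≤ s)
  linarith

theorem Sk_eq_of_mem_Ico (k n : ℕ) {t : ℝ} (h1 : (n : ℝ) ≤ t) (h2 : t < n + 1) : Sk k t = Sk k n := by
  have h : ∀ v : Fin k → ℤ, (∑ i, ((v i : ℝ)) ^ 2 ≤ t) ↔ (∑ i, ((v i : ℝ)) ^ 2 ≤ n) := fun v => by
    have e : ∑ i, ((v i : ℝ)) ^ 2 = ((∑ i, v i ^ 2 : ℤ) : ℝ) := by push_cast; rfl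
    rw [e]
    refine ⟨fun h => ?_, fun h => h.trans h1⟩
    have h3 : ((∑ i, v i ^ 2 : ℤ) : ℝ) < ((n + 1 : ℤ) : ℝ) := by push_cast at h ⊢; linarith
    have h4 : (∑ i, v i ^ 2 : ℤ) ≤ n := by have := Int.cast_lt.1 h3; lia
    exact_mod_cast h4
  unfold Sk
  simp_rw [h]

theorem abs_centredPk_sub_le {k : ℕ} (hk : 4 ≤ k) {N t S : ℝ} (hN : 1 ≤ N) (h1 : N ≤ t) (h2 : t ≤ N + 1) :
    |S - Vk k * t ^ ((k : ℝ) / 2) + (k : ℝ) / 4 * Vk k * t ^ ((k : ℝ) / 2 - 1) -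
      (S - Vk k * N ^ ((k : ℝ) / 2) + Vk k * ((k : ℝ) / 2) * N ^ ((k : ℝ) / 2 - 1) * (1 / 2 - (t - N)))| ≤
      2 * Vk k * ((k : ℝ) / 2) * (((k : ℝ) / 2 - 1) * 2 ^ ((k : ℝ) / 2 - 2)) * N ^ ((k : ℝ) / 2 - 2) := by
  have hk' : (4 : ℝ) ≤ k := by exact_mod_cast hk
  set s := (k : ℝ) / 2 with hs
  have h2s : 2 ≤ s := by rw [hs]; linarith
  have e : (k : ℝ) / 4 = s / 2 := by rw [hs]; ring
  rw [e]
  have hV := Vk_nonneg k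
  have a1 := rpow_taylor_le h2s hN h1 h2
  have a2 := tangent_le_rpow (by linarith : 1 ≤ s) (by linarith : 0 < N) (by linarith : 0 ≤ t)
  have a3 := rpow_sub_rpow_le (by linarith : 1 ≤ s - 1) hN h1 h2
  rw [show s - 1 - 1 = s - 2 by ring] at a3
  have a4 : N ^ (s - 1) ≤ t ^ (s - 1) := Real.rpow_le_rpow (by linarith) h1 (by linarith)
  set u := t ^ s - N ^ s - s * N ^ (s - 1) * (t - N) with hu
  set w := t ^ (s - 1) - N ^ (s - 1) with hw
  set M := (s - 1) * 2 ^ (s - 2) * N ^ (s - 2) with hM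
  have hu0 : 0 ≤ u := by linarith
  have hw0 : 0 ≤ w := by linarith
  have e2 : S - Vk k * t ^ s + s / 2 * Vk k * t ^ (s - 1) -
      (S - Vk k * N ^ s + Vk k * s * N ^ (s - 1) * (1 / 2 - (t - N))) = Vk k * (s / 2 * w) - Vk k * u := by
    rw [hu, hw]; ring
  have e3 : 2 * Vk k * s * ((s - 1) * 2 ^ (s - 2)) * N ^ (s - 2) = Vk k * (2 * s * M) := by
    rw [hM]; ring
  rw [e2, e3, ← mul_sub, abs_mul, abs_of_nonneg hV]
  refine mul_le_mul_of_nonneg_left ?_ hV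
  have hM0 : 0 ≤ M := hw0.trans a3
  have h3 : s / 2 * w ≤ s / 2 * M := mul_le_mul_of_nonneg_left a3 (by linarith)
  have h4 : 0 ≤ s / 2 * w := by positivity
  have h5 : 0 ≤ s * M := by positivity
  rw [abs_le]
  constructor <;> nlinarith

theorem integral_affine_sq (p B N : ℝ) :
    ∫ t in N..(N + 1), (p + B * (1 / 2 - (t - N))) ^ 2 = p ^ 2 + B ^ 2 / 12 := by
  have h : ∀ t ∈ Set.uIcc N (N + 1), HasDerivAt
      (fun t => (p + B / 2) ^ 2 * (t - N) - (p + B / 2) * B * (t - N) ^ 2 + B ^ 2 * (t - N) ^ 3 / 3)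
      ((p + B * (1 / 2 - (t - N))) ^ 2) t := fun t _ => by
    have h0 : HasDerivAt (fun t => t - N) 1 t := (hasDerivAt_id t).sub_const N
    have := (((h0.const_mul ((p + B / 2) ^ 2)).sub ((h0.pow 2).const_mul ((p + B / 2) * B))).add
      (((h0.pow 3).const_mul (B ^ 2)).div_const 3))
    refine this.congr_deriv ?_
    norm_num
    ring
  rw [intervalIntegral.integral_eq_sub_of_hasDerivAt h (by
    apply Continuous.intervalIntegrable; fun_prop)]
  ring

theorem exp_neg_mul_unit_bounds {c N t : ℝ} (hc : 0 ≤ c) (h1 : N ≤ t) (h2 : t ≤ N + 1) :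
    (1 - c) * Real.exp (-c * N) ≤ Real.exp (-c * t) ∧ Real.exp (-c * t) ≤ Real.exp (-c * N) := by
  constructor
  · have h := Real.add_one_le_exp (-c * (t - N))
    have h3 : 1 - c ≤ Real.exp (-c * (t - N)) := by nlinarith
    calc _ ≤ Real.exp (-c * (t - N)) * Real.exp (-c * N) :=
          mul_le_mul_of_nonneg_right h3 (Real.exp_pos _).le
      _ = _ := by rw [← Real.exp_add]; ring_nf
  · exact Real.exp_le_exp.2 (by nlinarith)

theorem exp_neg_mul_le_three_mul {c N t : ℝ} (hc : 0 ≤ c) (hc1 : c ≤ 1) (h2 : t ≤ N + 1) :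
    Real.exp (-c * N) ≤ 3 * Real.exp (-c * t) := by
  have h : Real.exp (c * (t - N)) ≤ 3 :=
    (Real.exp_le_exp.2 (by nlinarith : c * (t - N) ≤ 1)).trans Real.exp_one_lt_three.le
  calc _ = Real.exp (c * (t - N)) * Real.exp (-c * t) := by rw [← Real.exp_add]; ring_nf
    _ ≤ _ := mul_le_mul_of_nonneg_right h (Real.exp_pos _).le

theorem abs_unit_integral_sub_le {f g : ℝ → ℝ} {N M : ℝ} (hf : ContinuousOn f (Set.Icc N (N + 1)))
    (hg : ContinuousOn g (Set.Icc N (N + 1))) (h : ∀ t, N ≤ t → t ≤ N + 1 → |f t - g t| ≤ M) :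
    |(∫ t in N..(N + 1), f t) - ∫ t in N..(N + 1), g t| ≤ M := by
  have hN : N ≤ N + 1 := by linarith
  rw [← intervalIntegral.integral_sub (hf.intervalIntegrable_of_Icc hN) (hg.intervalIntegrable_of_Icc hN),
    ← Real.norm_eq_abs]
  refine (intervalIntegral.norm_integral_le_of_norm_le_const (C := M) fun t ht => ?_).trans (by simp)
  rw [Set.uIoc_of_le hN] at ht
  exact h t ht.1.le ht.2

theorem abs_integral_sq_mul_exp_sub_le {h : ℝ → ℝ} {p B a c N : ℝ} (hcont : ContinuousOn h (Set.Icc N (N + 1)))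
    (hB : 0 ≤ B) (hc : 0 < c) (hc1 : c ≤ 1)
    (hh : ∀ t, N ≤ t → t ≤ N + 1 → |h t - (p + B * (1 / 2 - (t - N)))| ≤ a) :
    |(∫ t in N..(N + 1), h t ^ 2 * Real.exp (-c * t)) - Real.exp (-c * N) * (p ^ 2 + B ^ 2 / 12)| ≤
      Real.exp (-c * N) * (5 * c * p ^ 2 + 4 * (a ^ 2 / c) + B * a + c * B ^ 2) := by
  rw [← integral_affine_sq p B N, ← intervalIntegral.integral_const_mul]
  refine abs_unit_integral_sub_le (by fun_prop) (by fun_prop) fun t h1 h2 => ?_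
  obtain ⟨e1, e2⟩ := exp_neg_mul_unit_bounds hc.le h1 h2
  have hd := hh t h1 h2
  set E := Real.exp (-c * N)
  set F := Real.exp (-c * t)
  have hE : 0 < E := Real.exp_pos _
  set A := p + B * (1 / 2 - (t - N)) with hA
  obtain ⟨d, hd'⟩ : ∃ d, h t = A + d := ⟨h t - A, by ring⟩
  rw [hd'] at hd ⊢
  rw [add_sub_cancel_left] at hd
  have ha : 0 ≤ a := (abs_nonneg _).trans hd
  have hA1 : |A| ≤ |p| + B / 2 := by
    refine (abs_add_le _ _).trans (add_le_add_right ?_ _)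
    rw [abs_mul, abs_of_nonneg hB]
    have : |1 / 2 - (t - N)| ≤ 1 / 2 := by rw [abs_le]; constructor <;> linarith
    nlinarith
  have hq : |(A + d) ^ 2 - A ^ 2| ≤ 2 * |p| * a + B * a + a ^ 2 := by
    rw [show (A + d) ^ 2 - A ^ 2 = (2 * A + d) * d by ring, abs_mul]
    have h3 : |2 * A + d| ≤ 2 * |p| + B + a := by
      refine (abs_add_le _ _).trans ?_
      rw [abs_mul, abs_two]; linarith
    calc _ ≤ (2 * |p| + B + a) * a := mul_le_mul h3 hd (abs_nonneg _) (by positivity)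
      _ = _ := by ring
  have hA2 : A ^ 2 ≤ 2 * p ^ 2 + B ^ 2 / 2 := by
    have := pow_le_pow_left₀ (abs_nonneg A) hA1 2
    rw [sq_abs] at this
    nlinarith [sq_nonneg (|p| - B / 2), sq_abs p]
  have hd2 : d ^ 2 ≤ a ^ 2 := by rw [← sq_abs d]; exact pow_le_pow_left₀ (abs_nonneg _) hd 2
  have hs : (A + d) ^ 2 ≤ 4 * p ^ 2 + B ^ 2 + 2 * a ^ 2 := by nlinarith [sq_nonneg (A - d)]
  have ham : 2 * |p| * a ≤ c * p ^ 2 + a ^ 2 / c := by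
    have h3 : c * p ^ 2 + a ^ 2 / c - 2 * |p| * a = (c * |p| - a) ^ 2 / c := by
      rw [← sq_abs p]; field_simp; ring
    have : 0 ≤ (c * |p| - a) ^ 2 / c := by positivity
    linarith
  have ha2 : a ^ 2 ≤ a ^ 2 / c := by rw [le_div_iff₀ hc]; nlinarith [sq_nonneg a]
  have hca2 : c * a ^ 2 ≤ a ^ 2 / c := le_trans (by nlinarith [sq_nonneg a]) ha2
  have hfin : |(A + d) ^ 2 - A ^ 2| + c * (A + d) ^ 2 ≤
      5 * c * p ^ 2 + 4 * (a ^ 2 / c) + B * a + c * B ^ 2 := by nlinarith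
  calc |(A + d) ^ 2 * F - E * A ^ 2| = |E * ((A + d) ^ 2 - A ^ 2) - (A + d) ^ 2 * (E - F)| := by
        congr 1; ring
    _ ≤ |E * ((A + d) ^ 2 - A ^ 2)| + |(A + d) ^ 2 * (E - F)| := abs_sub _ _
    _ = E * |(A + d) ^ 2 - A ^ 2| + (A + d) ^ 2 * (E - F) := by
        rw [abs_mul, abs_of_pos hE, abs_of_nonneg (mul_nonneg (sq_nonneg _) (sub_nonneg.2 e2))]
    _ ≤ E * |(A + d) ^ 2 - A ^ 2| + (A + d) ^ 2 * (c * E) := by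
        gcongr; linarith
    _ = E * (|(A + d) ^ 2 - A ^ 2| + c * (A + d) ^ 2) := by ring
    _ ≤ _ := mul_le_mul_of_nonneg_left hfin hE.le

theorem sq_mul_exp_le_integral {h : ℝ → ℝ} {p B a c N : ℝ} (hcont : ContinuousOn h (Set.Icc N (N + 1)))
    (hc : 0 < c) (hc1 : c ≤ 1)
    (hh : ∀ t, N ≤ t → t ≤ N + 1 → |h t - (p + B * (1 / 2 - (t - N)))| ≤ a) :
    Real.exp (-c * N) * p ^ 2 ≤ 9 * (∫ t in N..(N + 1), h t ^ 2 * Real.exp (-c * t)) +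
      Real.exp (-c * N) * (B ^ 2 + 3 * a ^ 2) := by
  have hN : N ≤ N + 1 := by linarith
  have key : ∀ t ∈ Set.Icc N (N + 1), Real.exp (-c * N) * (p ^ 2 - (B ^ 2 + 3 * a ^ 2)) ≤
      9 * (h t ^ 2 * Real.exp (-c * t)) := by
    rintro t ⟨h1, h2⟩
    have hd := hh t h1 h2
    have e1 := exp_neg_mul_le_three_mul hc.le hc1 h2
    set x := t - N
    have hp : p ^ 2 - (B ^ 2 + 3 * a ^ 2) ≤ 3 * h t ^ 2 := by
      obtain ⟨d, hd'⟩ : ∃ d, h t = p + B * (1 / 2 - x) + d := ⟨_, (add_sub_cancel _ _).symm⟩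
      rw [hd', add_sub_cancel_left] at hd
      have hd2 : d ^ 2 ≤ a ^ 2 := by rw [← sq_abs d]; exact pow_le_pow_left₀ (abs_nonneg _) hd 2
      have hp : p = h t + (-(B * (1 / 2 - x))) + (-d) := by rw [hd']; ring
      have hx : (B * (1 / 2 - x)) ^ 2 ≤ B ^ 2 / 4 := by
        have h3 : (1 / 2 - x) ^ 2 ≤ 1 / 4 := by
          have : 0 ≤ x := sub_nonneg.2 h1
          have : x ≤ 1 := by simp only [x]; linarith
          nlinarith
        rw [mul_pow]; nlinarith [sq_nonneg B]
      set y := B * (1 / 2 - x)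
      have : p ^ 2 ≤ 3 * h t ^ 2 + 3 * y ^ 2 + 3 * d ^ 2 := by
        rw [hp]
        nlinarith [sq_nonneg (h t + y), sq_nonneg (h t + d), sq_nonneg (y - d)]
      nlinarith [sq_nonneg B]
    calc _ ≤ Real.exp (-c * N) * (3 * h t ^ 2) := mul_le_mul_of_nonneg_left hp (Real.exp_pos _).le
      _ ≤ 3 * Real.exp (-c * t) * (3 * h t ^ 2) := mul_le_mul_of_nonneg_right e1 (by positivity)
      _ = _ := by ring
  have := intervalIntegral.integral_mono_on hN (intervalIntegrable_const (μ := volume))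
    ((by fun_prop : ContinuousOn (fun t => 9 * (h t ^ 2 * Real.exp (-c * t))) _).intervalIntegrable_of_Icc hN) key
  rw [intervalIntegral.integral_const, intervalIntegral.integral_const_mul] at this
  simp only [add_sub_cancel_left, one_smul] at this
  linarith

theorem continuousOn_rpow_mul_exp_Icc {N : ℝ} (hN : 1 ≤ N) (c j : ℝ) :
    ContinuousOn (fun t : ℝ => t ^ j * Real.exp (-c * t)) (Set.Icc N (N + 1)) := by
  refine ContinuousOn.mul (fun t ht => ?_) (by fun_prop)
  exact (Real.continuousAt_rpow_const _ _ (Or.inl (by linarith [ht.1]))).continuousWithinAt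

theorem rpow_mul_exp_le_integral {j c N : ℝ} (hj : 0 ≤ j) (hN : 1 ≤ N) (hc : 0 ≤ c) (hc1 : c ≤ 1) :
    N ^ j * Real.exp (-c * N) ≤ 3 * ∫ t in N..(N + 1), t ^ j * Real.exp (-c * t) := by
  have hN' : N ≤ N + 1 := by linarith
  have := intervalIntegral.integral_mono_on hN' (intervalIntegrable_const (μ := volume) (c := N ^ j * Real.exp (-c * N)))
    (((continuousOn_rpow_mul_exp_Icc hN c j).const_smul (3 : ℝ)).intervalIntegrable_of_Icc hN') (fun t ht => by
      have e1 := exp_neg_mul_le_three_mul hc hc1 ht.2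
      have e2 : N ^ j ≤ t ^ j := Real.rpow_le_rpow (by linarith) ht.1 hj
      calc _ ≤ t ^ j * (3 * Real.exp (-c * t)) :=
            mul_le_mul e2 e1 (Real.exp_pos _).le (Real.rpow_nonneg (by linarith [ht.1]) _)
        _ = 3 * (t ^ j * Real.exp (-c * t)) := by ring)
  simpa using this

theorem abs_integral_rpow_mul_exp_sub_le {j c N : ℝ} (hj : 1 ≤ j) (hN : 1 ≤ N) (hc : 0 ≤ c) :
    |(∫ t in N..(N + 1), t ^ j * Real.exp (-c * t)) - N ^ j * Real.exp (-c * N)| ≤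
      Real.exp (-c * N) * (c * (2 ^ j * N ^ j) + j * 2 ^ (j - 1) * N ^ (j - 1)) := by
  have hN' : N ≤ N + 1 := by linarith
  have h0 : N ^ j * Real.exp (-c * N) = ∫ _ in N..(N + 1), N ^ j * Real.exp (-c * N) := by simp
  rw [h0]
  refine abs_unit_integral_sub_le (continuousOn_rpow_mul_exp_Icc hN c j) continuousOn_const fun t h1 h2 => ?_
  obtain ⟨e1, e2⟩ := exp_neg_mul_unit_bounds hc h1 h2
  have a1 := rpow_sub_rpow_le hj hN h1 h2
  have a2 : N ^ j ≤ t ^ j := Real.rpow_le_rpow (by linarith) h1 (by linarith)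
  have a3 : t ^ j ≤ 2 ^ j * N ^ j := by
    rw [← Real.mul_rpow (by norm_num) (by linarith)]
    exact Real.rpow_le_rpow (by linarith) (by linarith) (by linarith)
  have a4 : 0 ≤ t ^ j := Real.rpow_nonneg (by linarith) _
  set E := Real.exp (-c * N)
  set F := Real.exp (-c * t)
  have hE : 0 < E := Real.exp_pos _
  calc |t ^ j * F - N ^ j * E| = |E * (t ^ j - N ^ j) - t ^ j * (E - F)| := by congr 1; ring
    _ ≤ |E * (t ^ j - N ^ j)| + |t ^ j * (E - F)| := abs_sub _ _
    _ = E * (t ^ j - N ^ j) + t ^ j * (E - F) := by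
        rw [abs_of_nonneg (mul_nonneg hE.le (by linarith)), abs_of_nonneg (mul_nonneg a4 (by linarith))]
    _ ≤ E * (j * 2 ^ (j - 1) * N ^ (j - 1)) + 2 ^ j * N ^ j * (c * E) :=
        add_le_add (mul_le_mul_of_nonneg_left a1 hE.le) (mul_le_mul a3 (by linarith) (by linarith) (a4.trans a3))
    _ = _ := by ring

theorem hasSum_unit_integrals {f : ℝ → ℝ} (hf : IntegrableOn f (Set.Ioi 1)) (h0 : ∀ t, 1 ≤ t → 0 ≤ f t) :
    HasSum (fun n : ℕ => ∫ t in ((n : ℝ) + 1)..((n : ℝ) + 1 + 1), f t) (∫ t in Set.Ioi 1, f t) := by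
  have hii : ∀ a b : ℝ, 1 ≤ a → a ≤ b → IntervalIntegrable f volume a b := fun a b ha hab => by
    rw [intervalIntegrable_iff_integrableOn_Ioc_of_le hab]
    exact hf.mono_set fun t ht => lt_of_le_of_lt ha ht.1
  rw [hasSum_iff_tendsto_nat_of_nonneg]
  · have h1 : ∀ n : ℕ, ∑ i ∈ Finset.range n, ∫ t in ((i : ℝ) + 1)..((i : ℝ) + 1 + 1), f t =
        ∫ t in (1 : ℝ)..((n : ℝ) + 1), f t := fun n => by
      have := intervalIntegral.sum_integral_adjacent_intervals (f := f) (μ := volume)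
        (a := fun i : ℕ => (i : ℝ) + 1) (n := n) (fun i _ => hii _ _ (by simp) (by simp))
      simpa using this
    simp_rw [h1]
    exact intervalIntegral_tendsto_integral_Ioi 1 hf
      (Filter.tendsto_atTop_add_const_right _ _ tendsto_natCast_atTop_atTop)
  · intro n
    refine intervalIntegral.integral_nonneg (by linarith) fun t ht => h0 t ?_
    have : (0 : ℝ) ≤ n := n.cast_nonneg
    linarith [ht.1]

theorem HasSum.abs_tsum_sub_le {a b d : ℕ → ℝ} {A : ℝ} (ha : HasSum a A) (hd : Summable d)
    (h : ∀ n, |a n - b n| ≤ d n) : |∑' n, b n - A| ≤ ∑' n, d n := by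
  have h1 : Summable fun n => a n - b n := Summable.of_norm_bounded hd h
  have h2 : Summable b := by simpa using ha.summable.sub h1
  rw [← ha.tsum_eq, abs_sub_comm, ← ha.summable.tsum_sub h2]
  exact tsum_of_norm_bounded (f := fun n => a n - b n) hd.hasSum h

theorem integral_rpow_mul_exp_neg_mul {j c : ℝ} (hj : 0 ≤ j) (hc : 0 < c) :
    ∫ t in Set.Ioi (0 : ℝ), t ^ j * Real.exp (-c * t) = Real.Gamma (j + 1) * c ^ (-(j + 1)) := by
  have := Real.integral_rpow_mul_exp_neg_mul_Ioi (show 0 < j + 1 by linarith) hc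
  simp only [add_sub_cancel_right, ← neg_mul] at this
  rw [this, one_div, Real.inv_rpow hc.le, Real.rpow_neg hc.le, mul_comm]

theorem integral_Ioi_one_rpow_mul_exp_bounds {j c : ℝ} (hj : 0 ≤ j) (hc : 0 < c) :
    (∫ t in Set.Ioi (1 : ℝ), t ^ j * Real.exp (-c * t)) ≤ Real.Gamma (j + 1) * c ^ (-(j + 1)) ∧
      Real.Gamma (j + 1) * c ^ (-(j + 1)) - 1 ≤ ∫ t in Set.Ioi (1 : ℝ), t ^ j * Real.exp (-c * t) := by
  have hint := integrableOn_rpow_mul_exp_neg_mul (show -1 < j by linarith) hc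
  have hadd : (∫ t in Set.Ioi (0 : ℝ), t ^ j * Real.exp (-c * t)) =
      (∫ t in Set.Ioc (0 : ℝ) 1, t ^ j * Real.exp (-c * t)) + ∫ t in Set.Ioi (1 : ℝ), t ^ j * Real.exp (-c * t) := by
    rw [← setIntegral_union (Set.Ioc_disjoint_Ioi le_rfl) measurableSet_Ioi
      (hint.mono_set Set.Ioc_subset_Ioi_self) (hint.mono_set (Set.Ioi_subset_Ioi zero_le_one)),
      Set.Ioc_union_Ioi_eq_Ioi zero_le_one]
  rw [integral_rpow_mul_exp_neg_mul hj hc] at hadd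
  have h0 : 0 ≤ ∫ t in Set.Ioc (0 : ℝ) 1, t ^ j * Real.exp (-c * t) :=
    setIntegral_nonneg measurableSet_Ioc fun t ht => mul_nonneg (Real.rpow_nonneg ht.1.le _) (Real.exp_pos _).le
  have h1 : ∫ t in Set.Ioc (0 : ℝ) 1, t ^ j * Real.exp (-c * t) ≤ ∫ _ in Set.Ioc (0 : ℝ) 1, (1 : ℝ) := by
    refine setIntegral_mono_on (hint.mono_set Set.Ioc_subset_Ioi_self) (by simp) measurableSet_Ioc fun t ht => ?_
    exact mul_le_one₀ (Real.rpow_le_one ht.1.le ht.2 hj) (Real.exp_pos _).le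
      (Real.exp_le_one_iff.2 (by nlinarith [ht.1]))
  rw [show ∫ _ in Set.Ioc (0 : ℝ) 1, (1 : ℝ) = 1 by simp] at h1
  constructor <;> linarith

theorem hasSum_unit_integrals_rpow_mul_exp {j c : ℝ} (hj : 0 ≤ j) (hc : 0 < c) :
    HasSum (fun n : ℕ => ∫ t in ((n : ℝ) + 1)..((n : ℝ) + 1 + 1), t ^ j * Real.exp (-c * t))
      (∫ t in Set.Ioi (1 : ℝ), t ^ j * Real.exp (-c * t)) :=
  hasSum_unit_integrals ((integrableOn_rpow_mul_exp_neg_mul (show -1 < j by linarith) hc).mono_set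
    (Set.Ioi_subset_Ioi zero_le_one)) fun t ht => mul_nonneg (Real.rpow_nonneg (by linarith) _) (Real.exp_pos _).le

theorem summable_rpow_mul_exp {j c : ℝ} (hj : 0 ≤ j) (hc : 0 < c) (hc1 : c ≤ 1) :
    Summable fun n : ℕ => ((n : ℝ) + 1) ^ j * Real.exp (-c * ((n : ℝ) + 1)) :=
  ((hasSum_unit_integrals_rpow_mul_exp hj hc).summable.mul_left 3).of_nonneg_of_le
    (fun n => by positivity) fun n => rpow_mul_exp_le_integral hj (by simp) hc.le hc1

theorem tsum_rpow_mul_exp_le {j c : ℝ} (hj : 0 ≤ j) (hc : 0 < c) (hc1 : c ≤ 1) :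
    ∑' n : ℕ, ((n : ℝ) + 1) ^ j * Real.exp (-c * ((n : ℝ) + 1)) ≤ 3 * Real.Gamma (j + 1) * c ^ (-(j + 1)) := by
  have h := hasSum_unit_integrals_rpow_mul_exp hj hc
  calc _ ≤ ∑' n : ℕ, 3 * ∫ t in ((n : ℝ) + 1)..((n : ℝ) + 1 + 1), t ^ j * Real.exp (-c * t) :=
        (summable_rpow_mul_exp hj hc hc1).tsum_le_tsum
          (fun n => rpow_mul_exp_le_integral hj (by simp) hc.le hc1) (h.summable.mul_left 3)
    _ = 3 * ∫ t in Set.Ioi (1 : ℝ), t ^ j * Real.exp (-c * t) := by rw [tsum_mul_left, h.tsum_eq]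
    _ ≤ 3 * (Real.Gamma (j + 1) * c ^ (-(j + 1))) :=
        mul_le_mul_of_nonneg_left (integral_Ioi_one_rpow_mul_exp_bounds hj hc).1 (by norm_num)
    _ = _ := by ring

theorem exists_tsum_rpow_mul_exp_sub_le {j : ℝ} (hj : 1 ≤ j) : ∃ K, 0 < K ∧ ∀ c, 0 < c → c ≤ 1 →
    |∑' n : ℕ, ((n : ℝ) + 1) ^ j * Real.exp (-c * ((n : ℝ) + 1)) - Real.Gamma (j + 1) * c ^ (-(j + 1))| ≤
      K * c ^ (-j) := by
  have hG1 : 0 < Real.Gamma (j + 1) := Real.Gamma_pos_of_pos (by linarith)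
  have hG2 : 0 < Real.Gamma (j - 1 + 1) := Real.Gamma_pos_of_pos (by linarith)
  refine ⟨2 ^ j * (3 * Real.Gamma (j + 1)) + j * 2 ^ (j - 1) * (3 * Real.Gamma (j - 1 + 1)) + 1,
    by positivity, fun c hc hc1 => ?_⟩
  have hj0 : 0 ≤ j := by linarith
  have hj1 : 0 ≤ j - 1 := by linarith
  have s1 := summable_rpow_mul_exp hj0 hc hc1
  have s2 := summable_rpow_mul_exp hj1 hc hc1
  have t1 := tsum_rpow_mul_exp_le hj0 hc hc1
  have t2 := tsum_rpow_mul_exp_le hj1 hc hc1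
  have hd := (s1.mul_left (c * 2 ^ j)).add (s2.mul_left (j * 2 ^ (j - 1)))
  have key := (hasSum_unit_integrals_rpow_mul_exp hj0 hc).abs_tsum_sub_le hd (fun n => by
    refine (abs_integral_rpow_mul_exp_sub_le hj (by simp) hc.le).trans (le_of_eq ?_)
    ring)
  rw [(s1.mul_left _).tsum_add (s2.mul_left _), tsum_mul_left, tsum_mul_left] at key
  obtain ⟨b1, b2⟩ := integral_Ioi_one_rpow_mul_exp_bounds hj0 hc
  have e1 : c * c ^ (-(j + 1)) = c ^ (-j) := by
    rw [← Real.rpow_one_add' hc.le (by linarith)]; ring_nf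
  rw [show -(j - 1 + 1) = -j by ring] at t2
  have h1 : 1 ≤ c ^ (-j) := Real.one_le_rpow_of_pos_of_le_one_of_nonpos hc hc1 (by linarith)
  have u1 := mul_le_mul_of_nonneg_left t1 (show 0 ≤ c * 2 ^ j by positivity)
  have u2 := mul_le_mul_of_nonneg_left t2 (show 0 ≤ j * 2 ^ (j - 1) by positivity)
  have e2 : c * 2 ^ j * (3 * Real.Gamma (j + 1) * c ^ (-(j + 1))) =
      2 ^ j * (3 * Real.Gamma (j + 1)) * c ^ (-j) := by rw [← e1]; ring
  rw [abs_le] at key ⊢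
  constructor <;> nlinarith

theorem Vk_mul_half_sq {k : ℕ} (hk : 0 < k) :
    (Vk k * ((k : ℝ) / 2)) ^ 2 = π ^ k / Real.Gamma ((k : ℝ) / 2) ^ 2 := by
  have hk' : (0 : ℝ) < (k : ℝ) / 2 := by positivity
  have hG := Real.Gamma_pos_of_pos hk'
  have h := Vk_mul_Gamma k
  rw [Real.Gamma_add_one hk'.ne', ← mul_assoc] at h
  rw [eq_div_iff (by positivity), ← mul_pow, h, ← Real.rpow_mul_natCast Real.pi_pos.le]
  norm_num

theorem unit_integral_centredPk_sq_eq {k n : ℕ} (c : ℝ) :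
    ∫ t in ((n : ℝ) + 1)..((n : ℝ) + 1 + 1), centredPk k t ^ 2 * Real.exp (-c * t) =
      ∫ t in ((n : ℝ) + 1)..((n : ℝ) + 1 + 1), ((Sk k ((n : ℝ) + 1) : ℝ) - Vk k * t ^ ((k : ℝ) / 2) +
        (k : ℝ) / 4 * Vk k * t ^ ((k : ℝ) / 2 - 1)) ^ 2 * Real.exp (-c * t) := by
  refine intervalIntegral.integral_congr_Ioo_of_le (by linarith) fun t ht => ?_
  have : Sk k t = Sk k ((n : ℝ) + 1) := by
    have := Sk_eq_of_mem_Ico k (n + 1) (t := t) (by push_cast; exact ht.1.le) (by push_cast; exact ht.2)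
    push_cast at this
    exact this
  simp only [centredPk, Pk, this]

theorem continuousOn_centred_Icc (k : ℕ) (S : ℝ) {N : ℝ} (hN : 1 ≤ N) :
    ContinuousOn (fun t : ℝ => S - Vk k * t ^ ((k : ℝ) / 2) + (k : ℝ) / 4 * Vk k * t ^ ((k : ℝ) / 2 - 1))
      (Set.Icc N (N + 1)) := by
  have h : ∀ p : ℝ, ContinuousOn (fun t : ℝ => t ^ p) (Set.Icc N (N + 1)) := fun p t ht =>
    (Real.continuousAt_rpow_const _ _ (Or.inl (by linarith [ht.1]))).continuousWithinAt
  have h1 := h ((k : ℝ) / 2)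
  have h2 := h ((k : ℝ) / 2 - 1)
  fun_prop

set_option maxHeartbeats 1000000 in
theorem exists_unit_integral_centredPk_sq_bounds {k : ℕ} (hk : 4 ≤ k) : ∃ K, 0 ≤ K ∧ ∀ c, 0 < c → c ≤ 1 → ∀ n : ℕ,
    |(∫ t in ((n : ℝ) + 1)..((n : ℝ) + 1 + 1), centredPk k t ^ 2 * Real.exp (-c * t)) -
        (Pk k ((n : ℝ) + 1) ^ 2 * Real.exp (-c * ((n : ℝ) + 1)) + (Vk k * ((k : ℝ) / 2)) ^ 2 / 12 *
          (((n : ℝ) + 1) ^ ((k : ℝ) - 2) * Real.exp (-c * ((n : ℝ) + 1))))| ≤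
      5 * c * (Pk k ((n : ℝ) + 1) ^ 2 * Real.exp (-c * ((n : ℝ) + 1))) +
      K / c * (((n : ℝ) + 1) ^ ((k : ℝ) - 4) * Real.exp (-c * ((n : ℝ) + 1))) +
      K * (((n : ℝ) + 1) ^ ((k : ℝ) - 3) * Real.exp (-c * ((n : ℝ) + 1))) +
      K * c * (((n : ℝ) + 1) ^ ((k : ℝ) - 2) * Real.exp (-c * ((n : ℝ) + 1))) ∧
    Pk k ((n : ℝ) + 1) ^ 2 * Real.exp (-c * ((n : ℝ) + 1)) ≤
      9 * (∫ t in ((n : ℝ) + 1)..((n : ℝ) + 1 + 1), centredPk k t ^ 2 * Real.exp (-c * t)) +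
      K * (((n : ℝ) + 1) ^ ((k : ℝ) - 2) * Real.exp (-c * ((n : ℝ) + 1))) := by
  have hk' : (4 : ℝ) ≤ k := by exact_mod_cast hk
  set D := Vk k * ((k : ℝ) / 2) with hD
  set L := 2 * Vk k * ((k : ℝ) / 2) * (((k : ℝ) / 2 - 1) * 2 ^ ((k : ℝ) / 2 - 2)) with hL
  have hV := Vk_nonneg k
  have hD0 : 0 ≤ D := by positivity
  have hL0 : 0 ≤ L := by
    have : 0 ≤ (k : ℝ) / 2 - 1 := by linarith
    positivity
  refine ⟨4 * L ^ 2 + D * L + D ^ 2, by positivity, fun c hc hc1 n => ?_⟩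
  set N := (n : ℝ) + 1 with hNdef
  have hN : 1 ≤ N := by simp [hNdef]
  have hN0 : 0 < N := by linarith
  have hh : ∀ t, N ≤ t → t ≤ N + 1 → |(Sk k N : ℝ) - Vk k * t ^ ((k : ℝ) / 2) +
      (k : ℝ) / 4 * Vk k * t ^ ((k : ℝ) / 2 - 1) - (Pk k N + D * N ^ ((k : ℝ) / 2 - 1) * (1 / 2 - (t - N)))| ≤
      L * N ^ ((k : ℝ) / 2 - 2) := fun t h1 h2 => abs_centredPk_sub_le hk hN h1 h2
  clear_value D L
  have hcont := continuousOn_centred_Icc k (Sk k N) hN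
  have hB : 0 ≤ D * N ^ ((k : ℝ) / 2 - 1) := by positivity
  have h1 := abs_integral_sq_mul_exp_sub_le hcont hB hc hc1 hh
  have h2 := sq_mul_exp_le_integral hcont hc hc1 hh
  rw [← unit_integral_centredPk_sq_eq] at h1 h2
  have p1 : (N ^ ((k : ℝ) / 2 - 1)) ^ 2 = N ^ ((k : ℝ) - 2) := by
    rw [← Real.rpow_mul_natCast hN0.le]; congr 1; push_cast; ring
  have p2 : (N ^ ((k : ℝ) / 2 - 2)) ^ 2 = N ^ ((k : ℝ) - 4) := by
    rw [← Real.rpow_mul_natCast hN0.le]; congr 1; push_cast; ring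
  have p3 : N ^ ((k : ℝ) / 2 - 1) * N ^ ((k : ℝ) / 2 - 2) = N ^ ((k : ℝ) - 3) := by
    rw [← Real.rpow_add hN0]; congr 1; ring
  have p4 : N ^ ((k : ℝ) - 4) ≤ N ^ ((k : ℝ) - 2) := Real.rpow_le_rpow_of_exponent_le hN (by linarith)
  have q2 : 0 < N ^ ((k : ℝ) - 2) := by positivity
  have q3 : 0 < N ^ ((k : ℝ) - 3) := by positivity
  have q4 : 0 < N ^ ((k : ℝ) - 4) := by positivity
  simp only [mul_pow, p1, p2] at h1 h2
  rw [show D * N ^ ((k : ℝ) / 2 - 1) * (L * N ^ ((k : ℝ) / 2 - 2)) = D * L * N ^ ((k : ℝ) - 3) by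
    rw [← p3]; ring] at h1
  set E := Real.exp (-c * N)
  have hE : 0 < E := Real.exp_pos _
  set K := 4 * L ^ 2 + D * L + D ^ 2 with hK
  have k1 : 4 * L ^ 2 ≤ K := by rw [hK]; nlinarith [sq_nonneg D, mul_nonneg hD0 hL0]
  have k2 : D * L ≤ K := by rw [hK]; nlinarith [sq_nonneg D, sq_nonneg L]
  have k3 : D ^ 2 ≤ K := by rw [hK]; nlinarith [sq_nonneg L, mul_nonneg hD0 hL0]
  constructor
  · rw [show E * (Pk k N ^ 2 + D ^ 2 * N ^ ((k : ℝ) - 2) / 12) =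
      Pk k N ^ 2 * E + D ^ 2 / 12 * (N ^ ((k : ℝ) - 2) * E) by ring] at h1
    refine h1.trans ?_
    have b1 : 4 * L ^ 2 * (N ^ ((k : ℝ) - 4) * E / c) ≤ K * (N ^ ((k : ℝ) - 4) * E / c) :=
      mul_le_mul_of_nonneg_right k1 (by positivity)
    have b2 : D * L * (N ^ ((k : ℝ) - 3) * E) ≤ K * (N ^ ((k : ℝ) - 3) * E) :=
      mul_le_mul_of_nonneg_right k2 (by positivity)
    have b3 : D ^ 2 * (c * (N ^ ((k : ℝ) - 2) * E)) ≤ K * (c * (N ^ ((k : ℝ) - 2) * E)) :=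
      mul_le_mul_of_nonneg_right k3 (by positivity)
    calc _ = 5 * c * (Pk k N ^ 2 * E) + 4 * L ^ 2 * (N ^ ((k : ℝ) - 4) * E / c) +
          D * L * (N ^ ((k : ℝ) - 3) * E) + D ^ 2 * (c * (N ^ ((k : ℝ) - 2) * E)) := by ring
      _ ≤ 5 * c * (Pk k N ^ 2 * E) + K * (N ^ ((k : ℝ) - 4) * E / c) +
          K * (N ^ ((k : ℝ) - 3) * E) + K * (c * (N ^ ((k : ℝ) - 2) * E)) := by linarith
      _ = _ := by ring
  · rw [mul_comm _ E]
    refine h2.trans (add_le_add_right ?_ _)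
    have b1 : L ^ 2 * N ^ ((k : ℝ) - 4) ≤ L ^ 2 * N ^ ((k : ℝ) - 2) :=
      mul_le_mul_of_nonneg_left p4 (sq_nonneg L)
    have b2 : (D ^ 2 + 3 * L ^ 2) * N ^ ((k : ℝ) - 2) ≤ K * N ^ ((k : ℝ) - 2) :=
      mul_le_mul_of_nonneg_right (by rw [hK]; nlinarith [sq_nonneg L, mul_nonneg hD0 hL0]) q2.le
    calc _ ≤ E * (K * N ^ ((k : ℝ) - 2)) := mul_le_mul_of_nonneg_left (by linarith) hE.le
      _ = _ := by ring

theorem integral_Ioi_one_centredPk_sq_bounds {k : ℕ} (hk : 2 ≤ k) : ∃ C, 0 ≤ C ∧ ∀ c, 0 < c →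
    (∫ t in Set.Ioi (1 : ℝ), centredPk k t ^ 2 * Real.exp (-c * t)) ≤
      (∫ t in Set.Ioi (0 : ℝ), centredPk k t ^ 2 * Real.exp (-c * t)) ∧
    (∫ t in Set.Ioi (0 : ℝ), centredPk k t ^ 2 * Real.exp (-c * t)) - C ≤
      ∫ t in Set.Ioi (1 : ℝ), centredPk k t ^ 2 * Real.exp (-c * t) := by
  obtain ⟨C, hC, hle⟩ := exists_abs_centredPk_le hk
  refine ⟨(C * 2 ^ k) ^ 2, by positivity, fun c hc => ?_⟩
  have hint := integrableOn_centredPk_sq hk hc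
  have hadd : (∫ t in Set.Ioi (0 : ℝ), centredPk k t ^ 2 * Real.exp (-c * t)) =
      (∫ t in Set.Ioc (0 : ℝ) 1, centredPk k t ^ 2 * Real.exp (-c * t)) +
        ∫ t in Set.Ioi (1 : ℝ), centredPk k t ^ 2 * Real.exp (-c * t) := by
    rw [← setIntegral_union (Set.Ioc_disjoint_Ioi le_rfl) measurableSet_Ioi
      (hint.mono_set Set.Ioc_subset_Ioi_self) (hint.mono_set (Set.Ioi_subset_Ioi zero_le_one)),
      Set.Ioc_union_Ioi_eq_Ioi zero_le_one]
  have h0 : 0 ≤ ∫ t in Set.Ioc (0 : ℝ) 1, centredPk k t ^ 2 * Real.exp (-c * t) :=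
    setIntegral_nonneg measurableSet_Ioc fun t ht => by positivity
  have h1 : ∫ t in Set.Ioc (0 : ℝ) 1, centredPk k t ^ 2 * Real.exp (-c * t) ≤
      ∫ _ in Set.Ioc (0 : ℝ) 1, (C * 2 ^ k) ^ 2 := by
    refine setIntegral_mono_on (hint.mono_set Set.Ioc_subset_Ioi_self) (integrableOn_const (by simp)) measurableSet_Ioc fun t ht => ?_
    have h2 : |centredPk k t| ≤ C * 2 ^ k := (hle t ht.1.le).trans
      (mul_le_mul_of_nonneg_left (pow_le_pow_left₀ (by linarith [ht.1]) (by linarith [ht.2]) k) hC.le)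
    have h3 := pow_le_pow_left₀ (abs_nonneg _) h2 2
    rw [sq_abs] at h3
    calc _ ≤ (C * 2 ^ k) ^ 2 * 1 := mul_le_mul h3 (Real.exp_le_one_iff.2 (by nlinarith [ht.1]))
          (Real.exp_pos _).le (by positivity)
      _ = _ := mul_one _
  rw [show ∫ _ in Set.Ioc (0 : ℝ) 1, (C * 2 ^ k) ^ 2 = (C * 2 ^ k) ^ 2 by simp] at h1
  constructor <;> linarith

theorem exists_integral_centredPk_sq_sub_rpow_le {k : ℕ} (hk : 5 ≤ k) {ε : ℝ} (hε : 0 < ε) (hε1 : ε ≤ 1 / 2) :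
    ∃ C, 0 < C ∧ ∀ c, 0 < c → c ≤ 1 →
      |(∫ t in Set.Ioi 0, centredPk k t ^ 2 * Real.exp (-c * t)) -
        (∑' r, mainCoeff k r) / Real.Gamma ((k : ℝ) / 2) ^ 2 * (Real.Gamma ((k : ℝ) - 1) * c ^ (1 - (k : ℝ)))| ≤
      C * c ^ (2 - (k : ℝ) - ε) := by
  obtain ⟨C, hC, h⟩ := exists_integral_centredPk_sq_sub_le hk hε hε1
  refine ⟨C * (2⁻¹ : ℝ) ^ (2 - (k : ℝ) - ε), by positivity, fun c hc hc1 => ?_⟩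
  have := h (2⁻¹ * c) (by positivity) (by linarith)
  rw [mul_inv_cancel_left₀ two_ne_zero, Real.mul_rpow (by norm_num) hc.le, ← mul_assoc C] at this
  exact this

theorem exists_integral_centredPk_sq_le {k : ℕ} (hk : 5 ≤ k) :
    ∃ C, 0 < C ∧ ∀ c, 0 < c → c ≤ 1 →
      (∫ t in Set.Ioi 0, centredPk k t ^ 2 * Real.exp (-c * t)) ≤ C * c ^ (1 - (k : ℝ)) := by
  obtain ⟨C, hC, h⟩ := exists_integral_centredPk_sq_sub_rpow_le hk one_half_pos le_rfl
  set M := (∑' r, mainCoeff k r) / Real.Gamma ((k : ℝ) / 2) ^ 2 * Real.Gamma ((k : ℝ) - 1)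
  refine ⟨|M| + C, by positivity, fun c hc hc1 => ?_⟩
  have h1 := (abs_le.1 (h c hc hc1)).2
  rw [← mul_assoc] at h1
  have h2 : c ^ (2 - (k : ℝ) - 1 / 2) ≤ c ^ (1 - (k : ℝ)) :=
    Real.rpow_le_rpow_of_exponent_ge hc hc1 (by linarith)
  have h3 : 0 < c ^ (1 - (k : ℝ)) := by positivity
  have h4 := mul_le_mul_of_nonneg_left h2 hC.le
  have h5 := mul_le_mul_of_nonneg_right (le_abs_self M) h3.le
  linarith

set_option maxHeartbeats 1000000 in
theorem exists_tsum_Pk_sq_sub_le {k : ℕ} (hk : 5 ≤ k) : ∃ C, 0 < C ∧ ∀ c, 0 < c → c ≤ 1 →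
    Summable (fun n : ℕ => Pk k ((n : ℝ) + 1) ^ 2 * Real.exp (-c * ((n : ℝ) + 1))) ∧
    |∑' n : ℕ, Pk k ((n : ℝ) + 1) ^ 2 * Real.exp (-c * ((n : ℝ) + 1)) -
      ((∫ t in Set.Ioi 0, centredPk k t ^ 2 * Real.exp (-c * t)) -
        (Vk k * ((k : ℝ) / 2)) ^ 2 / 12 * (Real.Gamma ((k : ℝ) - 1) * c ^ (1 - (k : ℝ))))| ≤
      C * c ^ (2 - (k : ℝ)) := by
  have hk' : (5 : ℝ) ≤ k := by exact_mod_cast hk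
  obtain ⟨K, hK, hunit⟩ := exists_unit_integral_centredPk_sq_bounds (k := k) (by lia)
  obtain ⟨C₁, hC₁, hone⟩ := integral_Ioi_one_centredPk_sq_bounds (k := k) (by lia)
  obtain ⟨M, hM, hJ⟩ := exists_integral_centredPk_sq_le hk
  obtain ⟨C₂, hC₂, hpow⟩ := exists_tsum_rpow_mul_exp_sub_le (show 1 ≤ (k : ℝ) - 2 by linarith)
  have e2 : (k : ℝ) - 2 + 1 = k - 1 := by ring
  have e3 : (k : ℝ) - 3 + 1 = k - 2 := by ring
  have e4 : (k : ℝ) - 4 + 1 = k - 3 := by ring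
  set G₂ := Real.Gamma ((k : ℝ) - 1) with hG₂
  set G₃ := Real.Gamma ((k : ℝ) - 2) with hG₃
  set G₄ := Real.Gamma ((k : ℝ) - 3) with hG₄
  have g2 : 0 < G₂ := Real.Gamma_pos_of_pos (by linarith)
  have g3 : 0 < G₃ := Real.Gamma_pos_of_pos (by linarith)
  have g4 : 0 < G₄ := Real.Gamma_pos_of_pos (by linarith)
  set D := (Vk k * ((k : ℝ) / 2)) ^ 2 / 12 with hD
  have hD0 : 0 ≤ D := by positivity
  refine ⟨5 * (9 * M + K * (3 * G₂)) + K * (3 * G₄) + K * (3 * G₃) + K * (3 * G₂) + D * C₂ + C₁,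
    by positivity, fun c hc hc1 => ?_⟩
  have w2 := summable_rpow_mul_exp (show 0 ≤ (k : ℝ) - 2 by linarith) hc hc1
  have w3 := summable_rpow_mul_exp (show 0 ≤ (k : ℝ) - 3 by linarith) hc hc1
  have w4 := summable_rpow_mul_exp (show 0 ≤ (k : ℝ) - 4 by linarith) hc hc1
  have t2 := tsum_rpow_mul_exp_le (show 0 ≤ (k : ℝ) - 2 by linarith) hc hc1
  have t3 := tsum_rpow_mul_exp_le (show 0 ≤ (k : ℝ) - 3 by linarith) hc hc1
  have t4 := tsum_rpow_mul_exp_le (show 0 ≤ (k : ℝ) - 4 by linarith) hc hc1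
  have hp := hpow c hc hc1
  rw [e2, ← hG₂, neg_sub] at t2 hp
  rw [e3, ← hG₃, neg_sub] at t3
  rw [e4, ← hG₄, neg_sub] at t4
  rw [neg_sub] at hp
  have hI := hasSum_unit_integrals ((integrableOn_centredPk_sq (k := k) (by lia) hc).mono_set
    (Set.Ioi_subset_Ioi zero_le_one)) (fun t _ => by positivity)
  obtain ⟨o1, o2⟩ := hone c hc
  have hJc := hJ c hc hc1
  set p : ℕ → ℝ := fun n => Pk k ((n : ℝ) + 1) ^ 2 * Real.exp (-c * ((n : ℝ) + 1))
  set u₂ : ℕ → ℝ := fun n => ((n : ℝ) + 1) ^ ((k : ℝ) - 2) * Real.exp (-c * ((n : ℝ) + 1))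
  set u₃ : ℕ → ℝ := fun n => ((n : ℝ) + 1) ^ ((k : ℝ) - 3) * Real.exp (-c * ((n : ℝ) + 1))
  set u₄ : ℕ → ℝ := fun n => ((n : ℝ) + 1) ^ ((k : ℝ) - 4) * Real.exp (-c * ((n : ℝ) + 1))
  set a : ℕ → ℝ := fun n => ∫ t in ((n : ℝ) + 1)..((n : ℝ) + 1 + 1), centredPk k t ^ 2 * Real.exp (-c * t)
  set J := ∫ t in Set.Ioi (0 : ℝ), centredPk k t ^ 2 * Real.exp (-c * t)
  set J₁ := ∫ t in Set.Ioi (1 : ℝ), centredPk k t ^ 2 * Real.exp (-c * t)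
  have hp0 : ∀ n, 0 ≤ p n := fun n => by positivity
  have hle : ∀ n, p n ≤ 9 * a n + K * u₂ n := fun n => (hunit c hc hc1 n).2
  have hdiff : ∀ n, |a n - (p n + D * u₂ n)| ≤
      5 * c * p n + K / c * u₄ n + K * u₃ n + K * c * u₂ n := fun n => (hunit c hc hc1 n).1
  clear_value p u₂ u₃ u₄ a J J₁ D G₂ G₃ G₄
  have sp : Summable p := .of_nonneg_of_le hp0 hle ((hI.summable.mul_left 9).add (w2.mul_left K))
  have tp : ∑' n, p n ≤ 9 * J₁ + K * ∑' n, u₂ n := by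
    rw [← hI.tsum_eq, ← tsum_mul_left, ← tsum_mul_left,
      ← (hI.summable.mul_left 9).tsum_add (w2.mul_left K)]
    exact sp.tsum_le_tsum hle ((hI.summable.mul_left 9).add (w2.mul_left K))
  have key := hI.abs_tsum_sub_le ((((sp.mul_left (5 * c)).add (w4.mul_left (K / c))).add
    (w3.mul_left K)).add (w2.mul_left (K * c))) hdiff
  rw [sp.tsum_add (w2.mul_left D), (((sp.mul_left (5 * c)).add (w4.mul_left (K / c))).add
    (w3.mul_left K)).tsum_add (w2.mul_left (K * c)), ((sp.mul_left (5 * c)).add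
    (w4.mul_left (K / c))).tsum_add (w3.mul_left K), (sp.mul_left (5 * c)).tsum_add (w4.mul_left (K / c)),
    tsum_mul_left, tsum_mul_left, tsum_mul_left, tsum_mul_left, tsum_mul_left] at key
  refine ⟨sp, ?_⟩
  set P := ∑' n, p n
  set U₂ := ∑' n, u₂ n
  set U₃ := ∑' n, u₃ n
  set U₄ := ∑' n, u₄ n
  set z := c ^ (2 - (k : ℝ)) with hz
  have z1 : c * c ^ (1 - (k : ℝ)) = z := by
    rw [hz, ← Real.rpow_one_add' hc.le (by linarith)]; ring_nf
  have z3 : c ^ (3 - (k : ℝ)) / c = z := by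
    rw [hz, ← Real.rpow_sub_one hc.ne']; ring_nf
  have z0 : 1 ≤ z := Real.one_le_rpow_of_pos_of_le_one_of_nonpos hc hc1 (by linarith)
  have v1 : c * P ≤ (9 * M + K * (3 * G₂)) * z := by
    have : P ≤ (9 * M + K * (3 * G₂)) * c ^ (1 - (k : ℝ)) := by
      have := mul_le_mul_of_nonneg_left t2 hK
      linarith
    calc _ ≤ c * ((9 * M + K * (3 * G₂)) * c ^ (1 - (k : ℝ))) := mul_le_mul_of_nonneg_left this hc.le
      _ = _ := by rw [← z1]; ring
  have v2 : K * c * U₂ ≤ K * (3 * G₂) * z := by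
    calc _ ≤ K * c * (3 * G₂ * c ^ (1 - (k : ℝ))) := mul_le_mul_of_nonneg_left t2 (by positivity)
      _ = _ := by rw [← z1]; ring
  have v3 : K * U₃ ≤ K * (3 * G₃) * z := by
    calc _ ≤ K * (3 * G₃ * z) := mul_le_mul_of_nonneg_left t3 hK
      _ = _ := by ring
  have v4 : K / c * U₄ ≤ K * (3 * G₄) * z := by
    calc _ ≤ K / c * (3 * G₄ * c ^ (3 - (k : ℝ))) := mul_le_mul_of_nonneg_left t4 (by positivity)
      _ = _ := by rw [← z3]; ring
  have v5 : |D * (U₂ - G₂ * c ^ (1 - (k : ℝ)))| ≤ D * (C₂ * z) := by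
    rw [abs_mul, abs_of_nonneg hD0]
    exact mul_le_mul_of_nonneg_left hp hD0
  have v6 : C₁ ≤ C₁ * z := le_mul_of_one_le_right hC₁ z0
  rw [abs_le] at key v5 ⊢
  constructor <;> linarith

theorem Ck_eq {k : ℕ} (hk : 5 ≤ k) :
    (∑' r, mainCoeff k r) / Real.Gamma ((k : ℝ) / 2) ^ 2 - (Vk k * ((k : ℝ) / 2)) ^ 2 / 12 = Ck k := by
  have h : ((k : ℝ) ^ 2 / 24) * (Vk k) ^ 2 = (Vk k * ((k : ℝ) / 2)) ^ 2 / 6 := by ring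
  rw [Ck, h, Vk_mul_half_sq (by lia), tsum_mainCoeff hk, Real.rpow_natCast]
  ring

end

/-- smoothed second moment of the lattice point discrepancy, `k ≥ 5`. -/
theorem smooth_second_moment_high_dim (k : ℕ) (hk : 5 ≤ k) :
    ∀ ε : ℝ, 0 < ε → ∃ A : ℝ, 0 < A ∧ ∀ X : ℝ, 2 ≤ X →
      Summable (fun n : ℕ => Pk k ((n : ℝ) + 1) ^ 2 * Real.exp (-((n : ℝ) + 1) / X)) ∧
      |(∑' n : ℕ, Pk k ((n : ℝ) + 1) ^ 2 * Real.exp (-((n : ℝ) + 1) / X))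
          - Ck k * Real.Gamma ((k : ℝ) - 1) * X ^ ((k : ℝ) - 1)|
        ≤ A * X ^ ((k : ℝ) - 2 + ε) := by
  intro ε hε
  have hδ : 0 < min ε (1 / 2) := lt_min hε one_half_pos
  obtain ⟨B, hB, hmain⟩ := exists_integral_centredPk_sq_sub_rpow_le hk hδ (min_le_right _ _)
  obtain ⟨C, hC, hsum⟩ := exists_tsum_Pk_sq_sub_le hk
  refine ⟨B + C, by positivity, fun X hX => ?_⟩
  have hX0 : 0 < X := by linarith
  have hX1 : 1 ≤ X := by linarith
  have hc : 0 < X⁻¹ := by positivity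
  have hc1 : X⁻¹ ≤ 1 := inv_le_one_of_one_le₀ hX1
  obtain ⟨s, h1⟩ := hsum X⁻¹ hc hc1
  have h2 := hmain X⁻¹ hc hc1
  have he : ∀ n : ℕ, -X⁻¹ * ((n : ℝ) + 1) = -((n : ℝ) + 1) / X := fun n => by ring
  have hr : ∀ y : ℝ, X⁻¹ ^ y = X ^ (-y) := fun y => by rw [Real.inv_rpow hX0.le, Real.rpow_neg hX0.le]
  simp only [he] at s h1
  refine ⟨s, ?_⟩
  simp only [hr] at h1 h2
  rw [show -(1 - (k : ℝ)) = k - 1 by ring] at h1 h2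
  have m1 : X ^ (-(2 - (k : ℝ))) ≤ X ^ ((k : ℝ) - 2 + ε) :=
    Real.rpow_le_rpow_of_exponent_le hX1 (by linarith)
  have m2 : X ^ (-(2 - (k : ℝ) - min ε (1 / 2))) ≤ X ^ ((k : ℝ) - 2 + ε) :=
    Real.rpow_le_rpow_of_exponent_le hX1 (by linarith [min_le_left ε (1 / 2)])
  have n1 := mul_le_mul_of_nonneg_left m1 hC.le
  have n2 := mul_le_mul_of_nonneg_left m2 hB.le
  rw [← Ck_eq hk, sub_mul, sub_mul, mul_assoc, mul_assoc]
  rw [abs_le] at h1 h2 ⊢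
  constructor <;> linarith
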